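/- arXiv:2602.14220 — 4 statements merged into one kernel-verified Lean document; each statement's English description precedes it below -/
import Mathlib

section
/- Let p ≥ 1, let n : Fin p → ℕ with n i ≥ 1 for all i, let λ : Fin p → ℝ, let σ = Σ i, Fin (n i), let N = Σ i, n i, and let 𝒥 = Matrix.blockDiagonal' (fun i => J_{n i}(λ i)) on σ. Assume N is odd. If B is a skew-symmetric real matrix on σ with B * 𝒥 + 𝒥ᵀ * B = 0 and rank B = N − 1, then there exist an invertible matrix A on σ with A * 𝒥 = 𝒥 * A and a bijection e : σ ≃ Fin N such that reindexing Aᵀ * B * A along e yields the canonical rank-(N−1) form J_{(N,N−1)}. (Equivalently: B is congruent, via an invertible element of the commutant of 𝒥, to Pᵀ J_{(N,N−1)} P for a permutation matrix P.) -/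
open Matrix

noncomputable section

/-- The `n×n` real Jordan block with eigenvalue `λ` (0-based indices). -/
def jordanBlock (n : ℕ) (lam : ℝ) : Matrix (Fin n) (Fin n) ℝ :=
  Matrix.of fun i j => if j = i then lam else if (j : ℕ) = (i : ℕ) + 1 then 1 else 0

/-- The real Jordan block `C_n(a,b)` for a complex eigenvalue `a ± i b`, as a matrix of
`2×2` blocks indexed by `Fin n × Fin 2`. -/
def realJordanBlock (n : ℕ) (a b : ℝ) : Matrix (Fin n × Fin 2) (Fin n × Fin 2) ℝ :=
  Matrix.of fun p q =>
    if q.1 = p.1 then !![a, b; -b, a] p.2 q.2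
    else if (q.1 : ℕ) = (p.1 : ℕ) + 1 then (1 : Matrix (Fin 2) (Fin 2) ℝ) p.2 q.2
    else 0

/-- The canonical `2`-form of rank `R` (for `R` even, `R ≤ N`): the `N×N` matrix whose
top-left `R×R` block is `[[0, I_{R/2}], [-I_{R/2}, 0]]` and whose other entries vanish. -/
def canonJ (N R : ℕ) : Matrix (Fin N) (Fin N) ℝ :=
  Matrix.of fun i j =>
    if (i : ℕ) < R / 2 ∧ (j : ℕ) = (i : ℕ) + R / 2 then 1
    else if (j : ℕ) < R / 2 ∧ (i : ℕ) = (j : ℕ) + R / 2 then -1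
    else 0


namespace CF

structure Sys (V : Type) [AddCommGroup V] [Module ℝ V] where
  B : V →ₗ[ℝ] V →ₗ[ℝ] ℝ
  S : Module.End ℝ V
  P : ℝ → Module.End ℝ V
  F : Finset ℝ
  skew : ∀ x y, B x y = - B y x
  BS : ∀ x y, B (S x) y = - B x (S y)
  BP : ∀ μ x y, B (P μ x) y = B x (P (-μ) y)
  PS : ∀ μ x, P μ (S x) = S (P μ x)
  PP : ∀ μ x, P μ (P μ x) = P μ x
  PP0 : ∀ μ ν x, μ ≠ ν → P μ (P ν x) = 0
  sumP : ∀ x, ∑ μ ∈ F, P μ x = x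
  nil : ∃ M, S ^ M = 0

variable {V : Type} [AddCommGroup V] [Module ℝ V]

lemma descend {X : Type} (F : X → ℕ → ℝ) (n : ℕ) (x0 : X)
    (step : ∀ x a0, a0 < n → (∀ a, a0 < a → a < n → F x a = 0) →
      ∃ x', ∀ a, a0 ≤ a → a < n → F x' a = 0) : ∃ x, ∀ a, a < n → F x a = 0 := by
  have key : ∀ k, k ≤ n → ∃ x, ∀ a, n ≤ a + k → a < n → F x a = 0 := by
    intro k
    induction k with
    | zero => intro _; exact ⟨x0, fun a h1 h2 => by omega⟩
    | succ k ih =>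
      intro hk
      obtain ⟨x, hx⟩ := ih (by omega)
      obtain ⟨x', hx'⟩ := step x (n - (k+1)) (by omega) (fun a h1 h2 => hx a (by omega) h2)
      exact ⟨x', fun a h1 h2 => hx' a (by omega) h2⟩
  obtain ⟨x, hx⟩ := key n le_rfl
  exact ⟨x, fun a h => hx a (by omega) h⟩

namespace Sys
variable (s : Sys V)

lemma shift (e : ℕ) : ∀ x y, s.B ((s.S ^ e) x) y = (-1)^e * s.B x ((s.S ^ e) y) := by
  induction e with
  | zero => intro x y; simp
  | succ e ih =>
    intro x y
    rw [pow_succ' s.S e, Module.End.mul_apply, s.BS, ih, ← Module.End.mul_apply, ← pow_succ,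
      pow_succ' s.S e]
    ring

lemma shift2 (e a : ℕ) (x y : V) :
    s.B ((s.S ^ e) x) ((s.S ^ a) y) = (-1)^e * s.B x ((s.S ^ (a+e)) y) := by
  rw [shift, ← Module.End.mul_apply, ← pow_add, add_comm]

lemma swap (a : ℕ) (x y : V) :
    s.B x ((s.S ^ a) y) = (-1)^(a+1) * s.B y ((s.S ^ a) x) := by
  rw [s.skew, shift]; ring

lemma pp (a b : ℕ) (y : V) : (s.S ^ a) ((s.S ^ b) y) = (s.S ^ (a+b)) y := by
  rw [← Module.End.mul_apply, ← pow_add]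

lemma Ppow (μ : ℝ) (a : ℕ) (x : V) : s.P μ ((s.S ^ a) x) = (s.S ^ a) (s.P μ x) := by
  induction a with
  | zero => simp
  | succ a ih => rw [pow_succ', Module.End.mul_apply, s.PS, ih, Module.End.mul_apply]

lemma pow_mem {M : Submodule ℝ V} (hM : ∀ z ∈ M, s.S z ∈ M) (a : ℕ) {x : V} (hx : x ∈ M) :
    (s.S ^ a) x ∈ M := by
  induction a with
  | zero => simpa
  | succ a ih => rw [pow_succ', Module.End.mul_apply]; exact hM _ ih

lemma expand (a e f : ℕ) (c d : ℝ) (x y x' y' : V) :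
    s.B (x + c • (s.S ^ e) y) ((s.S ^ a) (x' + d • (s.S ^ f) y')) =
      s.B x ((s.S ^ a) x') + d * s.B x ((s.S ^ (a+f)) y')
      + c * ((-1)^e * s.B y ((s.S ^ (a+e)) x'))
      + c * d * ((-1)^e * s.B y ((s.S ^ (a+f+e)) y')) := by
  simp only [map_add, map_smul, LinearMap.add_apply, LinearMap.smul_apply, pp, shift2, smul_eq_mul]
  ring

lemma even_self (a : ℕ) (ha : Even a) (x : V) : s.B x ((s.S ^ a) x) = 0 := by
  have := s.swap a x x
  rw [pow_succ, ha.neg_one_pow] at this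
  linarith

lemma N1 (M : Submodule ℝ V) (hM : ∀ z ∈ M, s.S z ∈ M) (t : ℕ) (x : V) (hx : x ∈ M)
    (htop : s.B x ((s.S ^ t) x) ≠ 0) (hab : ∀ a, t < a → s.B x ((s.S ^ a) x) = 0) :
    ∃ x' ∈ M, (∃ c : ℝ, c ≠ 0 ∧ ∃ z ∈ M, x' = c • x + s.S z) ∧
      (s.B x' ((s.S ^ t) x') = 1 ∨ s.B x' ((s.S ^ t) x') = -1) ∧
      ∀ a, a ≠ t → s.B x' ((s.S ^ a) x') = 0 := by
  let X := {x' : V // x' ∈ M ∧ (∃ z ∈ M, x' = x + s.S z) ∧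
    s.B x' ((s.S ^ t) x') = s.B x ((s.S ^ t) x) ∧ ∀ a, t < a → s.B x' ((s.S ^ a) x') = 0}
  obtain ⟨⟨x', hx'M, ⟨z, hz, hxz⟩, h1, h2⟩, h3⟩ :=
    descend (X := X) (fun x' a => s.B x'.1 ((s.S ^ a) x'.1)) t
      ⟨x, hx, ⟨0, M.zero_mem, by simp⟩, rfl, hab⟩ (by
      rintro ⟨x', hx'M, ⟨z, hz, hxz⟩, h1, h2⟩ a0 ha0 h3
      simp only at h3
      rcases Nat.even_or_odd a0 with he | ho
      · refine ⟨⟨x', hx'M, ⟨z, hz, hxz⟩, h1, h2⟩, ?_⟩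
        intro a h4 h5
        rcases eq_or_lt_of_le h4 with h | h
        · subst h; exact s.even_self _ he _
        · exact h3 a h h5
      · have hto : Odd t := by
          by_contra h
          exact htop (s.even_self _ (Nat.not_odd_iff_even.mp h) _)
        obtain ⟨e, he⟩ : ∃ e, t = a0 + e := ⟨t - a0, by omega⟩
        have hee : Even e := by
          rw [he] at hto
          rcases Nat.even_or_odd e with h | h
          · exact h
          · exact absurd (ho.add_odd h) (Nat.not_even_iff_odd.mpr hto)
        have he1 : 1 ≤ e := by omega
        set c : ℝ := - s.B x' ((s.S ^ a0) x') / (2 * s.B x ((s.S ^ t) x)) with hc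
        have fm : ∀ a, s.B (x' + c • (s.S ^ e) x') ((s.S ^ a) (x' + c • (s.S ^ e) x')) =
            s.B x' ((s.S ^ a) x') + 2 * c * s.B x' ((s.S ^ (a+e)) x')
            + c * c * s.B x' ((s.S ^ (a+e+e)) x') := by
          intro a
          rw [expand, hee.neg_one_pow]; ring
        have hSe : ∃ z ∈ M, (s.S ^ e) x' = s.S z := by
          obtain ⟨e', rfl⟩ : ∃ e', e = e' + 1 := ⟨e - 1, by omega⟩
          exact ⟨(s.S ^ e') x', s.pow_mem hM _ hx'M, by rw [pow_succ', Module.End.mul_apply]⟩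
        obtain ⟨z', hz', hze⟩ := hSe
        refine ⟨⟨x' + c • (s.S ^ e) x', M.add_mem hx'M (M.smul_mem _ (s.pow_mem hM _ hx'M)),
          ⟨z + c • z', M.add_mem hz (M.smul_mem _ hz'), ?_⟩, ?_, ?_⟩, ?_⟩
        · rw [hze, map_add, map_smul, ← add_assoc, ← hxz]
        · rw [fm, h1, h2 (t+e) (by omega), h2 (t+e+e) (by omega)]; ring
        · intro a ha
          rw [fm, h2 a ha, h2 (a+e) (by omega), h2 (a+e+e) (by omega)]; ring
        · intro a h4 h5
          simp only
          rw [fm, h2 (a+e+e) (by omega)]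
          rcases eq_or_lt_of_le h4 with h | h
          · subst h
            rw [← he, h1, hc]; field_simp; ring
          · rw [h3 a h h5, h2 (a+e) (by omega)]; ring)
  simp only at h3
  set τ := s.B x ((s.S ^ t) x) with hτ
  have hpos : 0 < |τ| := abs_pos.mpr htop
  set k : ℝ := (Real.sqrt |τ|)⁻¹ with hk
  have hk0 : k ≠ 0 := inv_ne_zero (Real.sqrt_ne_zero'.mpr hpos)
  have hkk : k * k = |τ|⁻¹ := by
    rw [hk, ← mul_inv, Real.mul_self_sqrt hpos.le]
  have sc : ∀ a, s.B (k • x') ((s.S ^ a) (k • x')) = k * k * s.B x' ((s.S ^ a) x') := by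
    intro a; simp; ring
  refine ⟨k • x', M.smul_mem _ hx'M, ⟨k, hk0, k • z, M.smul_mem _ hz, ?_⟩, ?_, ?_⟩
  · rw [hxz]; simp
  · rw [sc, h1, hkk]
    rcases lt_or_gt_of_ne htop with h | h
    · right; rw [abs_of_neg h]; field_simp
    · left; rw [abs_of_pos h]; field_simp
  · intro a ha
    rw [sc]
    rcases lt_or_gt_of_ne ha with h | h
    · rw [h3 a h]; simp
    · rw [h2 a h]; simp

lemma N2a (M : Submodule ℝ V) (hM : ∀ z ∈ M, s.S z ∈ M) (t : ℕ) (x y : V) (hy : y ∈ M)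
    (htop : s.B x ((s.S ^ t) y) ≠ 0) (hxx : ∀ a, t ≤ a → s.B x ((s.S ^ a) x) = 0)
    (hyy : ∀ a, t ≤ a → s.B y ((s.S ^ a) y) = 0)
    (hxy : ∀ a, t < a → s.B x ((s.S ^ a) y) = 0) :
    ∃ x', (∃ z ∈ M, x' = x + s.S z) ∧ (∀ a, s.B x' ((s.S ^ a) x') = 0) ∧
      s.B x' ((s.S ^ t) y) ≠ 0 ∧ ∀ a, t < a → s.B x' ((s.S ^ a) y) = 0 := by
  let X := {x' : V // (∃ z ∈ M, x' = x + s.S z) ∧ (∀ a, t ≤ a → s.B x' ((s.S ^ a) x') = 0) ∧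
      s.B x' ((s.S ^ t) y) ≠ 0 ∧ ∀ a, t < a → s.B x' ((s.S ^ a) y) = 0}
  obtain ⟨⟨x', h0, h1, h2, h4⟩, h3⟩ :=
    descend (X := X) (fun x' a => s.B x'.1 ((s.S ^ a) x'.1)) t
      ⟨x, ⟨0, M.zero_mem, by simp⟩, hxx, htop, hxy⟩ (by
      rintro ⟨x', ⟨z, hz, hxz⟩, h1, h2, hab⟩ a0 ha0 h3
      simp only at h3
      rcases Nat.even_or_odd a0 with he | ho
      · refine ⟨⟨x', ⟨z, hz, hxz⟩, h1, h2, hab⟩, ?_⟩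
        intro a h4 h5
        rcases eq_or_lt_of_le h4 with h | h
        · subst h; exact s.even_self _ he _
        · exact h3 a h h5
      · obtain ⟨e, he⟩ : ∃ e, t = a0 + e := ⟨t - a0, by omega⟩
        have he1 : 1 ≤ e := by omega
        set c : ℝ := - s.B x' ((s.S ^ a0) x') / (2 * s.B x' ((s.S ^ t) y)) with hc
        have hyx : ∀ a, t < a → s.B y ((s.S ^ a) x') = 0 := by
          intro a ha; rw [swap, hab a ha]; simp
        have hSe : ∃ z ∈ M, (s.S ^ e) y = s.S z := by
          obtain ⟨e', rfl⟩ : ∃ e', e = e' + 1 := ⟨e - 1, by omega⟩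
          exact ⟨(s.S ^ e') y, s.pow_mem hM _ hy, by rw [pow_succ', Module.End.mul_apply]⟩
        obtain ⟨z', hz', hze⟩ := hSe
        have fy : ∀ a, t ≤ a → s.B (x' + c • (s.S ^ e) y) ((s.S ^ a) y) = s.B x' ((s.S ^ a) y) := by
          intro a ha
          have := s.expand a e 0 c 0 x' y y y
          simp only [zero_smul, add_zero] at this
          rw [this, hyy (a+e) (by omega)]; ring
        refine ⟨⟨x' + c • (s.S ^ e) y, 
          ⟨z + c • z', M.add_mem hz (M.smul_mem _ hz'), ?_⟩, ?_, ?_, ?_⟩, ?_⟩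
        · rw [hze, map_add, map_smul, ← add_assoc, ← hxz]
        · intro a ha
          rw [expand, h1 a ha, hab (a+e) (by omega), hyx (a+e) (by omega), hyy _ (by omega)]; ring
        · rwa [fy t le_rfl]
        · intro a ha
          rw [fy a ha.le, hab a ha]
        · intro a h4 h5
          simp only
          rw [expand, hyy (a+e+e) (by omega)]
          rcases eq_or_lt_of_le h4 with h | h
          · subst h
            have : (-1:ℝ)^e * s.B y ((s.S ^ (a0+e)) x') = s.B x' ((s.S ^ (a0+e)) y) := by
              rw [s.swap _ y x', ← mul_assoc, ← pow_add]
              have : Even (e + (a0 + e + 1)) := by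
                obtain ⟨k, rfl⟩ := ho
                exact ⟨e + k + 1, by ring⟩
              rw [this.neg_one_pow, one_mul]
            rw [this, ← he, hc]; field_simp; ring
          · rw [h3 a h h5, hab (a+e) (by omega), hyx (a+e) (by omega)]; ring)
  exact ⟨x', h0, fun a => if h : a < t then h3 a h else h1 a (by omega), h2, h4⟩

lemma N2b (M : Submodule ℝ V) (hM : ∀ z ∈ M, s.S z ∈ M) (t : ℕ) (x y : V) (hy : y ∈ M)
    (htop : s.B x ((s.S ^ t) y) ≠ 0) 
    (hyy : ∀ a, s.B y ((s.S ^ a) y) = 0)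
    (hxy : ∀ a, t < a → s.B x ((s.S ^ a) y) = 0) :
    ∃ y' ∈ M, (∀ a, s.B y' ((s.S ^ a) y') = 0) ∧
      s.B x ((s.S ^ t) y') = 1 ∧ ∀ a, a ≠ t → s.B x ((s.S ^ a) y') = 0 := by
  let X := {y' : V // y' ∈ M ∧ (∀ a, s.B y' ((s.S ^ a) y') = 0) ∧
      s.B x ((s.S ^ t) y') ≠ 0 ∧ ∀ a, t < a → s.B x ((s.S ^ a) y') = 0}
  obtain ⟨⟨y', h0, h1, h2, h4⟩, h3⟩ :=
    descend (X := X) (fun y' a => s.B x ((s.S ^ a) y'.1)) t ⟨y, hy, hyy, htop, hxy⟩ (by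
      rintro ⟨y', h0, h1, h2, hab⟩ a0 ha0 h3
      simp only at h3
      obtain ⟨e, he⟩ : ∃ e, t = a0 + e := ⟨t - a0, by omega⟩
      have he1 : 1 ≤ e := by omega
      set c : ℝ := - s.B x ((s.S ^ a0) y') / (s.B x ((s.S ^ t) y')) with hc
      have fx : ∀ a, s.B x ((s.S ^ a) (y' + c • (s.S ^ e) y')) = s.B x ((s.S ^ a) y')
          + c * s.B x ((s.S ^ (a+e)) y') := by
        intro a
        simp [pp]
      refine ⟨⟨y' + c • (s.S ^ e) y', M.add_mem h0 (M.smul_mem _ (s.pow_mem hM _ h0)), ?_, ?_, ?_⟩, ?_⟩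
      · intro a
        rw [expand]; simp [h1]
      · rwa [fx, hab (t+e) (by omega), mul_zero, add_zero]
      · intro a ha
        rw [fx, hab a ha, hab (a+e) (by omega)]; simp
      · intro a h4 h5
        simp only
        rw [fx]
        rcases eq_or_lt_of_le h4 with h | h
        · subst h; rw [← he, hc]; field_simp; ring
        · rw [h3 a h h5, hab (a+e) (by omega)]; ring)
  simp only at h3
  refine ⟨(s.B x ((s.S ^ t) y'))⁻¹ • y', M.smul_mem _ h0, ?_, ?_, ?_⟩
  · intro a; simp [h1]
  · simp [h2]
  · intro a ha
    rcases lt_or_gt_of_ne ha with h | h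
    · simp [h3 a h]
    · simp [h4 a h]

end Sys

namespace Sys
variable (s : Sys V)

def hm (W : Submodule ℝ V) (k : ℕ) (μ : ℝ) : Submodule ℝ V :=
  W ⊓ LinearMap.ker (s.S ^ k) ⊓ LinearMap.ker (s.P μ - 1)

lemma mem_hm {W : Submodule ℝ V} {k : ℕ} {μ : ℝ} {x : V} :
    x ∈ s.hm W k μ ↔ x ∈ W ∧ (s.S ^ k) x = 0 ∧ s.P μ x = x := by
  simp [hm, sub_eq_zero, and_assoc]

lemma hm_S {W : Submodule ℝ V} (hW : ∀ z ∈ W, s.S z ∈ W) (k : ℕ) (μ : ℝ) :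
    ∀ z ∈ s.hm W k μ, s.S z ∈ s.hm W k μ := by
  intro z hz
  rw [mem_hm] at hz ⊢
  refine ⟨hW _ hz.1, ?_, ?_⟩
  · rw [← Module.End.mul_apply, ← pow_succ, pow_succ', Module.End.mul_apply, hz.2.1, map_zero]
  · rw [s.PS, hz.2.2]

lemma pow_zero_of_le {k l : ℕ} (h : k ≤ l) {x : V} (hx : (s.S ^ k) x = 0) : (s.S ^ l) x = 0 := by
  obtain ⟨d, rfl⟩ := Nat.exists_eq_add_of_le h
  rw [add_comm, ← pp, hx, map_zero]

lemma orth_of_ne {μ ν : ℝ} (h : ν ≠ -μ) {x y : V} (hx : s.P μ x = x) (hy : s.P ν y = y) (a : ℕ) :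
    s.B x ((s.S ^ a) y) = 0 := by
  rw [← hx, s.BP, s.Ppow, ← hy, s.PP0 _ _ _ (Ne.symm h)]; simp

lemma normPair (W : Submodule ℝ V) (hW : ∀ z ∈ W, s.S z ∈ W) (t kx ky : ℕ) (h1 : ky ≤ kx)
    (h2 : kx ≤ ky + 1) (μ : ℝ) (x y : V) (hx : x ∈ s.hm W kx μ) (hy : y ∈ s.hm W ky (-μ))
    (htop : s.B x ((s.S ^ t) y) ≠ 0) (hxy : ∀ a, t < a → s.B x ((s.S ^ a) y) = 0)
    (hxx : ∀ a, t ≤ a → s.B x ((s.S ^ a) x) = 0)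
    (hyy : ∀ a, t ≤ a → s.B y ((s.S ^ a) y) = 0) :
    ∃ x' ∈ s.hm W kx μ, ∃ y' ∈ s.hm W ky (-μ), (∃ z, (s.S ^ ky) z = 0 ∧ x' = x + s.S z) ∧
      (∀ a, s.B x' ((s.S ^ a) x') = 0) ∧ (∀ a, s.B y' ((s.S ^ a) y') = 0) ∧
      s.B x' ((s.S ^ t) y') = 1 ∧ ∀ a, a ≠ t → s.B x' ((s.S ^ a) y') = 0 := by
  by_cases hμ : μ = 0
  · subst hμ
    rw [neg_zero] at hy ⊢
    obtain ⟨x', ⟨z, hz, hxz⟩, hx1, hx2, hx3⟩ :=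
      s.N2a (s.hm W ky 0) (s.hm_S hW _ _) t x y hy htop hxx hyy hxy
    have hle : s.hm W ky 0 ≤ s.hm W kx 0 := by
      intro u hu
      rw [mem_hm] at hu ⊢
      exact ⟨hu.1, s.pow_zero_of_le h1 hu.2.1, hu.2.2⟩
    have hx' : x' ∈ s.hm W kx 0 := by
      rw [hxz]; exact Submodule.add_mem _ hx (s.hm_S hW _ _ _ (hle hz))
    obtain ⟨y', ⟨w, hw, hyw⟩, hy1, hy2, hy3⟩ :=
      s.N2a (s.hm W kx 0) (s.hm_S hW _ _) t y x' hx' 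
        (by rw [swap]; simpa using hx2) hyy (fun a _ => hx1 a)
        (fun a ha => by rw [swap, hx3 a ha, mul_zero])
    have hy' : y' ∈ s.hm W ky 0 := by
      rw [hyw]; refine Submodule.add_mem _ hy ?_
      have := s.hm_S hW _ _ _ hw
      rw [mem_hm] at this hw ⊢
      refine ⟨this.1, ?_, this.2.2⟩
      rw [← Module.End.mul_apply, ← pow_succ]
      exact s.pow_zero_of_le h2 hw.2.1
    obtain ⟨y'', hy'', h3, h4, h5⟩ := s.N2b (s.hm W ky 0) (s.hm_S hW _ _) t x' y' hy'
      (by rw [swap]; simpa using hy2) hy1 (fun a ha => by rw [swap, hy3 a ha, mul_zero])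
    exact ⟨x', hx', y'', hy'', ⟨z, (s.mem_hm.mp hz).2.1, hxz⟩, hx1, h3, h4, h5⟩
  · have hyy0 : ∀ a, s.B y ((s.S ^ a) y) = 0 := fun a => s.orth_of_ne (μ := -μ) (ν := -μ)
      (by intro h; apply hμ; linarith) (s.mem_hm.mp hy).2.2 (s.mem_hm.mp hy).2.2 a
    have hxx0 : ∀ a, s.B x ((s.S ^ a) x) = 0 := fun a => s.orth_of_ne (μ := μ) (ν := μ)
      (by intro h; apply hμ; linarith) (s.mem_hm.mp hx).2.2 (s.mem_hm.mp hx).2.2 a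
    obtain ⟨y'', hy'', h3, h4, h5⟩ := s.N2b (s.hm W ky (-μ)) (s.hm_S hW _ _) t x y hy
      htop hyy0 hxy
    exact ⟨x, hx, y'', hy'', ⟨0, by simp, by simp⟩, hxx0, h3, h4, h5⟩

structure Chain {ι : Type} (n : ι → ℕ) (top : ι → V) (lam : ι → ℝ) : Prop where
  npos : ∀ i, 1 ≤ n i
  nil : ∀ i, (s.S ^ (n i)) (top i) = 0
  hom : ∀ i, s.P (lam i) (top i) = top i
  val : ∀ i j a, s.B (top i) ((s.S ^ a) (top j)) = 0 ∨ s.B (top i) ((s.S ^ a) (top j)) = 1 ∨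
    s.B (top i) ((s.S ^ a) (top j)) = -1
  uniq : ∀ i j a k c, s.B (top i) ((s.S ^ a) (top j)) ≠ 0 → s.B (top i) ((s.S ^ c) (top k)) ≠ 0 →
    j = k ∧ a = c

def Reg {ι : Type} (n : ι → ℕ) (top : ι → V) : Prop :=
  ∀ i, ∃ j, n j = n i ∧ s.B (top i) ((s.S ^ (n i - 1)) (top j)) ≠ 0

def vec {ι : Type} (n : ι → ℕ) (top : ι → V) (x : Σ i, Fin (n i)) : V :=
  (s.S ^ (x.2 : ℕ)) (top x.1)

section
variable {s}
variable {ι : Type} {n : ι → ℕ} {top : ι → V} {lam : ι → ℝ}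

lemma gram (x y : Σ i, Fin (n i)) : s.B (s.vec n top x) (s.vec n top y) =
    (-1)^(x.2:ℕ) * s.B (top x.1) ((s.S ^ ((y.2:ℕ) + x.2)) (top y.1)) := by
  rw [vec, vec, shift2]

lemma Chain.gval (h : s.Chain n top lam) (x y : Σ i, Fin (n i)) :
    s.B (s.vec n top x) (s.vec n top y) = 0 ∨ s.B (s.vec n top x) (s.vec n top y) = 1 ∨
    s.B (s.vec n top x) (s.vec n top y) = -1 := by
  rw [gram]
  rcases h.val x.1 y.1 ((y.2:ℕ) + x.2) with h | h | h <;> rw [h] <;>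
    rcases neg_one_pow_eq_or ℝ (x.2:ℕ) with h | h <;> rw [h] <;> simp

lemma Chain.guniq (h : s.Chain n top lam) (x y z : Σ i, Fin (n i))
    (h1 : s.B (s.vec n top x) (s.vec n top y) ≠ 0) (h2 : s.B (s.vec n top x) (s.vec n top z) ≠ 0) :
    y = z := by
  rw [gram] at h1 h2
  obtain ⟨h3, h4⟩ := h.uniq _ _ _ _ _ (right_ne_zero_of_mul h1) (right_ne_zero_of_mul h2)
  obtain ⟨y1, y2⟩ := y
  obtain ⟨z1, z2⟩ := z
  simp only at h3 h4
  subst h3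
  congr 1
  ext
  omega

lemma Reg.row (h : s.Reg n top) (x : Σ i, Fin (n i)) :
    ∃ y, s.B (s.vec n top x) (s.vec n top y) ≠ 0 := by
  obtain ⟨i, a⟩ := x
  obtain ⟨j, h1, h2⟩ := h i
  have ha := a.2
  refine ⟨⟨j, ⟨n i - 1 - a, by omega⟩⟩, ?_⟩
  rw [gram]
  have : n i - 1 - (a:ℕ) + a = n i - 1 := by omega
  simp only [this]
  simpa using h2

lemma Chain.proj [Fintype ι] (h : s.Chain n top lam)
    (hr : ∀ x, (∃ y, s.B (s.vec n top x) (s.vec n top y) ≠ 0) ∨ ∀ z, s.B (s.vec n top x) z = 0)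
    (z : V) : ∃ u ∈ Submodule.span ℝ (Set.range (s.vec n top)),
      ∀ x, s.B (s.vec n top x) (z - u) = 0 := by
  refine ⟨∑ x, (∑ y, s.B (s.vec n top y) (s.vec n top x) * s.B (s.vec n top y) z) • s.vec n top x,
    Submodule.sum_mem _ fun x _ => Submodule.smul_mem _ _ (Submodule.subset_span ⟨x, rfl⟩), ?_⟩
  intro x
  rcases hr x with ⟨y, hy⟩ | h0
  · have hin : (∑ y', s.B (s.vec n top y') (s.vec n top y) * s.B (s.vec n top y') z) =
        s.B (s.vec n top x) (s.vec n top y) * s.B (s.vec n top x) z := by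
      refine Finset.sum_eq_single x (fun w _ hw => ?_) (by simp)
      by_contra hne
      have h1 := left_ne_zero_of_mul hne
      rw [s.skew] at h1
      rw [s.skew] at hy
      exact hw (h.guniq y w x (neg_ne_zero.mp h1) (neg_ne_zero.mp hy))
    rw [map_sub, map_sum, Finset.sum_eq_single y, hin]
    · rw [map_smul, smul_eq_mul]
      rcases h.gval x y with h | h | h
      · exact absurd h hy
      · rw [h]; ring
      · rw [h]; ring
    · intro w _ hw
      rw [map_smul, smul_eq_mul]
      have : s.B (s.vec n top x) (s.vec n top w) = 0 := by
        by_contra hne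
        exact hw (h.guniq x w y hne hy)
      rw [this, mul_zero]
    · simp
  · exact h0 _

end
end Sys

namespace Sys
variable {s : Sys V}
variable {ι : Type} {n : ι → ℕ} {top : ι → V} {lam : ι → ℝ}

lemma Chain.li_aux [Fintype ι] (h : s.Chain n top lam) (c : (Σ i, Fin (n i)) → ℝ)
    (hc : ∑ x, c x • s.vec n top x = 0) (x y : Σ i, Fin (n i))
    (hxy : s.B (s.vec n top x) (s.vec n top y) ≠ 0) : c x = 0 := by
  have h1 := congrArg (fun v => s.B (s.vec n top y) v) hc
  rw [s.skew] at hxy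
  have hxy := neg_ne_zero.mp hxy
  simp only [map_sum, map_zero] at h1
  rw [Finset.sum_eq_single x] at h1
  · rw [map_smul, smul_eq_mul] at h1
    exact (mul_eq_zero.mp h1).resolve_right hxy
  · intro w _ hw
    rw [map_smul, smul_eq_mul]
    have : s.B (s.vec n top y) (s.vec n top w) = 0 := by
      by_contra hne
      exact hw (h.guniq y w x hne hxy)
    rw [this, mul_zero]
  · simp

lemma Chain.li_reg [Fintype ι] (h : s.Chain n top lam) (hr : s.Reg n top) :
    LinearIndependent ℝ (s.vec n top) := by
  rw [Fintype.linearIndependent_iff]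
  intro c hc x
  obtain ⟨y, hy⟩ := hr.row x
  exact h.li_aux c hc x y hy

lemma Chain.li_sing [Fintype ι] (h : s.Chain n top lam) (x0 : Σ i, Fin (n i))
    (h0 : s.vec n top x0 ≠ 0)
    (hr : ∀ x, x ≠ x0 → ∃ y, s.B (s.vec n top x) (s.vec n top y) ≠ 0) :
    LinearIndependent ℝ (s.vec n top) := by
  rw [Fintype.linearIndependent_iff]
  intro c hc
  have h1 : ∀ x, x ≠ x0 → c x = 0 := by
    intro x hx
    obtain ⟨y, hy⟩ := hr x hx
    exact h.li_aux c hc x y hy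
  intro x
  by_cases hx : x = x0
  · subst hx
    rw [Finset.sum_eq_single x] at hc
    · exact (smul_eq_zero.mp hc).resolve_right h0
    · intro b _ hb; rw [h1 b hb, zero_smul]
    · simp
  · exact h1 x hx

lemma single_chain {x : V} {k : ℕ} {μ : ℝ} (hk : 1 ≤ k) (hx : (s.S ^ k) x = 0)
    (hμ : s.P μ x = x)
    (hv : ∀ a, s.B x ((s.S ^ a) x) = 0 ∨ s.B x ((s.S ^ a) x) = 1 ∨ s.B x ((s.S ^ a) x) = -1)
    (hu : ∀ a c, s.B x ((s.S ^ a) x) ≠ 0 → s.B x ((s.S ^ c) x) ≠ 0 → a = c) :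
    s.Chain (ι := Unit) (fun _ => k) (fun _ => x) (fun _ => μ) where
  npos := fun _ => hk
  nil := fun _ => hx
  hom := fun _ => hμ
  val := fun _ _ a => hv a
  uniq := fun _ _ a _ c h1 h2 => ⟨rfl, hu a c h1 h2⟩

lemma pair_chain {x y : V} {kx ky : ℕ} {μ ν : ℝ} {t : ℕ} (hkx : 1 ≤ kx) (hky : 1 ≤ ky)
    (hx : (s.S ^ kx) x = 0) (hy : (s.S ^ ky) y = 0)
    (hμ : s.P μ x = x) (hν : s.P ν y = y)
    (hxx : ∀ a, s.B x ((s.S ^ a) x) = 0) (hyy : ∀ a, s.B y ((s.S ^ a) y) = 0)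
    (h1 : s.B x ((s.S ^ t) y) = 1) (h0 : ∀ a, a ≠ t → s.B x ((s.S ^ a) y) = 0) :
    s.Chain (ι := Bool) (fun b => bif b then ky else kx) (fun b => bif b then y else x)
      (fun b => bif b then ν else μ) where
  npos := by rintro (_ | _) <;> simpa
  nil := by rintro (_ | _) <;> simpa
  hom := by rintro (_ | _) <;> simpa
  val := by
    have hv : ∀ a, s.B x ((s.S ^ a) y) = 0 ∨ s.B x ((s.S ^ a) y) = 1 ∨
        s.B x ((s.S ^ a) y) = -1 := by
      intro a
      by_cases h : a = t
      · subst h; simp [h1]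
      · simp [h0 a h]
    rintro (_ | _) (_ | _) a
    · simp [hxx]
    · simpa using hv a
    · simp only [cond_true, cond_false]
      rw [s.swap]
      rcases hv a with h | h | h <;> rw [h] <;>
        rcases neg_one_pow_eq_or ℝ (a+1) with h | h <;> rw [h] <;> simp
    · simp [hyy]
  uniq := by
    have hv : ∀ a, s.B x ((s.S ^ a) y) ≠ 0 → a = t := fun a h => by
      by_contra h'; exact h (h0 a h')
    have hv' : ∀ a, s.B y ((s.S ^ a) x) ≠ 0 → a = t := fun a h => by
      rw [s.swap] at h
      exact hv a (right_ne_zero_of_mul h)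
    rintro (_ | _) (_ | _) a (_ | _) c <;> simp only [cond_true, cond_false] <;> intro h h'
    all_goals first
      | exact absurd (hxx _) h
      | exact absurd (hyy _) h
      | exact absurd (hxx _) h'
      | exact absurd (hyy _) h'
      | exact ⟨by simp, (hv _ h).trans (hv _ h').symm⟩
      | exact ⟨by simp, (hv' _ h).trans (hv' _ h').symm⟩

lemma sum_chain {ι' : Type} {n' : ι' → ℕ} {top' : ι' → V} {lam' : ι' → ℝ}
    (h : s.Chain n top lam) (h' : s.Chain n' top' lam')
    (ho : ∀ i j a, s.B (top i) ((s.S ^ a) (top' j)) = 0) :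
    s.Chain (Sum.elim n n') (Sum.elim top top') (Sum.elim lam lam') := by
  have ho' : ∀ i j a, s.B (top' j) ((s.S ^ a) (top i)) = 0 := by
    intro i j a; rw [s.swap, ho, mul_zero]
  refine ⟨?_, ?_, ?_, ?_, ?_⟩
  · rintro (i | i) <;> simp [h.npos, h'.npos]
  · rintro (i | i) <;> simp [h.nil, h'.nil]
  · rintro (i | i) <;> simp [h.hom, h'.hom]
  · rintro (i | i) (j | j) a <;> simp [ho, ho', h.val, h'.val]
  · rintro (i | i) (j | j) a (k | k) c <;> simp only [Sum.elim_inl, Sum.elim_inr] <;> intro h1 h2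
    all_goals first
      | exact absurd (ho _ _ _) h1
      | exact absurd (ho _ _ _) h2
      | exact absurd (ho' _ _ _) h1
      | exact absurd (ho' _ _ _) h2
      | (obtain ⟨h3, h4⟩ := h.uniq _ _ _ _ _ h1 h2; subst h3; exact ⟨rfl, h4⟩)
      | (obtain ⟨h3, h4⟩ := h'.uniq _ _ _ _ _ h1 h2; subst h3; exact ⟨rfl, h4⟩)

lemma sum_reg {ι' : Type} {n' : ι' → ℕ} {top' : ι' → V} 
    (h : s.Reg n top) (h' : s.Reg n' top') : s.Reg (Sum.elim n n') (Sum.elim top top') := by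
  rintro (i | i)
  · obtain ⟨j, h1, h2⟩ := h i
    exact ⟨Sum.inl j, h1, h2⟩
  · obtain ⟨j, h1, h2⟩ := h' i
    exact ⟨Sum.inr j, h1, h2⟩

lemma gamma_zero (W : Submodule ℝ V) (hW : ∀ z ∈ W, s.S z ∈ W) (hP : ∀ μ, ∀ z ∈ W, s.P μ z ∈ W)
    (hno : ∀ (ι : Type) (_ : Fintype ι) (_ : Nonempty ι) (n : ι → ℕ) (top : ι → V) (lam : ι → ℝ),
      s.Chain n top lam → s.Reg n top → ¬ (∀ i, top i ∈ W))
    (j : ℕ) (x : V) (hx : x ∈ W) (y : V) (hy : y ∈ W) (hxj : (s.S ^ (j+1)) x = 0)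
    (hyj : (s.S ^ (j+1)) y = 0) : s.B x ((s.S ^ j) y) = 0 := by
  have big : ∀ x y : V, (s.S ^ (j+1)) y = 0 → ∀ a, j < a → s.B x ((s.S ^ a) y) = 0 := by
    intro x y hy a ha
    rw [s.pow_zero_of_le (l := a) ha hy, map_zero]
  have H0 : ∀ x ∈ s.hm W (j+1) 0, s.B x ((s.S ^ j) x) = 0 := by
    intro x hx
    by_contra hne
    obtain ⟨x', hx', -, h1, h2⟩ := s.N1 (s.hm W (j+1) 0) (s.hm_S hW _ _) j x hx hne
      (big x x (s.mem_hm.mp hx).2.1)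
    obtain ⟨h3, h4, h5⟩ := s.mem_hm.mp hx'
    refine hno Unit inferInstance inferInstance _ _ _ (single_chain (s := s) (k := j+1)
      (by omega) h4 h5 ?_ ?_) ?_ (fun _ => h3)
    · intro a
      by_cases ha : a = j
      · subst ha; exact Or.inr h1
      · exact Or.inl (h2 a ha)
    · intro a c ha hc
      have ha : a = j := by by_contra h; exact ha (h2 a h)
      have hc : c = j := by by_contra h; exact hc (h2 c h)
      rw [ha, hc]
    · intro i
      refine ⟨i, rfl, ?_⟩
      simp only [Nat.add_sub_cancel]
      rcases h1 with h | h <;> rw [h] <;> norm_num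
  have H1 : ∀ μ, ∀ x ∈ s.hm W (j+1) μ, ∀ y ∈ s.hm W (j+1) (-μ), s.B x ((s.S ^ j) y) = 0 := by
    intro μ x hx y hy
    by_contra hne
    have self : ∀ ν, ∀ x ∈ s.hm W (j+1) ν, ∀ a, j ≤ a → s.B x ((s.S ^ a) x) = 0 := by
      intro ν x hx a ha
      by_cases hν : ν = 0
      · subst hν
        rcases eq_or_lt_of_le ha with h | h
        · subst h; exact H0 x hx
        · exact big x x (s.mem_hm.mp hx).2.1 a h
      · exact s.orth_of_ne (μ := ν) (ν := ν) (by intro h; apply hν; linarith)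
          (s.mem_hm.mp hx).2.2 (s.mem_hm.mp hx).2.2 a
    obtain ⟨x', hx', y', hy', -, h1, h2, h3, h4⟩ := s.normPair W hW j (j+1) (j+1) le_rfl (by omega)
      μ x y hx hy hne (big x y (s.mem_hm.mp hy).2.1) (self _ x hx) (self _ y hy)
    obtain ⟨hx1, hx2, hx3⟩ := s.mem_hm.mp hx'
    obtain ⟨hy1, hy2, hy3⟩ := s.mem_hm.mp hy'
    refine hno Bool inferInstance inferInstance _ _ _ (pair_chain (s := s) (by omega) (by omega) 
      hx2 hy2 hx3 hy3 h1 h2 h3 h4) ?_ ?_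
    · rintro (_ | _)
      · exact ⟨true, rfl, by simp [h3]⟩
      · refine ⟨false, rfl, ?_⟩
        simp only [cond_true, cond_false, Nat.add_sub_cancel]
        rw [s.swap, h3]; simp
    · rintro (_ | _) <;> simpa
  have hmP : ∀ x ∈ W, (s.S ^ (j+1)) x = 0 → ∀ μ, s.P μ x ∈ s.hm W (j+1) μ := by
    intro x hx hxj μ
    rw [s.mem_hm]
    exact ⟨hP _ _ hx, by rw [← s.Ppow, hxj, map_zero], s.PP _ _⟩
  rw [← s.sumP x, map_sum, LinearMap.sum_apply]
  refine Finset.sum_eq_zero fun μ _ => ?_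
  rw [← s.PP, s.BP, s.Ppow]
  exact H1 μ _ (hmP x hx hxj μ) _ (hmP y hy hyj (-μ))

end Sys

namespace Sys
variable {s : Sys V}

lemma endgame (W Z : Submodule ℝ V) (hW : ∀ z ∈ W, s.S z ∈ W) (hZW : Z ≤ W)
    (hZS : ∀ z ∈ Z, s.S z ∈ Z) (v : V) (hv : v ≠ 0)
    (hrad : ∀ x ∈ W, (∀ y ∈ W, s.B x y = 0) → ∃ c : ℝ, x = c • v)
    (hno : ∀ j, ∀ x ∈ W, ∀ y ∈ W, (s.S ^ (j+1)) x = 0 → (s.S ^ (j+1)) y = 0 →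
      s.B x ((s.S ^ j) y) = 0)
    (t : ℕ) (w : V) (hw : w ∈ W) (hwv : (s.S ^ (t+1)) w = v)
    (hww : ∀ a, t < a → s.B w ((s.S ^ a) w) = 0) (hZw : ∀ u ∈ Z, ∀ a, s.B u ((s.S ^ a) w) = 0)
    (hproj : ∀ z ∈ W, ∃ u, z - u ∈ Z ∧ ∀ u' ∈ Z, s.B u' u = 0)
    (hZt : ∀ u ∈ Z, (s.S ^ (t+1)) u = 0) : ∀ u ∈ Z, ∃ c : ℝ, u = c • v := by
  have key : ∀ d j, j + d = t + 1 → ∀ u ∈ Z, ∃ c : ℝ, (s.S ^ j) u = c • v := by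
    intro d
    induction d with
    | zero =>
      intro j hj u hu
      rw [add_zero] at hj
      exact ⟨0, by rw [hj, hZt u hu, zero_smul]⟩
    | succ d ih =>
      intro j hj u hu
      apply hrad _ (s.pow_mem hW _ (hZW hu))
      intro z0 hz0
      obtain ⟨p, hp, hp'⟩ := hproj z0 hz0
      have e1 : s.B ((s.S ^ j) u) z0 = s.B ((s.S ^ j) u) (z0 - p) := by
        rw [map_sub, hp' _ (s.pow_mem hZS j hu), sub_zero]
      rw [e1]
      generalize z0 - p = z at hp
      obtain ⟨a, ha⟩ := ih (j+1) (by omega) u hu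
      obtain ⟨b, hb⟩ := ih (j+1) (by omega) z hp
      obtain ⟨e, he⟩ : ∃ e, t = j + e := ⟨t - j, by omega⟩
      have kz : ∀ (u : V) (a : ℝ), (s.S ^ (j+1)) u = a • v →
          (s.S ^ (j+1)) (u + (-a) • (s.S ^ e) w) = 0 := by
        intro u a ha
        rw [map_add, map_smul, ha, s.pp, show j + 1 + e = t + 1 by omega, hwv]
        simp
      have h0 := hno j (z + (-b) • (s.S ^ e) w) (W.add_mem (hZW hp) (W.smul_mem _ (s.pow_mem hW _ hw)))
        (u + (-a) • (s.S ^ e) w) (W.add_mem (hZW hu) (W.smul_mem _ (s.pow_mem hW _ hw)))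
        (kz z b hb) (kz u a ha)
      rw [s.expand, hZw z hp, s.swap _ w u, hZw u hu] at h0
      have h4 : (-b) * (-a) * ((-1)^e * s.B w ((s.S ^ (j+e+e)) w)) = 0 := by
        by_cases he0 : e = 0
        · subst he0
          have : a = 0 := by
            have h5 := hZt u hu
            rw [show t + 1 = j + 1 by omega, ha] at h5
            exact (smul_eq_zero.mp h5).resolve_right hv
          rw [this]; ring
        · rw [hww _ (by omega)]; ring
      rw [h4] at h0
      have h5 : s.B z ((s.S ^ j) u) = 0 := by simpa using h0
      rw [s.skew, h5, neg_zero]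
  intro u hu
  simpa using key (t+1) 0 (by omega) u hu

lemma finish (W : Submodule ℝ V) (hW : ∀ z ∈ W, s.S z ∈ W) (v : V) (hv : v ≠ 0)
    (hker : ∀ y, s.B v y = 0)
    (hrad : ∀ x ∈ W, (∀ y ∈ W, s.B x y = 0) → ∃ c : ℝ, x = c • v)
    (hno : ∀ j, ∀ x ∈ W, ∀ y ∈ W, (s.S ^ (j+1)) x = 0 → (s.S ^ (j+1)) y = 0 →
      s.B x ((s.S ^ j) y) = 0)
    (t : ℕ) {ι : Type} [Fintype ι] {n : ι → ℕ} {top : ι → V} {lam : ι → ℝ}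
    (hc : s.Chain n top lam) (htW : ∀ i, top i ∈ W) (x0 : Σ i, Fin (n i))
    (hx0 : (x0.2 : ℕ) = t + 1) (hx0v : s.vec n top x0 = v)
    (hww : ∀ a, t < a → s.B (top x0.1) ((s.S ^ a) (top x0.1)) = 0)
    (hr : ∀ x, x ≠ x0 → ∃ y, s.B (s.vec n top x) (s.vec n top y) ≠ 0)
    (hZt : ∀ u ∈ W, (∀ i a, s.B u ((s.S ^ a) (top i)) = 0) → (s.S ^ (t+1)) u = 0) :
    W ≤ Submodule.span ℝ (Set.range (s.vec n top)) := by
  let Z : Submodule ℝ V :=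
    { carrier := {u | u ∈ W ∧ ∀ i a, s.B u ((s.S ^ a) (top i)) = 0}
      add_mem' := by
        rintro a b ⟨h1, h2⟩ ⟨h3, h4⟩
        exact ⟨W.add_mem h1 h3, fun i c => by simp [h2, h4]⟩
      zero_mem' := ⟨W.zero_mem, by simp⟩
      smul_mem' := by
        rintro c x ⟨h1, h2⟩
        exact ⟨W.smul_mem _ h1, fun i a => by simp [h2]⟩ }
  have hspan : Submodule.span ℝ (Set.range (s.vec n top)) ≤ W := by
    rw [Submodule.span_le]
    rintro _ ⟨x, rfl⟩
    exact s.pow_mem hW _ (htW _)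
  have hproj : ∀ z ∈ W, ∃ u ∈ Submodule.span ℝ (Set.range (s.vec n top)), z - u ∈ Z := by
    intro z hz
    obtain ⟨u, hu, hu'⟩ := hc.proj (by
      intro x
      by_cases hx : x = x0
      · right; rw [hx, hx0v]; exact hker
      · left; exact hr x hx) z
    refine ⟨u, hu, W.sub_mem hz (hspan hu), ?_⟩
    intro i a
    by_cases ha : a < n i
    · have := hu' ⟨i, ⟨a, ha⟩⟩
      rw [s.skew, neg_eq_zero]
      exact this
    · rw [s.pow_zero_of_le (by omega) (hc.nil i), map_zero]
  have horth : ∀ u ∈ Submodule.span ℝ (Set.range (s.vec n top)), ∀ u' ∈ Z, s.B u' u = 0 := by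
    intro u hu u' hu'
    induction hu using Submodule.span_induction with
    | mem x hx => obtain ⟨y, rfl⟩ := hx; exact hu'.2 _ _
    | zero => simp
    | add x y _ _ h1 h2 => rw [map_add, h1, h2, add_zero]
    | smul c x _ h1 => rw [map_smul, h1, smul_zero]
  have hZ := endgame (s := s) W Z hW (fun u hu => hu.1) (by
    rintro z ⟨h1, h2⟩
    refine ⟨hW _ h1, fun i a => ?_⟩
    rw [s.BS, ← Module.End.mul_apply, ← pow_succ', h2, neg_zero]) v hv hrad hno t (top x0.1)
    (htW _) (by rw [← hx0v, vec, hx0]) hww (fun u hu a => hu.2 _ a)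
    (fun z hz => by
      obtain ⟨u, hu, hu'⟩ := hproj z hz
      exact ⟨u, hu', horth u hu⟩) (fun u hu => hZt u hu.1 hu.2)
  intro z hz
  obtain ⟨u, hu, hu'⟩ := hproj z hz
  obtain ⟨c, hc⟩ := hZ _ hu'
  have : z = c • s.vec n top x0 + u := by rw [hx0v, ← hc]; simp
  rw [this]
  exact Submodule.add_mem _ (Submodule.smul_mem _ _ (Submodule.subset_span ⟨x0, rfl⟩)) hu

lemma core (W : Submodule ℝ V) (hW : ∀ z ∈ W, s.S z ∈ W) (hP : ∀ μ, ∀ z ∈ W, s.P μ z ∈ W)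
    (v : V) (hv : v ≠ 0) (hvW : v ∈ W) (hker : ∀ y, s.B v y = 0)
    (hrad : ∀ x ∈ W, (∀ y ∈ W, s.B x y = 0) → ∃ c : ℝ, x = c • v)
    (hno : ∀ j, ∀ x ∈ W, ∀ y ∈ W, (s.S ^ (j+1)) x = 0 → (s.S ^ (j+1)) y = 0 →
      s.B x ((s.S ^ j) y) = 0) :
    ∃ (ι : Type) (_ : Fintype ι) (n : ι → ℕ) (top : ι → V) (lam : ι → ℝ),
      s.Chain n top lam ∧ (∀ i, top i ∈ W) ∧ (∃ x0, s.vec n top x0 ≠ 0 ∧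
        (∀ y, s.B (s.vec n top x0) y = 0) ∧
        ∀ x, x ≠ x0 → ∃ y, s.B (s.vec n top x) (s.vec n top y) ≠ 0) ∧
      W ≤ Submodule.span ℝ (Set.range (s.vec n top)) := by
  classical
  obtain ⟨μ, hμ⟩ : ∃ μ, s.P μ v = v := by
    have h1 : ∀ μ, ∃ c : ℝ, s.P μ v = c • v := by
      intro μ
      apply hrad _ (hP _ _ hvW)
      intro y _
      rw [s.BP, hker]
    obtain ⟨μ, h2⟩ : ∃ μ, s.P μ v ≠ 0 := by
      by_contra! h
      apply hv
      rw [← s.sumP v]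
      exact Finset.sum_eq_zero fun μ _ => h μ
    refine ⟨μ, ?_⟩
    obtain ⟨c, h3⟩ := h1 μ
    have h4 := s.PP μ v
    rw [h3, map_smul, h3] at h4
    have hc0 : c ≠ 0 := by rintro rfl; exact h2 (by rw [h3, zero_smul])
    rw [h3]
    exact smul_right_injective V hc0 h4
  have hex : ∃ m, ∀ z ∈ W, (s.S ^ m) z = 0 := by
    obtain ⟨M, hM⟩ := s.nil
    exact ⟨M, fun z _ => by rw [hM]; rfl⟩
  obtain ⟨q, hq⟩ : ∃ q, Nat.find hex = q + 1 := by
    refine Nat.exists_eq_succ_of_ne_zero fun h => hv ?_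
    have := Nat.find_spec hex v hvW
    rw [h] at this
    simpa using this
  have hq1 : ∀ z ∈ W, (s.S ^ (q+1)) z = 0 := hq ▸ Nat.find_spec hex
  obtain ⟨z0, hz0W, hz0⟩ : ∃ z ∈ W, (s.S ^ q) z ≠ 0 := by
    have := Nat.find_min hex (m := q) (by omega)
    push Not at this
    exact this
  have hbig : ∀ x ∈ W, ∀ y ∈ W, ∀ a, q ≤ a → s.B x ((s.S ^ a) y) = 0 := by
    intro x hx y hy a ha
    rcases eq_or_lt_of_le ha with h | h
    · subst h; exact hno q x hx y hy (hq1 x hx) (hq1 y hy)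
    · rw [s.pow_zero_of_le (l := a) h (hq1 y hy), map_zero]
  have htopv : ∀ z ∈ W, ∃ c : ℝ, (s.S ^ q) z = c • v := by
    intro z hz
    apply hrad _ (s.pow_mem hW _ hz)
    intro y hy
    rw [s.shift, hbig z hz y hy q le_rfl, mul_zero]
  obtain ⟨w, hw, hwv⟩ : ∃ w ∈ s.hm W (q+1) μ, (s.S ^ q) w = v := by
    obtain ⟨c, hc⟩ := htopv z0 hz0W
    have hc0 : c ≠ 0 := by rintro rfl; exact hz0 (by rw [hc, zero_smul])
    refine ⟨s.P μ (c⁻¹ • z0), ?_, ?_⟩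
    · have : s.P μ (c⁻¹ • z0) ∈ W := hP _ _ (W.smul_mem _ hz0W)
      exact s.mem_hm.mpr ⟨this, hq1 _ this, s.PP _ _⟩
    · rw [← s.Ppow, map_smul, hc, smul_smul, inv_mul_cancel₀ hc0, one_smul, hμ]
  have hwW := (s.mem_hm.mp hw).1
  have hSv : s.S v = 0 := by
    rw [← hwv, ← Module.End.mul_apply, ← pow_succ', hq1 w hwW]
  rcases q with _ | t
  · refine ⟨Unit, inferInstance, fun _ => 1, fun _ => v, fun _ => μ, single_chain le_rfl
      (by simpa using hSv) hμ (fun a => Or.inl (hker _)) (fun a c h => absurd (hker _) h),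
      fun _ => hvW, ⟨⟨(), 0⟩, by simpa [vec] using hv, by simpa [vec] using hker, ?_⟩, ?_⟩
    · rintro ⟨i, a⟩ hx
      refine absurd ?_ hx
      cases i
      congr 1
      exact Subsingleton.elim (α := Fin 1) _ _
    · intro z hz
      obtain ⟨c, hc⟩ := htopv z hz
      have hc : z = c • v := by simpa using hc
      rw [hc]
      exact Submodule.smul_mem _ _ (Submodule.subset_span ⟨⟨(), 0⟩, by simp [vec]⟩)
  by_cases hcase : ∀ k ∈ W, (s.S ^ (t+1)) k = 0 → ∀ z ∈ W, s.B k ((s.S ^ t) z) = 0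
  · have hww : s.B w ((s.S ^ t) w) ≠ 0 := by
      intro h0
      obtain ⟨d, hd⟩ := hrad ((s.S ^ t) w) (s.pow_mem hW _ hwW) (by
        intro z hz
        obtain ⟨c, hc⟩ := htopv z hz
        have hk := hcase (z - c • w) (W.sub_mem hz (W.smul_mem _ hwW))
          (by rw [map_sub, map_smul, hc, hwv, sub_self]) w hwW
        rw [map_sub, map_smul, LinearMap.sub_apply, LinearMap.smul_apply, h0, smul_zero,
          sub_zero] at hk
        rw [s.skew, hk, neg_zero])
      apply hv
      rw [← hwv, pow_succ', Module.End.mul_apply, hd, map_smul, hSv, smul_zero]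
    have hμ0 : μ = 0 := by
      by_contra hne
      exact hww (s.orth_of_ne (μ := μ) (ν := μ) (by intro h; apply hne; linarith)
        (s.mem_hm.mp hw).2.2 (s.mem_hm.mp hw).2.2 t)
    subst hμ0
    obtain ⟨w', hw', ⟨c, hc0, z, hz, hcz⟩, h1, h2⟩ := s.N1 (s.hm W (t+1+1) 0) (s.hm_S hW _ _) t w hw hww
      (fun a ha => hbig w hwW w hwW a ha)
    obtain ⟨hw'1, hw'2, hw'3⟩ := s.mem_hm.mp hw'
    have hw'v : (s.S ^ (t+1)) w' = c • v := by
      rw [hcz, map_add, map_smul, hwv, ← Module.End.mul_apply, ← pow_succ, hq1 z (s.mem_hm.mp hz).1,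
        add_zero]
    have h1' : s.B w' ((s.S ^ t) w') ≠ 0 := by rcases h1 with h | h <;> rw [h] <;> norm_num
    have hch := single_chain (s := s) (k := t+1+1) (by omega) hw'2 hw'3 (fun a => by
      by_cases ha : a = t
      · subst ha; exact Or.inr h1
      · exact Or.inl (h2 a ha)) (fun a c ha hc => by
        have ha : a = t := by by_contra h; exact ha (h2 a h)
        have hc : c = t := by by_contra h; exact hc (h2 c h)
        rw [ha, hc])
    have hv' : c • v ≠ 0 := smul_ne_zero hc0 hv
    have hrow : ∀ x : (Σ _ : Unit, Fin (t+1+1)), x ≠ ⟨(), ⟨t+1, by omega⟩⟩ → 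
        ∃ y, s.B (s.vec (ι := Unit) (fun _ => t+1+1) (fun _ => w') x) (s.vec (ι := Unit) (fun _ => t+1+1) (fun _ => w') y) ≠ 0 := by
      rintro ⟨⟨⟩, a⟩ hx
      have ha : (a:ℕ) ≠ t + 1 := by
        intro h; apply hx; congr 1; ext; exact h
      have := a.2
      refine ⟨⟨(), ⟨t - a, by omega⟩⟩, ?_⟩
      rw [gram]
      simp only
      rw [show t - (a:ℕ) + a = t by omega]
      simpa using h1'
    refine ⟨Unit, inferInstance, _, _, _, hch, fun _ => hw'1, ⟨⟨(), ⟨t+1, by omega⟩⟩, ?_, ?_, hrow⟩, ?_⟩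
    · rw [vec]; simpa only [hw'v] using hv'
    · intro y; rw [vec]; simp only [hw'v]; simp [hker]
    · refine finish W hW (c • v) hv' (fun y => by simp [hker]) ?_ hno t hch (fun _ => hw'1)
        ⟨(), ⟨t+1, by omega⟩⟩ rfl hw'v (fun a ha => h2 a (by omega)) hrow ?_
      · intro x hx hxy
        obtain ⟨d, hd⟩ := hrad x hx hxy
        exact ⟨d * c⁻¹, by rw [smul_smul, mul_assoc, inv_mul_cancel₀ hc0, mul_one, hd]⟩
      · intro u hu hu0
        obtain ⟨d, hd⟩ := htopv u hu
        have hk := hcase (u - (d * c⁻¹) • w') (W.sub_mem hu (W.smul_mem _ hw'1)) (by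
          rw [map_sub, map_smul, hd, hw'v, smul_smul, mul_assoc, inv_mul_cancel₀ hc0, mul_one,
            sub_self]) w' hw'1
        rw [map_sub, map_smul, LinearMap.sub_apply, LinearMap.smul_apply, hu0 () t, zero_sub,
          neg_eq_zero, smul_eq_zero] at hk
        have := hk.resolve_right h1'
        have hd0 : d = 0 := (mul_eq_zero.mp this).resolve_right (inv_ne_zero hc0)
        rw [hd, hd0, zero_smul]
  · push Not at hcase
    obtain ⟨k, hkW, hk0, z, hz, hkz⟩ := hcase
    have hkw : s.B k ((s.S ^ t) w) ≠ 0 := by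
      intro h0
      apply hkz
      obtain ⟨c, hc⟩ := htopv z hz
      have := hno t k hkW (z - c • w) (W.sub_mem hz (W.smul_mem _ hwW)) hk0
          (by rw [map_sub, map_smul, hc, hwv, sub_self])
      rwa [map_sub, map_sub, map_smul, map_smul, h0, smul_zero, sub_zero] at this
    have hy : s.P (-μ) k ∈ s.hm W (t+1) (-μ) :=
      s.mem_hm.mpr ⟨hP _ _ hkW, by rw [← s.Ppow, hk0, map_zero], s.PP _ _⟩
    have hwy : s.B w ((s.S ^ t) (s.P (-μ) k)) ≠ 0 := by
      rw [← s.Ppow, ← s.BP, (s.mem_hm.mp hw).2.2, s.swap]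
      simpa using hkw
    generalize s.P (-μ) k = y at hy hwy
    obtain ⟨hyW, hy0, hyμ⟩ := s.mem_hm.mp hy
    have hyy : s.B y ((s.S ^ t) y) = 0 := hno t y hyW y hyW hy0 hy0
    obtain ⟨w1, hw1, hw1v, hw1y, hw1w⟩ : ∃ w1 ∈ s.hm W (t+1+1) μ, (s.S ^ (t+1)) w1 = v ∧ 
        s.B w1 ((s.S ^ t) y) ≠ 0 ∧ s.B w1 ((s.S ^ t) w1) = 0 := by
      by_cases h0 : s.B w ((s.S ^ t) w) = 0
      · exact ⟨w, hw, hwv, hwy, h0⟩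
      have hμ0 : μ = 0 := by
        by_contra hne
        exact h0 (s.orth_of_ne (μ := μ) (ν := μ) (by intro h; apply hne; linarith)
          (s.mem_hm.mp hw).2.2 (s.mem_hm.mp hw).2.2 t)
      subst hμ0
      rw [neg_zero] at hyμ
      have hto : Odd t := by
        by_contra h
        exact h0 (s.even_self _ (Nat.not_odd_iff_even.mp h) _)
      set c : ℝ := - s.B w ((s.S ^ t) w) / (2 * s.B w ((s.S ^ t) y)) with hc
      refine ⟨w + c • y, ?_, ?_, ?_, ?_⟩
      · refine Submodule.add_mem _ hw (Submodule.smul_mem _ _ (s.mem_hm.mpr ⟨hyW, hq1 _ hyW, hyμ⟩))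
      · rw [map_add, map_smul, hy0, hwv]; simp
      · simpa [hyy] using hwy
      · have := s.expand t 0 0 c c w y w y
        simp only [pow_zero, Module.End.one_apply, add_zero, one_mul] at this
        rw [this, hyy, s.swap t y w, hto.add_one.neg_one_pow, hc]
        field_simp; ring
    obtain ⟨x', hx', y', hy', ⟨z', hz', hxz'⟩, h1, h2, h3, h4⟩ := s.normPair W hW t (t+1+1) (t+1)
      (by omega) (by omega) μ w1 y hw1 hy hw1y
      (fun a ha => hbig _ (s.mem_hm.mp hw1).1 _ hyW a ha)
      (fun a ha => by
        rcases eq_or_lt_of_le ha with h | h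
        · subst h; exact hw1w
        · exact hbig _ (s.mem_hm.mp hw1).1 _ (s.mem_hm.mp hw1).1 a h)
      (fun a ha => by
        rcases eq_or_lt_of_le ha with h | h
        · subst h; exact hyy
        · exact hbig _ hyW _ hyW a h)
    obtain ⟨hx1, hx2, hx3⟩ := s.mem_hm.mp hx'
    obtain ⟨hy1, hy2, hy3⟩ := s.mem_hm.mp hy'
    have hx'v : (s.S ^ (t+1)) x' = v := by
      rw [hxz', map_add, hw1v, ← Module.End.mul_apply, ← pow_succ, s.pow_zero_of_le (by omega) hz',
        add_zero]
    have h3' : s.B y' ((s.S ^ t) x') ≠ 0 := by rw [s.swap, h3]; simp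
    have hch := pair_chain (s := s) (by omega) (by omega) hx2 hy2 hx3 hy3 h1 h2 h3 h4
    have hrow : ∀ x : (Σ b : Bool, Fin (bif b then t+1 else t+1+1)), x ≠ ⟨false, ⟨t+1, by simp⟩⟩ → 
        ∃ y, s.B (s.vec (ι := Bool) (fun b => bif b then t+1 else t+1+1) (fun b => bif b then y' else x') x) (s.vec (fun b => bif b then t+1 else t+1+1) (fun b => bif b then y' else x') y) ≠ 0 := by
      rintro ⟨b, a⟩ hx
      rcases b with _ | _
      · have ha : (a:ℕ) ≠ t + 1 := by
          intro h; apply hx; congr 1; ext; exact h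
        have ha2 := a.2
        simp only [cond_false] at ha2
        refine ⟨⟨true, ⟨t - a, by simp only [cond_true]; omega⟩⟩, ?_⟩
        rw [gram]
        simp only
        rw [show t - (a:ℕ) + a = t by omega]
        simp [h3]
      · have ha2 := a.2
        simp only [cond_true] at ha2
        refine ⟨⟨false, ⟨t - a, by simp only [cond_false]; omega⟩⟩, ?_⟩
        rw [gram]
        simp only
        rw [show t - (a:ℕ) + a = t by omega]
        simpa using h3'
    have htW : ∀ b : Bool, (bif b then y' else x') ∈ W := by rintro (_ | _) <;> simpa
    refine ⟨Bool, inferInstance, _, _, _, hch, htW, ⟨⟨false, ⟨t+1, by simp⟩⟩, ?_, ?_, hrow⟩, ?_⟩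
    · rw [vec]; simpa only [cond_false, hx'v] using hv
    · intro y; rw [vec]; simp only [cond_false, hx'v]; simp [hker]
    · refine finish W hW v hv hker hrad hno t hch htW
        ⟨false, ⟨t+1, by simp⟩⟩ rfl hx'v (fun a ha => h1 a) hrow ?_
      intro u hu hu0
      obtain ⟨d, hd⟩ := htopv u hu
      have hk := hno t (u - d • x') (W.sub_mem hu (W.smul_mem _ hx1)) y' hy1 (by
          rw [map_sub, map_smul, hd, hx'v, sub_self]) hy2
      have hu1 : s.B u ((s.S ^ t) y') = 0 := hu0 true t
      rw [map_sub, map_smul, LinearMap.sub_apply, LinearMap.smul_apply, hu1, h3] at hk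
      have hd0 : d = 0 := by simpa using hk
      rw [hd, hd0, zero_smul]

end Sys

namespace Sys
variable {s : Sys V}

lemma main_fam [FiniteDimensional ℝ V] (v : V) (hv : v ≠ 0) (hker : ∀ y, s.B v y = 0)
    (hrad : ∀ x, (∀ y, s.B x y = 0) → ∃ c : ℝ, x = c • v) :
    ∃ (ι : Type) (_ : Fintype ι) (n : ι → ℕ) (top : ι → V) (lam : ι → ℝ),
      s.Chain n top lam ∧ (∃ x0, s.vec n top x0 ≠ 0 ∧
        (∀ y, s.B (s.vec n top x0) y = 0) ∧
        ∀ x, x ≠ x0 → ∃ y, s.B (s.vec n top x) (s.vec n top y) ≠ 0) ∧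
      LinearIndependent ℝ (s.vec n top) ∧
      ⊤ ≤ Submodule.span ℝ (Set.range (s.vec n top)) := by
  classical
  let Q : ℕ → Prop := fun k => ∃ (ι : Type) (_ : Fintype ι) (n : ι → ℕ) (top : ι → V) (lam : ι → ℝ),
    s.Chain n top lam ∧ s.Reg n top ∧ ∑ i, n i = k
  have hbd : ∀ k, Q k → k ≤ Module.finrank ℝ V := by
    rintro k ⟨ι, _, n, top, lam, h1, h2, rfl⟩
    have := (h1.li_reg h2).fintype_card_le_finrank
    simpa using this
  have hQ0 : Q 0 := ⟨Empty, inferInstance, Empty.elim, Empty.elim, Empty.elim,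
    ⟨by rintro ⟨⟩, by rintro ⟨⟩, by rintro ⟨⟩, by rintro ⟨⟩, by rintro ⟨⟩⟩, by rintro ⟨⟩, by simp⟩
  obtain ⟨ι, _, n, top, lam, hc, hr, hk⟩ := Nat.findGreatest_spec (P := Q) (Nat.zero_le _) hQ0
  have hmax : ∀ k, Q k → k ≤ ∑ i, n i := by
    intro k hQ
    rw [hk]
    exact Nat.le_findGreatest (hbd k hQ) hQ
  let W : Submodule ℝ V :=
    { carrier := {z | ∀ i a, s.B (top i) ((s.S ^ a) z) = 0}
      add_mem' := by
        intro a b h2 h4 i c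
        rw [map_add, map_add, h2, h4, add_zero]
      zero_mem' := by intro i a; simp
      smul_mem' := by
        intro c x h2 i a
        rw [map_smul, map_smul, h2, smul_zero] }
  have hW : ∀ z ∈ W, s.S z ∈ W := by
    intro z hz i a
    rw [← Module.End.mul_apply, ← pow_succ]
    exact hz i _
  have hP : ∀ μ, ∀ z ∈ W, s.P μ z ∈ W := by
    intro μ z hz i a
    rw [← s.Ppow]
    have h1 := s.BP (-μ) (top i) ((s.S ^ a) z)
    rw [neg_neg] at h1
    rw [← h1]
    by_cases h : -μ = lam i
    · rw [h, hc.hom]; exact hz i a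
    · rw [← hc.hom i, s.PP0 _ _ _ h]; simp
  have hvW : v ∈ W := by
    intro i a
    rw [s.swap, hker, mul_zero]
  have hprojW : ∀ z, ∃ u ∈ Submodule.span ℝ (Set.range (s.vec n top)), z - u ∈ W := by
    intro z
    obtain ⟨u, hu, hu'⟩ := hc.proj (fun x => Or.inl (hr.row x)) z
    refine ⟨u, hu, ?_⟩
    intro i a
    by_cases ha : a < n i
    · have := hu' ⟨i, ⟨a, ha⟩⟩
      rw [vec, s.shift] at this
      simpa using this
    · rw [s.swap, s.pow_zero_of_le (by omega) (hc.nil i), map_zero, mul_zero]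
  have horth : ∀ u ∈ Submodule.span ℝ (Set.range (s.vec n top)), ∀ u' ∈ W, s.B u' u = 0 := by
    intro u hu u' hu'
    induction hu using Submodule.span_induction with
    | mem x hx => obtain ⟨y, rfl⟩ := hx; rw [vec, s.swap, hu', mul_zero]
    | zero => simp
    | add x y _ _ h1 h2 => rw [map_add, h1, h2, add_zero]
    | smul c x _ h1 => rw [map_smul, h1, smul_zero]
  have hradW : ∀ x ∈ W, (∀ y ∈ W, s.B x y = 0) → ∃ c : ℝ, x = c • v := by
    intro x hx h
    apply hrad
    intro y
    obtain ⟨u, hu, hu'⟩ := hprojW y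
    have h1 := h _ hu'
    rw [map_sub, horth u hu x hx, sub_zero] at h1
    exact h1
  have hno := gamma_zero (s := s) W hW hP (by
    intro ι' _ _ n' top' lam' hc' hr' hin
    have := hmax (∑ i, n i + ∑ i, n' i) ⟨ι ⊕ ι', inferInstance, _, _, _,
      sum_chain hc hc' (fun i j a => hin j i a), sum_reg hr hr', by simp⟩
    have h2 : 0 < ∑ i, n' i := Finset.sum_pos (fun i _ => hc'.npos i) Finset.univ_nonempty
    omega)
  obtain ⟨ι', _, n', top', lam', hc', hin, ⟨x0, h1, h2, h3⟩, h4⟩ := core W hW hP v hv hvW hker hradW hno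
  have hcc := sum_chain hc hc' (fun i j a => hin j i a)
  let x0' : Σ k, Fin (Sum.elim n n' k) := ⟨Sum.inr x0.1, x0.2⟩
  have hrr : ∀ x, x ≠ x0' → ∃ y, s.B (s.vec (Sum.elim n n') (Sum.elim top top') x)
      (s.vec (Sum.elim n n') (Sum.elim top top') y) ≠ 0 := by
    rintro ⟨i | i, a⟩ hx
    · obtain ⟨y, hy⟩ := hr.row ⟨i, a⟩
      exact ⟨⟨Sum.inl y.1, y.2⟩, hy⟩
    · obtain ⟨y, hy⟩ := h3 ⟨i, a⟩ (by rintro rfl; exact hx rfl)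
      exact ⟨⟨Sum.inr y.1, y.2⟩, hy⟩
  refine ⟨ι ⊕ ι', inferInstance, _, _, _, hcc, ⟨x0', h1, h2, hrr⟩, hcc.li_sing x0' h1 hrr, ?_⟩
  intro z _
  obtain ⟨u, hu, hu'⟩ := hprojW z
  have e1 : z = u + (z - u) := by abel
  rw [e1]
  refine Submodule.add_mem _ (Submodule.span_mono ?_ hu) (Submodule.span_mono ?_ (h4 hu'))
  · rintro _ ⟨x, rfl⟩
    exact ⟨⟨Sum.inl x.1, x.2⟩, rfl⟩
  · rintro _ ⟨x, rfl⟩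
    exact ⟨⟨Sum.inr x.1, x.2⟩, rfl⟩

end Sys

lemma combin {σ : Type} [Fintype σ] [DecidableEq σ] (G : Matrix σ σ ℝ) (hs : ∀ x y, G x y = - G y x)
    (hv : ∀ x y, G x y = 0 ∨ G x y = 1 ∨ G x y = -1)
    (hu : ∀ x y z, G x y ≠ 0 → G x z ≠ 0 → y = z) (x0 : σ) (h0 : ∀ y, G x0 y = 0)
    (hr : ∀ x, x ≠ x0 → ∃ y, G x y ≠ 0) (N : ℕ) (hN : Fintype.card σ = N) :
    ∃ e : σ ≃ Fin N, Matrix.reindex e e G = canonJ N (N - 1) := by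
  classical
  let r := Fintype.card {x // ∃ y, G x y = 1}
  let e0 : {x // ∃ y, G x y = 1} ≃ Fin r := Fintype.equivFin _
  let pp : Fin r → σ := fun k => (e0.symm k).1
  have hpe : ∀ k, ∃ y, G (pp k) y = 1 := fun k => (e0.symm k).2
  choose q hq using hpe
  have hq' : ∀ k, G (q k) (pp k) = -1 := fun k => by rw [hs, hq]
  have hpinj : Function.Injective pp := fun k l h => e0.symm.injective (Subtype.ext h)
  have hpsurj : ∀ x y, G x y = 1 → ∃ k, pp k = x := fun x y h =>
    ⟨e0 ⟨x, y, h⟩, by simp [pp]⟩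
  have gp : ∀ k y, G (pp k) y = if y = q k then 1 else 0 := by
    intro k y
    split_ifs with h
    · rw [h, hq]
    · by_contra h1; exact h (hu _ _ _ h1 (by rw [hq]; norm_num))
  have gq : ∀ k y, G (q k) y = if y = pp k then -1 else 0 := by
    intro k y
    split_ifs with h
    · rw [h, hq']
    · by_contra h1; exact h (hu _ _ _ h1 (by rw [hq']; norm_num))
  have hqinj : Function.Injective q := by
    intro k l h
    have h1 := hq' l
    rw [← h, gq] at h1
    split_ifs at h1 with h2
    · exact (hpinj h2).symm
    · norm_num at h1
  have hpq : ∀ k l, pp k ≠ q l := by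
    intro k l h
    have h1 := hq k
    rw [h, gq] at h1
    split_ifs at h1 <;> norm_num at h1
  have hp0 : ∀ k, pp k ≠ x0 := by
    intro k h
    have h1 := hq k
    rw [h, h0] at h1; norm_num at h1
  have hq0 : ∀ k, q k ≠ x0 := by
    intro k h
    have h1 := hq' k
    rw [h, h0] at h1; norm_num at h1
  let f : (Fin r ⊕ Fin r) ⊕ Fin 1 → σ := Sum.elim (Sum.elim pp q) (fun _ => x0)
  have hf : Function.Bijective f := by
    constructor
    · rintro ((k | k) | k) ((l | l) | l) h <;> simp only [f, Sum.elim_inl, Sum.elim_inr] at h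
      · rw [hpinj h]
      · exact absurd h (hpq _ _)
      · exact absurd h (hp0 _)
      · exact absurd h.symm (hpq _ _)
      · rw [hqinj h]
      · exact absurd h (hq0 _)
      · exact absurd h.symm (hp0 _)
      · exact absurd h.symm (hq0 _)
      · rw [Subsingleton.elim k l]
    · intro x
      by_cases hx : x = x0
      · exact ⟨Sum.inr 0, hx.symm⟩
      · obtain ⟨y, hy⟩ := hr x hx
        rcases hv x y with h | h | h
        · exact absurd h hy
        · obtain ⟨k, hk⟩ := hpsurj x y h
          exact ⟨Sum.inl (Sum.inl k), hk⟩
        · obtain ⟨k, hk⟩ := hpsurj y x (by rw [hs, h]; norm_num)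
          refine ⟨Sum.inl (Sum.inr k), ?_⟩
          have h1 := hq k
          rw [hk] at h1
          show q k = x
          exact hu y (q k) x (by rw [h1]; norm_num) (by rw [hs, h]; norm_num)
  have hcard : N = r + r + 1 := by
    rw [← hN, ← Fintype.card_of_bijective hf]; simp
  subst hcard
  let g : (Fin r ⊕ Fin r) ⊕ Fin 1 ≃ Fin (r + r + 1) :=
    (Equiv.sumCongr finSumFinEquiv (Equiv.refl _)).trans finSumFinEquiv
  refine ⟨(Equiv.ofBijective f hf).symm.trans g, ?_⟩
  ext i j
  obtain ⟨u, rfl⟩ := g.surjective i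
  obtain ⟨v, rfl⟩ := g.surjective j
  have hg1 : ∀ k, ((g (Sum.inl (Sum.inl k)) : Fin _) : ℕ) = k := fun k => by simp [g]
  have hg2 : ∀ k, ((g (Sum.inl (Sum.inr k)) : Fin _) : ℕ) = r + k := fun k => by simp [g]; omega
  have hg3 : ∀ k, ((g (Sum.inr k) : Fin _) : ℕ) = r + r := fun k => by simp [g]
  have hR : (r + r + 1 - 1) / 2 = r := by omega
  simp only [Matrix.reindex_apply, Matrix.submatrix_apply, Equiv.symm_trans_apply, Equiv.symm_symm,
    Equiv.symm_apply_apply, Equiv.ofBijective_apply, canonJ, Matrix.of_apply, hR]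
  rcases u with (k | k) | k <;> rcases v with (l | l) | l <;>
    simp only [hg1, hg2, hg3, f, Sum.elim_inl, Sum.elim_inr, gp, gq, h0]
  · have := k.2; have := l.2
    rw [if_neg (hpq _ _), if_neg (by omega), if_neg (by omega)]
  · have := k.2; have := l.2
    by_cases h : l = k
    · subst h; rw [if_pos rfl, if_pos (by omega)]
    · rw [if_neg (fun h' => h (hqinj h')), if_neg, if_neg (by omega)]
      intro h'; apply h; ext; omega
  · have := k.2
    rw [if_neg (Ne.symm (hq0 _)), if_neg (by omega), if_neg (by omega)]
  · have := k.2; have := l.2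
    by_cases h : l = k
    · subst h; rw [if_pos rfl, if_neg (by omega), if_pos (by omega)]
    · rw [if_neg (fun h' => h (hpinj h')), if_neg (by omega), if_neg]
      intro h'; apply h; ext; omega
  · have := k.2; have := l.2
    rw [if_neg (Ne.symm (hpq _ _)), if_neg (by omega), if_neg (by omega)]
  · have := k.2
    rw [if_neg (Ne.symm (hp0 _)), if_neg (by omega), if_neg (by omega)]
  · have := l.2
    rw [if_neg (by omega), if_neg (by omega)]
  · have := l.2
    rw [if_neg (by omega), if_neg (by omega)]
  · rw [if_neg (by omega), if_neg (by omega)]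

namespace Sys
variable {s : Sys V}

lemma count {ι : Type} [Fintype ι] {n : ι → ℕ} {top : ι → V} {lam : ι → ℝ}
    (hnil : ∀ i, (s.S ^ (n i)) (top i) = 0) (hhom : ∀ i, s.P (lam i) (top i) = top i)
    (hli : LinearIndependent ℝ (s.vec n top))
    (hsp : ⊤ ≤ Submodule.span ℝ (Set.range (s.vec n top))) (μ : ℝ) (k : ℕ) :
    Module.finrank ℝ (LinearMap.range (s.P μ * s.S ^ k)) =
      ∑ i, if lam i = μ then n i - k else 0 := by
  classical
  let τ := Σ i : {i // lam i = μ}, Fin (n i.1 - k)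
  let f : τ → Σ i, Fin (n i) := fun x => ⟨x.1.1, ⟨x.2 + k, by have := x.2.2; omega⟩⟩
  have hf : Function.Injective f := by
    rintro ⟨⟨i, hi⟩, a⟩ ⟨⟨j, hj⟩, b⟩ h
    simp only [f, Sigma.mk.injEq] at h
    obtain ⟨h1, h2⟩ := h
    subst h1
    simp only [heq_eq_eq, Fin.mk.injEq] at h2
    congr 1
    ext; omega
  have hL : ∀ i a, (s.P μ * s.S ^ k) ((s.S ^ a) (top i)) =
      if lam i = μ then (s.S ^ (a + k)) (top i) else 0 := by
    intro i a
    rw [Module.End.mul_apply, s.pp, s.Ppow]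
    split_ifs with h
    · rw [← h, hhom, add_comm]
    · rw [← hhom i, s.PP0 _ _ _ (Ne.symm h), map_zero]
  have hrange : LinearMap.range (s.P μ * s.S ^ k) =
      Submodule.span ℝ (Set.range (s.vec n top ∘ f)) := by
    rw [LinearMap.range_eq_map, ← top_le_iff.mp hsp, Submodule.map_span]
    apply le_antisymm
    · rw [Submodule.span_le]
      rintro _ ⟨_, ⟨x, rfl⟩, rfl⟩
      rw [vec, hL]
      split_ifs with h
      · by_cases h2 : (x.2:ℕ) + k < n x.1
        · exact Submodule.subset_span ⟨⟨⟨x.1, h⟩, ⟨x.2, by simp only; omega⟩⟩, rfl⟩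
        · rw [s.pow_zero_of_le (by omega) (hnil _)]; exact Submodule.zero_mem _
      · exact Submodule.zero_mem _
    · apply Submodule.span_mono
      rintro _ ⟨⟨⟨i, hi⟩, a⟩, rfl⟩
      have ha := a.2
      simp only at ha
      refine ⟨_, ⟨⟨i, ⟨a, by omega⟩⟩, rfl⟩, ?_⟩
      rw [vec, hL, if_pos hi]; rfl
  rw [hrange, finrank_span_eq_card (hli.comp f hf)]
  simp only [τ, Fintype.card_sigma, Fintype.card_fin]
  rw [← Finset.sum_filter]
  exact (Finset.sum_subtype _ (by simp) (fun i => n i - k)).symm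

lemma count2 {ι : Type} [Fintype ι] (n : ι → ℕ) (lam : ι → ℝ) (μ : ℝ) (k : ℕ) :
    Fintype.card {i // (lam i, n i) = (μ, k+1)} + 2 * (∑ i, if lam i = μ then n i - (k+1) else 0) =
      (∑ i, if lam i = μ then n i - k else 0) + (∑ i, if lam i = μ then n i - (k+2) else 0) := by
  classical
  rw [Fintype.card_subtype, Finset.card_filter, Finset.mul_sum, ← Finset.sum_add_distrib,
    ← Finset.sum_add_distrib]
  refine Finset.sum_congr rfl fun i _ => ?_
  simp only [Prod.mk.injEq]
  by_cases h : lam i = μ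
  · simp only [h, true_and, if_true]
    split_ifs with h2 <;> omega
  · simp [h]

lemma match_fam {ι : Type} [Fintype ι] {n : ι → ℕ} {top : ι → V} {lam : ι → ℝ}
    (hpos : ∀ i, 1 ≤ n i)
    (hnil : ∀ i, (s.S ^ (n i)) (top i) = 0) (hhom : ∀ i, s.P (lam i) (top i) = top i)
    (hli : LinearIndependent ℝ (s.vec n top))
    (hsp : ⊤ ≤ Submodule.span ℝ (Set.range (s.vec n top))) 
    {ι' : Type} [Fintype ι'] {n' : ι' → ℕ} {top' : ι' → V} {lam' : ι' → ℝ}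
    (hpos' : ∀ i, 1 ≤ n' i)
    (hnil' : ∀ i, (s.S ^ (n' i)) (top' i) = 0) (hhom' : ∀ i, s.P (lam' i) (top' i) = top' i)
    (hli' : LinearIndependent ℝ (s.vec n' top'))
    (hsp' : ⊤ ≤ Submodule.span ℝ (Set.range (s.vec n' top'))) :
    ∃ e : ι ≃ ι', ∀ i, n' (e i) = n i ∧ lam' (e i) = lam i := by
  classical
  have hc : ∀ c : ℝ × ℕ, Nonempty ({i // (lam i, n i) = c} ≃ {i // (lam' i, n' i) = c}) := by
    rintro ⟨μ, k⟩
    rw [← Fintype.card_eq]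
    rcases k with _ | k
    · have h1 : IsEmpty {i // (lam i, n i) = (μ, 0)} := ⟨fun i => by
        have h := i.2; have := hpos i.1; rw [Prod.mk.injEq] at h; omega⟩
      have h2 : IsEmpty {i // (lam' i, n' i) = (μ, 0)} := ⟨fun i => by
        have h := i.2; have := hpos' i.1; rw [Prod.mk.injEq] at h; omega⟩
      rw [Fintype.card_eq_zero, Fintype.card_eq_zero]
    · have h1 := count2 n lam μ k
      have h2 := count2 n' lam' μ k
      rw [← count hnil hhom hli hsp, ← count hnil hhom hli hsp, ← count hnil hhom hli hsp] at h1
      rw [← count hnil' hhom' hli' hsp', ← count hnil' hhom' hli' hsp',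
        ← count hnil' hhom' hli' hsp'] at h2
      omega
  let E := Equiv.ofFiberEquiv (fun c => (hc c).some)
  refine ⟨E, fun i => ?_⟩
  have := Equiv.ofFiberEquiv_map (fun c => (hc c).some) i
  simp only [Prod.mk.injEq] at this
  exact ⟨this.2, this.1⟩

end Sys

section std
variable {p : ℕ} (n : Fin p → ℕ) (lam : Fin p → ℝ)

def Sm : Module.End ℝ ((Σ i, Fin (n i)) → ℝ) where
  toFun x := fun y => if h : (y.2:ℕ) + 1 < n y.1 then x ⟨y.1, ⟨y.2 + 1, h⟩⟩ else 0
  map_add' x y := by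
    ext u
    simp only [Pi.add_apply]
    split_ifs <;> simp
  map_smul' c x := by
    ext u
    simp only [Pi.smul_apply, RingHom.id_apply]
    split_ifs <;> simp

def Pm (μ : ℝ) : Module.End ℝ ((Σ i, Fin (n i)) → ℝ) where
  toFun x := fun y => if lam y.1 = μ then x y else 0
  map_add' x y := by
    ext u
    simp only [Pi.add_apply]
    split_ifs <;> simp
  map_smul' c x := by
    ext u
    simp only [Pi.smul_apply, RingHom.id_apply]
    split_ifs <;> simp

lemma Sm_apply (x) (y : Σ i, Fin (n i)) :
    Sm n x y = if h : (y.2:ℕ) + 1 < n y.1 then x ⟨y.1, ⟨y.2 + 1, h⟩⟩ else 0 := rfl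

lemma Pm_apply (μ) (x) (y : Σ i, Fin (n i)) :
    Pm n lam μ x y = if lam y.1 = μ then x y else 0 := rfl

lemma Sm_pow (k : ℕ) : ∀ (x) (y : Σ i, Fin (n i)),
    (Sm n ^ k) x y = if h : (y.2:ℕ) + k < n y.1 then x ⟨y.1, ⟨y.2 + k, h⟩⟩ else 0 := by
  induction k with
  | zero => intro x y; simp
  | succ k ih =>
    intro x y
    rw [pow_succ', Module.End.mul_apply, Sm_apply]
    by_cases h : (y.2:ℕ) + (k+1) < n y.1
    · rw [dif_pos (by omega), dif_pos h, ih, dif_pos (by simp only; omega)]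
      congr 3
      simp only; omega
    · rw [dif_neg h]
      split_ifs with h2
      · rw [ih, dif_neg (by simp only; omega)]
      · rfl

lemma Sm_nil : (Sm n) ^ (∑ i, n i) = 0 := by
  ext x y
  simp only [LinearMap.comp_apply]
  rw [Sm_pow, dif_neg]
  · rfl
  · have := Finset.single_le_sum (f := n) (fun i _ => Nat.zero_le _) (Finset.mem_univ y.1)
    omega

lemma Jm_mulVec (x : (Σ i, Fin (n i)) → ℝ) (y : Σ i, Fin (n i)) :
    (Matrix.blockDiagonal' (fun i => jordanBlock (n i) (lam i)) *ᵥ x) y =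
      lam y.1 * x y + Sm n x y := by
  obtain ⟨i, a⟩ := y
  rw [Matrix.mulVec, dotProduct, Fintype.sum_sigma, Finset.sum_eq_single i]
  · simp only [Matrix.blockDiagonal'_apply_eq, jordanBlock, Matrix.of_apply, Sm_apply]
    by_cases h : (a:ℕ) + 1 < n i
    · rw [dif_pos h]
      have : ∀ b : Fin (n i), (if b = a then lam i else if (b:ℕ) = a + 1 then 1 else 0) * x ⟨i, b⟩ =
          (if b = a then lam i * x ⟨i, b⟩ else 0) +
          (if b = ⟨a+1, h⟩ then x ⟨i, b⟩ else 0) := by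
        intro b
        simp only [Fin.ext_iff]
        split_ifs <;> first | omega | simp
      rw [Finset.sum_congr rfl (fun b _ => this b), Finset.sum_add_distrib]
      simp
    · rw [dif_neg h]
      have : ∀ b : Fin (n i), (if b = a then lam i else if (b:ℕ) = a + 1 then 1 else 0) * x ⟨i, b⟩ =
          (if b = a then lam i * x ⟨i, b⟩ else 0) := by
        intro b
        have := b.2
        simp only [Fin.ext_iff]
        split_ifs <;> first | omega | simp
      rw [Finset.sum_congr rfl (fun b _ => this b)]
      simp
  · intro j _ hj
    apply Finset.sum_eq_zero
    intro b _
    rw [Matrix.blockDiagonal'_apply_ne _ _ _ (Ne.symm hj), zero_mul]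
  · simp

lemma Sm_single (i : Fin p) (a : Fin (n i)) :
    Sm n (Pi.single ⟨i, a⟩ 1) = if h : (a:ℕ) = 0 then 0 else
      Pi.single ⟨i, ⟨a - 1, by omega⟩⟩ 1 := by
  ext ⟨j, b⟩
  rw [Sm_apply]
  by_cases hij : i = j
  · subst hij
    have := a.2
    split_ifs with h1 h2 h2
    · simp [Pi.single_apply, Fin.ext_iff]; omega
    · simp only [Pi.single_apply, Sigma.mk.injEq, heq_eq_eq, true_and, Fin.ext_iff]
      congr 1
      simp only [eq_iff_iff]; omega
    · rfl
    · simp only [Pi.single_apply, Sigma.mk.injEq, heq_eq_eq, true_and, Fin.ext_iff]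
      rw [if_neg]; simp only at h1; omega
  · split_ifs with h1 h2 h2 <;> simp [Ne.symm hij]

def Bf (B : Matrix (Σ i, Fin (n i)) (Σ i, Fin (n i)) ℝ) :
    ((Σ i, Fin (n i)) → ℝ) →ₗ[ℝ] ((Σ i, Fin (n i)) → ℝ) →ₗ[ℝ] ℝ := Matrix.toLinearMap₂' ℝ B

lemma Bf_apply (B : Matrix (Σ i, Fin (n i)) (Σ i, Fin (n i)) ℝ) (x y) :
    Bf n B x y = x ⬝ᵥ (B *ᵥ y) := by
  rw [Bf, Matrix.toLinearMap₂'_apply']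

lemma Bf_sum (B : Matrix (Σ i, Fin (n i)) (Σ i, Fin (n i)) ℝ) (x y) :
    Bf n B x y = ∑ u, ∑ v, x u * B u v * y v := by
  rw [Bf_apply, dotProduct]
  refine Finset.sum_congr rfl fun u _ => ?_
  rw [Matrix.mulVec, dotProduct, Finset.mul_sum]
  refine Finset.sum_congr rfl fun v _ => by ring

lemma Bf_single (B : Matrix (Σ i, Fin (n i)) (Σ i, Fin (n i)) ℝ) (x y) :
    Bf n B (Pi.single x 1) (Pi.single y 1) = B x y := by
  rw [Bf_apply]; simp


lemma Bf_D {B : Matrix (Σ i, Fin (n i)) (Σ i, Fin (n i)) ℝ}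
    (heq : B * Matrix.blockDiagonal' (fun i => jordanBlock (n i) (lam i))
        + (Matrix.blockDiagonal' (fun i => jordanBlock (n i) (lam i)))ᵀ * B = 0) (x y) :
    Bf n B (fun u => lam u.1 * x u) y + Bf n B x (fun u => lam u.1 * y u) +
    Bf n B (Sm n x) y + Bf n B x (Sm n y) = 0 := by
  have h1 : ∀ x, (Matrix.blockDiagonal' (fun i => jordanBlock (n i) (lam i)) *ᵥ x) =
      (fun u : Σ i, Fin (n i) => lam u.1 * x u) + Sm n x := fun x => funext (Jm_mulVec n lam x)
  have h2 := congrArg (fun M => x ⬝ᵥ (M *ᵥ y)) heq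
  simp only [Matrix.add_mulVec, ← Matrix.mulVec_mulVec, dotProduct_add, Matrix.zero_mulVec,
    dotProduct_zero] at h2
  rw [Matrix.dotProduct_mulVec x (_ᵀ), Matrix.vecMul_transpose, h1, h1, ← Bf_apply, ← Bf_apply,
    map_add, map_add, LinearMap.add_apply] at h2
  linarith

lemma B_zero {B : Matrix (Σ i, Fin (n i)) (Σ i, Fin (n i)) ℝ}
    (heq : B * Matrix.blockDiagonal' (fun i => jordanBlock (n i) (lam i))
        + (Matrix.blockDiagonal' (fun i => jordanBlock (n i) (lam i)))ᵀ * B = 0) :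
    ∀ (m : ℕ) (x y : Σ i, Fin (n i)), (x.2:ℕ) + y.2 = m → lam x.1 + lam y.1 ≠ 0 → B x y = 0 := by
  intro m
  induction m using Nat.strong_induction_on with
  | _ m ih =>
    rintro ⟨i, a⟩ ⟨j, c⟩ h hl
    have h1 := Bf_D n lam heq (Pi.single ⟨i, a⟩ 1) (Pi.single ⟨j, c⟩ 1)
    simp only at h hl
    have e1 : ∀ x : Σ i, Fin (n i), (fun u : Σ i, Fin (n i) =>
        lam u.1 * (Pi.single x 1 : (Σ i, Fin (n i)) → ℝ) u) = lam x.1 • Pi.single x 1 := by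
      intro x
      ext u
      by_cases hu : u = x
      · subst hu; simp
      · simp [hu]
    have h2 : Bf n B (Sm n (Pi.single ⟨i, a⟩ 1)) (Pi.single ⟨j, c⟩ 1) = 0 := by
      rw [Sm_single]
      split_ifs with h3
      · simp
      · rw [Bf_single]
        exact ih (m - 1) (by omega) _ _ (by simp only; omega) hl
    have h2' : Bf n B (Pi.single ⟨i, a⟩ 1) (Sm n (Pi.single ⟨j, c⟩ 1)) = 0 := by
      rw [Sm_single]
      split_ifs with h3
      · simp
      · rw [Bf_single]
        exact ih (m - 1) (by omega) _ _ (by simp only; omega) hl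
    rw [e1, e1, h2, h2', map_smul, map_smul, LinearMap.smul_apply, Bf_single] at h1
    simp only [smul_eq_mul, add_zero, ← add_mul] at h1
    exact (mul_eq_zero.mp h1).resolve_left hl

def stdSys {B : Matrix (Σ i, Fin (n i)) (Σ i, Fin (n i)) ℝ}
    (heq : B * Matrix.blockDiagonal' (fun i => jordanBlock (n i) (lam i))
        + (Matrix.blockDiagonal' (fun i => jordanBlock (n i) (lam i)))ᵀ * B = 0)
    (hskew : Bᵀ = -B) : Sys ((Σ i, Fin (n i)) → ℝ) where
  B := Bf n B
  S := Sm n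
  P := Pm n lam
  F := Finset.univ.image lam
  skew x y := by
    rw [Bf_sum, Bf_sum, Finset.sum_comm, ← Finset.sum_neg_distrib]
    refine Finset.sum_congr rfl fun u _ => ?_
    rw [← Finset.sum_neg_distrib]
    refine Finset.sum_congr rfl fun v _ => ?_
    have := congrFun (congrFun hskew u) v
    rw [Matrix.transpose_apply, Matrix.neg_apply] at this
    rw [this]; ring
  BS x y := by
    have h1 := Bf_D n lam heq x y
    have h2 : Bf n B (fun u => lam u.1 * x u) y + Bf n B x (fun u => lam u.1 * y u) = 0 := by
      rw [Bf_sum, Bf_sum, ← Finset.sum_add_distrib]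
      refine Finset.sum_eq_zero fun u _ => ?_
      rw [← Finset.sum_add_distrib]
      refine Finset.sum_eq_zero fun v _ => ?_
      by_cases h : lam u.1 + lam v.1 = 0
      · linear_combination (x u * B u v * y v) * h
      · rw [B_zero n lam heq _ u v rfl h]; ring
    linarith
  BP μ x y := by
    rw [Bf_sum, Bf_sum]
    refine Finset.sum_congr rfl fun u _ => Finset.sum_congr rfl fun v _ => ?_
    rw [Pm_apply, Pm_apply]
    by_cases h : lam u.1 + lam v.1 = 0
    · have : lam u.1 = μ ↔ lam v.1 = -μ := ⟨fun _ => by linarith, fun _ => by linarith⟩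
      simp only [this]
      split_ifs <;> ring
    · rw [B_zero n lam heq _ u v rfl h]; ring
  PS μ x := by
    ext y
    rw [Pm_apply, Sm_apply, Sm_apply]
    split_ifs <;> simp_all [Pm_apply]
  PP μ x := by
    ext y
    rw [Pm_apply]
    split_ifs with h
    · rfl
    · rw [Pm_apply, if_neg h]
  PP0 μ ν x h := by
    ext y
    rw [Pm_apply, Pm_apply]
    split_ifs with h1 h2
    · exact absurd (h1.symm.trans h2) h
    · rfl
    · rfl
  sumP x := by
    ext y
    rw [Finset.sum_apply]
    simp [Pm_apply]
  nil := ⟨_, Sm_nil n⟩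
end std

section fin
variable {p : ℕ} (n : Fin p → ℕ) (lam : Fin p → ℝ)

lemma exists_ker {B : Matrix (Σ i, Fin (n i)) (Σ i, Fin (n i)) ℝ}
    (hN : 1 ≤ ∑ i, n i) (hrank : B.rank = (∑ i, n i) - 1) :
    ∃ v, v ≠ 0 ∧ B *ᵥ v = 0 ∧ ∀ x, B *ᵥ x = 0 → ∃ c : ℝ, x = c • v := by
  have h1 := LinearMap.finrank_range_add_finrank_ker B.mulVecLin
  rw [Module.finrank_fintype_fun_eq_card, Fintype.card_sigma] at h1
  simp only [Fintype.card_fin] at h1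
  have h2 : Module.finrank ℝ (LinearMap.range B.mulVecLin) = (∑ i, n i) - 1 := hrank
  have h3 : Module.finrank ℝ (LinearMap.ker B.mulVecLin) = 1 := by omega
  obtain ⟨v, hv, hw⟩ := finrank_eq_one_iff'.mp h3
  refine ⟨v.1, fun h => hv (Subtype.ext h), v.2, fun x hx => ?_⟩
  obtain ⟨c, hc⟩ := hw ⟨x, hx⟩
  exact ⟨c, (congrArg Subtype.val hc).symm⟩

lemma std_vec (i : Fin p) (a : ℕ) (ha : a < n i) :
    (Sm n ^ a) (Pi.single ⟨i, ⟨n i - 1, by omega⟩⟩ 1) =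
      (Pi.single ⟨i, ⟨n i - 1 - a, by omega⟩⟩ 1 : (Σ i, Fin (n i)) → ℝ) := by
  ext ⟨j, b⟩
  rw [Sm_pow]
  by_cases hij : i = j
  · subst hij
    have := b.2
    split_ifs with h1
    · simp only [Pi.single_apply, Sigma.mk.injEq, heq_eq_eq, true_and, Fin.ext_iff]
      congr 1
      simp only [eq_iff_iff]; omega
    · simp only [Pi.single_apply, Sigma.mk.injEq, heq_eq_eq, true_and, Fin.ext_iff]
      simp only at h1
      rw [if_neg]; omega
  · split_ifs with h1 <;> simp [Ne.symm hij]

lemma AJ {w : (Σ i, Fin (n i)) → (Σ i, Fin (n i)) → ℝ}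
    (hP : ∀ x, Pm n lam (lam x.1) (w x) = w x)
    (hS : ∀ i (a : Fin (n i)), Sm n (w ⟨i, a⟩) = if h : (a:ℕ) = 0 then 0 else
      w ⟨i, ⟨a - 1, by omega⟩⟩) :
    (Matrix.of fun x y => w y x) * Matrix.blockDiagonal' (fun i => jordanBlock (n i) (lam i))
        = Matrix.blockDiagonal' (fun i => jordanBlock (n i) (lam i)) *
          (Matrix.of fun x y => w y x) := by
  have hA : ∀ y, (Matrix.of fun x y => w y x) *ᵥ (Pi.single y 1) = w y := by
    intro y; ext u; simp
  have hD : ∀ y u, lam u.1 * w y u = lam y.1 * w y u := by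
    intro y u
    have := congrFun (hP y) u
    rw [Pm_apply] at this
    split_ifs at this with h
    · rw [h]
    · rw [← this]; simp
  apply Matrix.ext_of_mulVec_single
  rintro ⟨i, a⟩
  rw [← Matrix.mulVec_mulVec, ← Matrix.mulVec_mulVec, hA]
  have h1 : (Matrix.blockDiagonal' (fun i => jordanBlock (n i) (lam i))) *ᵥ (Pi.single ⟨i, a⟩ 1) =
      lam i • Pi.single ⟨i, a⟩ 1 + Sm n (Pi.single ⟨i, a⟩ 1) := by
    ext u
    rw [Jm_mulVec]
    by_cases hu : u = ⟨i, a⟩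
    · subst hu; simp
    · simp [hu]
  have h2 : (Matrix.blockDiagonal' (fun i => jordanBlock (n i) (lam i))) *ᵥ (w ⟨i, a⟩) =
      lam i • w ⟨i, a⟩ + Sm n (w ⟨i, a⟩) := by
    ext u
    rw [Jm_mulVec, hD]; rfl
  rw [h1, h2, Matrix.mulVec_add, Matrix.mulVec_smul, hA, hS, Sm_single]
  split_ifs
  · simp
  · rw [hA]

lemma ABA (B : Matrix (Σ i, Fin (n i)) (Σ i, Fin (n i)) ℝ)
    (w : (Σ i, Fin (n i)) → (Σ i, Fin (n i)) → ℝ) (x y) :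
    ((Matrix.of fun x y => w y x)ᵀ * B * (Matrix.of fun x y => w y x)) x y =
      Bf n B (w x) (w y) := by
  have hA : ∀ y, (Matrix.of fun x y => w y x) *ᵥ (Pi.single y 1) = w y := by
    intro y; ext u; simp
  rw [← Bf_single n (_ * _), Bf_apply, ← Matrix.mulVec_mulVec, ← Matrix.mulVec_mulVec, hA,
    Matrix.dotProduct_mulVec _ (_ᵀ), Matrix.vecMul_transpose, hA, Bf_apply]

theorem main_result (hn : ∀ i, 1 ≤ n i)
    (hN : Odd (∑ i, n i))
    (B : Matrix (Σ i, Fin (n i)) (Σ i, Fin (n i)) ℝ)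
    (hskew : Bᵀ = -B) (hrank : B.rank = (∑ i, n i) - 1)
    (heq : B * Matrix.blockDiagonal' (fun i => jordanBlock (n i) (lam i))
        + (Matrix.blockDiagonal' (fun i => jordanBlock (n i) (lam i)))ᵀ * B = 0) :
    ∃ A : Matrix (Σ i, Fin (n i)) (Σ i, Fin (n i)) ℝ, IsUnit A ∧
      A * Matrix.blockDiagonal' (fun i => jordanBlock (n i) (lam i))
        = Matrix.blockDiagonal' (fun i => jordanBlock (n i) (lam i)) * A ∧
      ∃ e : (Σ i, Fin (n i)) ≃ Fin (∑ i, n i),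
        Matrix.reindex e e (Aᵀ * B * A) = canonJ (∑ i, n i) ((∑ i, n i) - 1) := by
  classical
  obtain ⟨v, hv, hBv, hvr⟩ := exists_ker n hN.pos hrank
  let s := stdSys n lam heq hskew
  have sB : ∀ x y, s.B x y = Bf n B x y := fun _ _ => rfl
  obtain ⟨ι, _, n', top', lam', hch, ⟨x0, -, hx0, hx0'⟩, hli', hsp'⟩ := s.main_fam v hv
    (fun y => by rw [s.skew, sB, Bf_apply, hBv]; simp)
    (fun x hx => by
      apply hvr
      ext u
      have := hx (Pi.single u 1)
      rw [s.skew, neg_eq_zero, sB, Bf_apply] at this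
      simpa using this)
  let top : Fin p → ((Σ i, Fin (n i)) → ℝ) := fun i => Pi.single ⟨i, ⟨n i - 1, by have := hn i; omega⟩⟩ 1
  let rev : (Σ i, Fin (n i)) ≃ (Σ i, Fin (n i)) := Equiv.sigmaCongrRight fun i => Fin.revPerm
  have hvec : s.vec n top = Pi.basisFun ℝ _ ∘ rev := by
    ext1 ⟨i, a⟩
    rw [Function.comp_apply, Pi.basisFun_apply]
    refine (std_vec n i a a.2).trans ?_
    congr 2
    ext
    simp [rev, Fin.val_rev]; omega
  obtain ⟨e, he⟩ := Sys.match_fam (s := s) (n := n) (top := top) (lam := lam) hn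
    (fun i => by
      ext y
      refine (Sm_pow n _ _ _).trans ?_
      by_cases h : y.1 = i
      · subst h; rw [dif_neg (by omega)]; rfl
      · split_ifs
        · simp only [top]; rw [Pi.single_eq_of_ne]; · rfl
          intro h'; exact h (congrArg Sigma.fst h')
        · rfl)
    (fun i => by
      ext y
      refine (Pm_apply n lam _ _ _).trans ?_
      split_ifs with h
      · rfl
      · simp only [top]; rw [Pi.single_eq_of_ne]
        intro h'; rw [h'] at h; exact h rfl)
    (by rw [hvec]; exact (Pi.basisFun ℝ _).linearIndependent.comp _ rev.injective)
    (by rw [hvec, Set.range_comp, rev.range_eq_univ, Set.image_univ, (Pi.basisFun ℝ _).span_eq])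
    hch.npos hch.nil hch.hom hli' hsp'
  let g : (Σ i, Fin (n i)) → Σ i, Fin (n' i) := fun x =>
    ⟨e x.1, ⟨n x.1 - 1 - x.2, by have := (he x.1).1; have := x.2.2; omega⟩⟩
  have hg : Function.Bijective g := by
    constructor
    · rintro ⟨i, a⟩ ⟨j, b⟩ h
      simp only [g, Sigma.mk.injEq, e.injective.eq_iff] at h
      obtain ⟨h1, h2⟩ := h
      subst h1
      simp only [heq_eq_eq, Fin.mk.injEq] at h2
      congr 1
      ext; omega
    · rintro ⟨j, b⟩
      obtain ⟨i, rfl⟩ := e.surjective j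
      have h1 := (he i).1
      have := b.2
      refine ⟨⟨i, ⟨n i - 1 - b, by omega⟩⟩, ?_⟩
      simp only [g, Sigma.mk.injEq, heq_eq_eq, true_and, Fin.ext_iff]
      omega
  let w : (Σ i, Fin (n i)) → (Σ i, Fin (n i)) → ℝ := fun x => s.vec n' top' (g x)
  refine ⟨Matrix.of fun x y => w y x, ?_, AJ n lam ?_ ?_, ?_⟩
  · rw [← Matrix.linearIndependent_cols_iff_isUnit]
    exact hli'.comp g hg.1
  · rintro ⟨i, a⟩
    show s.P (lam i) ((s.S ^ _) (top' (e i))) = (s.S ^ _) (top' (e i))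
    rw [s.Ppow, ← (he i).2, hch.hom]
  · intro i a
    have h0 := a.2
    have h1 := (he i).1
    show s.S ((s.S ^ (n i - 1 - (a:ℕ))) (top' (e i))) = _
    rw [← Module.End.mul_apply, ← pow_succ']
    split_ifs with h
    · have : n i - 1 - (a:ℕ) + 1 = n' (e i) := by omega
      rw [this, hch.nil]
    · show _ = (s.S ^ (n i - 1 - ((a:ℕ) - 1))) (top' (e i))
      congr 2; omega
  · obtain ⟨z0, hz0⟩ := hg.2 x0
    have key := fun x y => (ABA n B w x y).trans (sB _ _).symm
    apply combin _ _ _ _ z0 _ _ _ (by rw [Fintype.card_sigma]; simp)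
    · intro x y; rw [key, key, s.skew]
    · intro x y; rw [key]; exact hch.gval _ _
    · intro x y z; rw [key, key]; intro h1 h2; exact hg.1 (hch.guniq _ _ _ h1 h2)
    · intro y; rw [key]; simp only [w]; rw [hz0]; exact hx0 _
    · intro x hx
      obtain ⟨y, hy⟩ := hx0' (g x) (fun h => hx (hg.1 (h.trans hz0.symm)))
      obtain ⟨y, rfl⟩ := hg.2 y
      exact ⟨y, by rw [key]; exact hy⟩

end fin
end CF

/-- For an odd-dimensional real-eigenvalue Jordan matrix `𝒥`, every skew-symmetric solution of
`B𝒥 + 𝒥ᵀB = 0` of maximal rank `N - 1` is congruent, via an invertible element of the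
commutant of `𝒥`, to a permutation of the canonical rank-`(N-1)` form. -/
theorem canonical_form_real_odd
    (p : ℕ) (hp : 1 ≤ p) (n : Fin p → ℕ) (hn : ∀ i, 1 ≤ n i) (lam : Fin p → ℝ)
    (hN : Odd (∑ i, n i))
    (B : Matrix (Σ i, Fin (n i)) (Σ i, Fin (n i)) ℝ)
    (hskew : Bᵀ = -B) (hrank : B.rank = (∑ i, n i) - 1)
    (heq : B * Matrix.blockDiagonal' (fun i => jordanBlock (n i) (lam i))
        + (Matrix.blockDiagonal' (fun i => jordanBlock (n i) (lam i)))ᵀ * B = 0) :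
    ∃ A : Matrix (Σ i, Fin (n i)) (Σ i, Fin (n i)) ℝ, IsUnit A ∧
      A * Matrix.blockDiagonal' (fun i => jordanBlock (n i) (lam i))
        = Matrix.blockDiagonal' (fun i => jordanBlock (n i) (lam i)) * A ∧
      ∃ e : (Σ i, Fin (n i)) ≃ Fin (∑ i, n i),
        Matrix.reindex e e (Aᵀ * B * A) = canonJ (∑ i, n i) ((∑ i, n i) - 1) := by
  exact CF.main_result n lam hn hN B hskew hrank heq
end
end

section
/- Let p ≥ 1, let n : Fin p → ℕ with n i ≥ 1 for all i, let a, b : Fin p → ℝ with b i > 0 for all i, let σ = Σ i, (Fin (n i) × Fin 2), let N = 2 · Σ i, n i, and let 𝒥 = Matrix.blockDiagonal' (fun i => C_{n i}(a i, b i)) on σ. If B is a skew-symmetric invertible real matrix on σ with B * 𝒥 + 𝒥ᵀ * B = 0, then there exist an invertible matrix A on σ with A * 𝒥 = 𝒥 * A and a bijection e : σ ≃ Fin N such that reindexing Aᵀ * B * A along e yields the standard symplectic matrix J_N. (Equivalently: B is congruent, via an invertible element of the commutant of 𝒥, to Pᵀ J_N P for a permutation matrix P.) -/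
open Matrix

noncomputable section

section Abstract

open Polynomial

variable {V : Type*} [AddCommGroup V] [Module ℂ V]

/-- powers of `S - μ` as polynomials -/
def DD (μ : ℂ) (k : ℕ) : ℂ[X] := (X - C μ) ^ k

def OrthP (S : Module.End ℂ V) (h : V →ₗ⋆[ℂ] V →ₗ[ℂ] ℂ) (y z : V) : Prop :=
  ∀ r : ℂ[X], h (aeval S r y) z = 0

structure SA (S : Module.End ℂ V) (h : V →ₗ⋆[ℂ] V →ₗ[ℂ] ℂ) : Prop where
  herm : ∀ y z, (starRingEnd ℂ) (h y z) = h z y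
  sa : ∀ y z, h (S y) z = h y (S z)

theorem DD_map (μ : ℂ) (k : ℕ) : (DD μ k).map (starRingEnd ℂ) = DD (starRingEnd ℂ μ) k := by
  simp [DD]

theorem DD_add (μ : ℂ) (k l : ℕ) : DD μ (k + l) = DD μ k * DD μ l := by
  simp [DD, pow_add]

theorem SA.adj {S : Module.End ℂ V} {h : V →ₗ⋆[ℂ] V →ₗ[ℂ] ℂ} (H : SA S h) (p : ℂ[X]) :
    ∀ y z, h (aeval S p y) z = h y (aeval S (p.map (starRingEnd ℂ)) z) := by
  induction p using Polynomial.induction_on' with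
  | add p q hp hq => intro y z; simp [hp, hq]
  | monomial n a =>
    intro y z
    simp only [aeval_monomial, map_monomial, Module.End.mul_apply,
      Module.algebraMap_end_apply, map_smulₛₗ, LinearMap.smul_apply, RingHom.id_apply]
    congr 1
    induction n generalizing y z with
    | zero => simp
    | succ n ih => 
      rw [pow_succ, Module.End.mul_apply, ih, H.sa, ← Module.End.mul_apply, ← pow_succ', pow_succ]

theorem aeval_mul_app (S : Module.End ℂ V) (p q : ℂ[X]) (y : V) :
    aeval S p (aeval S q y) = aeval S (p * q) y := by
  rw [map_mul, Module.End.mul_apply]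

section
variable {S : Module.End ℂ V} {h : V →ₗ⋆[ℂ] V →ₗ[ℂ] ℂ}

theorem OrthP.left {y z : V} (o : OrthP S h y z) (p : ℂ[X]) : OrthP S h (aeval S p y) z := by
  intro r; rw [aeval_mul_app]; exact o _

theorem OrthP.right (H : SA S h) {y z : V} (o : OrthP S h y z) (p : ℂ[X]) :
    OrthP S h y (aeval S p z) := by
  intro r
  have h1 := H.adj (p.map (starRingEnd ℂ)) (aeval S r y) z
  have : (p.map (starRingEnd ℂ)).map (starRingEnd ℂ) = p := by
    rw [Polynomial.map_map]; simp
  rw [this] at h1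
  rw [← h1, aeval_mul_app]; exact o _

theorem OrthP.symm (H : SA S h) {y z : V} (o : OrthP S h y z) : OrthP S h z y := by
  intro r
  rw [H.adj, ← H.herm, o]; simp

theorem OrthP.zero_right {y : V} : OrthP S h y 0 := by
  intro r; simp

theorem OrthP.add_right {y z w : V} (o : OrthP S h y z) (o' : OrthP S h y w) :
    OrthP S h y (z + w) := by
  intro r; simp [o r, o' r]

theorem OrthP.sub_right {y z w : V} (o : OrthP S h y z) (o' : OrthP S h y w) :
    OrthP S h y (z - w) := by
  intro r; simp [o r, o' r]

theorem OrthP.smul_right {y z : V} (o : OrthP S h y z) (c : ℂ) :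
    OrthP S h y (c • z) := by
  intro r; simp [o r]

theorem OrthP.sum_right {κ : Type*} {y : V} {z : κ → V} {t : Finset κ}
    (o : ∀ k ∈ t, OrthP S h y (z k)) : OrthP S h y (∑ k ∈ t, z k) := by
  intro r; rw [map_sum]; exact Finset.sum_eq_zero fun k hk => o k hk r

theorem OrthP.sum_left {κ : Type*} {y : V} {z : κ → V} {t : Finset κ}
    (o : ∀ k ∈ t, OrthP S h (z k) y) : OrthP S h (∑ k ∈ t, z k) y := by
  intro r; rw [map_sum, map_sum, LinearMap.sum_apply]; exact Finset.sum_eq_zero fun k hk => o k hk r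

theorem OrthP.of_pow {μ : ℂ} {y z : V} (o : ∀ l, h (aeval S (DD μ l) y) z = 0) :
    OrthP S h y z := by
  intro r
  rw [← Polynomial.sum_taylor_eq r μ, Polynomial.sum]
  simp only [map_sum, LinearMap.sum_apply]
  refine Finset.sum_eq_zero fun l _ => ?_
  rw [← aeval_mul_app, aeval_C, Module.algebraMap_end_apply, ← DD, map_smulₛₗ, LinearMap.smul_apply,
    o l, smul_zero]

theorem OrthP.of_ne (H : SA S h) {μ ν : ℂ} {N M : ℕ} {y z : V}
    (hy : aeval S (DD μ N) y = 0) (hz : aeval S (DD ν M) z = 0)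
    (hne : starRingEnd ℂ μ ≠ ν) : OrthP S h y z := by
  have hco : IsCoprime (DD (starRingEnd ℂ μ) N) (DD ν M) := by
    apply IsCoprime.pow
    exact Polynomial.isCoprime_X_sub_C_of_isUnit_sub (sub_ne_zero.2 hne).isUnit
  obtain ⟨a, b, hab⟩ := hco
  have hz' : z = aeval S (DD (starRingEnd ℂ μ) N) (aeval S a z) := by
    conv_lhs => rw [show z = aeval S (1 : ℂ[X]) z by simp, ← hab]
    rw [map_add, LinearMap.add_apply, ← aeval_mul_app S b, hz, aeval_mul_app, mul_comm]
    simp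
  intro r
  rw [hz', ← DD_map, ← H.adj, aeval_mul_app, mul_comm, ← aeval_mul_app, hy]
  simp

theorem kill_ge {μ : ℂ} {N k : ℕ} {y : V} (hy : aeval S (DD μ N) y = 0) (hk : N ≤ k) :
    aeval S (DD μ k) y = 0 := by
  obtain ⟨d, rfl⟩ := Nat.exists_eq_add_of_le hk
  rw [add_comm, DD_add, ← aeval_mul_app, hy, map_zero]

theorem kill_poly {μ : ℂ} {N : ℕ} {y : V} (hy : aeval S (DD μ N) y = 0) (f : ℂ[X]) :
    aeval S (DD μ N) (aeval S f y) = 0 := by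
  rw [aeval_mul_app, mul_comm, ← aeval_mul_app, hy, map_zero]

/-- linear normalisation -/
theorem normB (H : SA S h) {μ ν : ℂ} (hμν : starRingEnd ℂ μ = ν) {N : ℕ} (hN : 1 ≤ N) {u v : V}
    (hu : aeval S (DD μ N) u = 0) (hne : h (aeval S (DD μ (N - 1)) u) v ≠ 0) :
    ∃ f : ℂ[X], f.eval ν ≠ 0 ∧ ∀ k, h (aeval S (DD μ k) u) (aeval S f v) =
      if k + 1 = N then 1 else 0 := by
  have key : ∀ M : ℕ, ∃ f : ℂ[X], f.eval ν ≠ 0 ∧ 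
      h (aeval S (DD μ (N - 1)) u) (aeval S f v) = 1 ∧
      ∀ k, k + 1 < N → N ≤ k + 1 + M → h (aeval S (DD μ k) u) (aeval S f v) = 0 := by
    intro M
    induction M with
    | zero =>
      refine ⟨C (h (aeval S (DD μ (N - 1)) u) v)⁻¹, by simpa using hne, ?_, ?_⟩
      · simp [hne]
      · intro k h1 h2; omega
    | succ M ih =>
      obtain ⟨f, f0, f1, f2⟩ := ih
      set k0 := N - (M + 2) with hk0
      set c := - h (aeval S (DD μ k0) u) (aeval S f v) with hc
      have expd : ∀ k, h (aeval S (DD μ k) u) (aeval S (f * (1 + C c * DD ν (M+1))) v) =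
          h (aeval S (DD μ k) u) (aeval S f v) + 
            c * h (aeval S (DD μ (k + (M + 1))) u) (aeval S f v) := by
        intro k
        have : aeval S (f * (1 + C c * DD ν (M+1))) v = 
          aeval S f v + c • aeval S (DD ν (M+1)) (aeval S f v) := by
          rw [mul_add, mul_one, map_add, LinearMap.add_apply, aeval_mul_app, mul_left_comm,
            ← aeval_mul_app S (C c), aeval_C, Module.algebraMap_end_apply, mul_comm (DD _ _)]
        rw [this, map_add, map_smul, smul_eq_mul, ← hμν, ← DD_map, ← H.adj, aeval_mul_app,
          ← DD_add, add_comm (M+1)]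
      refine ⟨f * (1 + C c * DD ν (M+1)), by simpa [DD] using f0, ?_, ?_⟩
      · rw [expd, f1, kill_ge hu (by omega)]; simp
      · intro k h1 h2
        rw [expd]
        by_cases hk : N ≤ k + 1 + M
        · rw [f2 k h1 hk, kill_ge hu (by omega)]; simp
        · have e1 : k = k0 := by omega
          have e2 : k + (M + 1) = N - 1 := by omega
          rw [e2, f1, e1, hc]; ring
  obtain ⟨f, f0, f1, f2⟩ := key N
  refine ⟨f, f0, fun k => ?_⟩
  split_ifs with hk
  · rw [← f1, ← hk]; rfl
  · rcases lt_or_ge (k+1) N with h1 | h1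
    · exact f2 k h1 (by omega)
    · rw [kill_ge hu (by omega)]; simp

theorem normA (H : SA S h) {μ : ℂ} (hμ : starRingEnd ℂ μ = μ) {N : ℕ} (hN : 1 ≤ N) {v : V}
    (hv : aeval S (DD μ N) v = 0) (hne : h (aeval S (DD μ (N - 1)) v) v ≠ 0) :
    ∃ f : ℂ[X], f.eval μ ≠ 0 ∧ ∃ ε : ℂ, (ε = 1 ∨ ε = -1) ∧
      ∀ k, h (aeval S (DD μ k) (aeval S f v)) (aeval S f v) = if k + 1 = N then ε else 0 := by
  have real : ∀ k w, (starRingEnd ℂ) (h (aeval S (DD μ k) w) w) = h (aeval S (DD μ k) w) w := by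
    intro k w
    rw [H.herm, H.adj, DD_map, hμ]
  have key : ∀ M : ℕ, ∃ f : ℂ[X], f.eval μ ≠ 0 ∧ 
      h (aeval S (DD μ (N - 1)) (aeval S f v)) (aeval S f v) ≠ 0 ∧
      ∀ k, k + 1 < N → N ≤ k + 1 + M → h (aeval S (DD μ k) (aeval S f v)) (aeval S f v) = 0 := by
    intro M
    induction M with
    | zero =>
      refine ⟨1, by simp, by simpa using hne, ?_⟩
      · intro k h1 h2; omega
    | succ M ih =>
      obtain ⟨f, f0, f1, f2⟩ := ih
      set w := aeval S f v with hw
      have kw : aeval S (DD μ N) w = 0 := kill_poly hv f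
      set k0 := N - (M + 2) with hk0
      set c := - h (aeval S (DD μ k0) w) w / (2 * h (aeval S (DD μ (N-1)) w) w) with hc
      have hcr : starRingEnd ℂ c = c := by
        rw [hc, map_div₀, map_neg, map_mul, real, real, map_ofNat]
      have hww : aeval S (f * (1 + C c * DD μ (M+1))) v = w + c • aeval S (DD μ (M+1)) w := by
          rw [mul_add, mul_one, map_add, LinearMap.add_apply, hw, aeval_mul_app, mul_left_comm,
            ← aeval_mul_app S (C c), aeval_C, Module.algebraMap_end_apply, mul_comm (DD _ _)]
      have expd : ∀ k, h (aeval S (DD μ k) (w + c • aeval S (DD μ (M+1)) w))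
          (w + c • aeval S (DD μ (M+1)) w) =
          h (aeval S (DD μ k) w) w + 2 * c * h (aeval S (DD μ (k + (M + 1))) w) w
           + c * c * h (aeval S (DD μ (k + (M + 1) + (M + 1))) w) w := by
        intro k
        have e1 : ∀ y, h y (aeval S (DD μ (M+1)) w) = h (aeval S (DD μ (M+1)) y) w := by
          intro y; rw [H.adj, DD_map, hμ]
        simp only [map_add, map_smul, map_smulₛₗ, LinearMap.add_apply, LinearMap.smul_apply, 
          smul_eq_mul, hcr, e1, aeval_mul_app, ← DD_add]
        rw [show M + 1 + k = k + (M+1) by omega, show M + 1 + (k + (M + 1)) = k + (M+1) + (M+1) by omega]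
        ring
      refine ⟨f * (1 + C c * DD μ (M+1)), by simpa [DD] using f0, ?_, ?_⟩
      · rw [hww, expd, kill_ge kw (by omega : N ≤ N - 1 + (M + 1)),
          kill_ge kw (by omega : N ≤ N - 1 + (M + 1) + (M + 1))]; simpa using f1
      · intro k h1 h2
        rw [hww, expd, kill_ge kw (by omega : N ≤ k + (M + 1) + (M + 1))]
        by_cases hk : N ≤ k + 1 + M
        · rw [f2 k h1 hk, kill_ge kw (by omega)]; simp
        · have e1 : k = k0 := by omega
          have e2 : k + (M + 1) = N - 1 := by omega
          rw [e2, e1, hc]; rw [map_zero, LinearMap.zero_apply]; field_simp; ring_nf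
  obtain ⟨f, f0, f1, f2⟩ := key N
  set w := aeval S f v with hw
  have kw : aeval S (DD μ N) w = 0 := kill_poly hv f
  obtain ⟨r, hr⟩ := Complex.conj_eq_iff_real.1 (real (N-1) w)
  have hr0 : r ≠ 0 := by rintro rfl; exact f1 (by simpa using hr)
  have hs : Real.sqrt |r| ≠ 0 := (Real.sqrt_pos.2 (abs_pos.2 hr0)).ne'
  have hs2 : Real.sqrt |r| * Real.sqrt |r| = |r| := Real.mul_self_sqrt (abs_nonneg _)
  set c : ℂ := (((Real.sqrt |r|)⁻¹ : ℝ) : ℂ) with hc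
  have hww : aeval S (C c * f) v = c • w := by
    rw [← aeval_mul_app, aeval_C, Module.algebraMap_end_apply]
  refine ⟨C c * f, ?_, ((r / |r| : ℝ) : ℂ), ?_, fun k => ?_⟩
  · rw [eval_mul, eval_C]; refine mul_ne_zero ?_ f0; rw [hc]; exact_mod_cast inv_ne_zero hs
  · rcases lt_or_gt_of_ne hr0 with h | h
    · right; rw [abs_of_neg h, div_neg, div_self hr0]; simp
    · left; rw [abs_of_pos h, div_self hr0]; simp
  rw [hww]
  simp only [map_smul, map_smulₛₗ, LinearMap.smul_apply, smul_eq_mul]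
  rw [show starRingEnd ℂ c = c by rw [hc]; exact Complex.conj_ofReal _]
  split_ifs with hk
  · have : k = N - 1 := by omega
    rw [this, hr, hc, ← Complex.ofReal_mul, ← Complex.ofReal_mul]
    congr 1
    rw [← mul_assoc, ← mul_inv, hs2, div_eq_inv_mul]
  · rcases lt_or_ge (k+1) N with h1 | h1
    · rw [f2 k h1 (by omega)]; simp
    · rw [kill_ge kw (by omega)]; simp

end

section Fam
variable {ι : Type*} [DecidableEq ι]

structure Good (S : Module.End ℂ V) (h : V →ₗ⋆[ℂ] V →ₗ[ℂ] ℂ) (μ : ι → ℂ) (n : ι → ℕ)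
    (s : Finset ι) (v : ι → V) : Prop where
  kill : ∀ i ∈ s, aeval S (DD (μ i) (n i)) (v i) = 0
  nd : ∀ q : ι → ℂ[X], (∀ j ∈ s, OrthP S h (∑ i ∈ s, aeval S (q i) (v i)) (v j)) →
    ∀ i ∈ s, DD (μ i) (n i) ∣ q i

def TransP (S : Module.End ℂ V) (h : V →ₗ⋆[ℂ] V →ₗ[ℂ] ℂ) (s : Finset ι) (v w : ι → V) : Prop :=
  ∀ y, (∀ j ∈ s, OrthP S h y (v j)) → ∀ i ∈ s, OrthP S h y (w i)

structure GramP (S : Module.End ℂ V) (h : V →ₗ⋆[ℂ] V →ₗ[ℂ] ℂ) (μ : ι → ℂ) (n : ι → ℕ)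
    (t : Finset ι) (v : ι → V) (π : ι → ι) (ε : ι → ℂ) : Prop where
  mem : ∀ i ∈ t, π i ∈ t
  inv : ∀ i ∈ t, π (π i) = i
  n_eq : ∀ i ∈ t, n (π i) = n i
  eps_eq : ∀ i ∈ t, ε (π i) = ε i
  eps : ∀ i ∈ t, ε i = 1 ∨ ε i = -1
  mu_eq : ∀ i ∈ t, μ (π i) = starRingEnd ℂ (μ i)
  gram : ∀ i ∈ t, ∀ j ∈ t, ∀ k l, h (aeval S (DD (μ i) k) (v i)) (aeval S (DD (μ j) l) (v j)) =
    if j = π i ∧ k + l + 1 = n i then ε i else 0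

variable {S : Module.End ℂ V} {h : V →ₗ⋆[ℂ] V →ₗ[ℂ] ℂ} {μ : ι → ℂ} {n : ι → ℕ}
  {s : Finset ι} {v : ι → V}

theorem upd_unit (H : SA S h) (G : Good S h μ n s v) {i : ι} (hi : i ∈ s) {f : ℂ[X]}
    (hf : f.eval (μ i) ≠ 0) :
    Good S h μ n s (Function.update v i (aeval S f (v i))) ∧
      TransP S h s v (Function.update v i (aeval S f (v i))) := by
  have hco : IsCoprime f (DD (μ i) (n i)) := by
    apply IsCoprime.pow_right
    rw [isCoprime_comm, (Polynomial.irreducible_X_sub_C _).coprime_iff_not_dvd,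
      Polynomial.dvd_iff_isRoot]
    exact hf
  refine ⟨⟨?_, ?_⟩, ?_⟩
  · intro j hj
    rcases eq_or_ne j i with rfl | hne
    · rw [Function.update_self]; exact kill_poly (G.kill j hj) f
    · rw [Function.update_of_ne hne]; exact G.kill j hj
  · intro q hq
    have hsum : ∑ k ∈ s, aeval S (q k) (Function.update v i (aeval S f (v i)) k) =
        ∑ k ∈ s, aeval S (Function.update q i (q i * f) k) (v k) := by
      refine Finset.sum_congr rfl fun k _ => ?_
      rcases eq_or_ne k i with rfl | hne
      · simp only [Function.update_self, aeval_mul_app]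
      · simp only [Function.update_of_ne hne]
    have h1 := G.nd (Function.update q i (q i * f)) (by
      intro j hj
      have := hq j hj
      rw [hsum] at this
      rcases eq_or_ne j i with rfl | hne
      · rw [Function.update_self] at this
        obtain ⟨a, b, hab⟩ := hco
        have e : v j = aeval S a (aeval S f (v j)) := by
          conv_lhs => rw [show v j = aeval S (1 : ℂ[X]) (v j) by simp, ← hab]
          rw [map_add, LinearMap.add_apply, ← aeval_mul_app S b, G.kill j hj, aeval_mul_app]
          simp
        rw [e]
        exact this.right H a
      · rwa [Function.update_of_ne hne] at this)
    intro j hj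
    have h2 := h1 j hj
    rcases eq_or_ne j i with rfl | hne
    · rw [Function.update_self] at h2
      exact hco.symm.dvd_of_dvd_mul_right h2
    · rwa [Function.update_of_ne hne] at h2
  · intro y hy j hj
    rcases eq_or_ne j i with rfl | hne
    · rw [Function.update_self]; exact (hy j hj).right H f
    · rw [Function.update_of_ne hne]; exact hy j hj

theorem upd_add (H : SA S h) (G : Good S h μ n s v) {i j : ι} (hi : i ∈ s) (hj : j ∈ s)
    (hij : j ≠ i) (hμ : μ j = μ i) (hn : n j = n i) (c : ℂ) :
    Good S h μ n s (Function.update v i (v i + c • v j)) ∧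
      TransP S h s v (Function.update v i (v i + c • v j)) := by
  refine ⟨⟨?_, ?_⟩, ?_⟩
  · intro k hk
    rcases eq_or_ne k i with rfl | hne
    · rw [Function.update_self, map_add, map_smul, G.kill k hk, ← hμ, ← hn, G.kill j hj]; simp
    · rw [Function.update_of_ne hne]; exact G.kill k hk
  · intro q hq
    have hsum : ∑ k ∈ s, aeval S (q k) (Function.update v i (v i + c • v j) k) =
        ∑ k ∈ s, aeval S (Function.update q j (q j + C c * q i) k) (v k) := by
      have e1 : ∀ k ∈ s, aeval S (q k) (Function.update v i (v i + c • v j) k) =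
          aeval S (q k) (v k) + if k = i then c • aeval S (q i) (v j) else 0 := by
        intro k _
        rcases eq_or_ne k i with rfl | hne
        · simp
        · simp [Function.update_of_ne hne, hne]
      have e2 : ∀ k ∈ s, aeval S (Function.update q j (q j + C c * q i) k) (v k) =
          aeval S (q k) (v k) + if k = j then c • aeval S (q i) (v j) else 0 := by
        intro k _
        rcases eq_or_ne k j with rfl | hne
        · simp
        · simp [Function.update_of_ne hne, hne]
      rw [Finset.sum_congr rfl e1, Finset.sum_congr rfl e2, Finset.sum_add_distrib,
        Finset.sum_add_distrib]
      simp [hi, hj]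
    have h1 := G.nd (Function.update q j (q j + C c * q i)) (by
      intro k hk
      have := hq k hk
      have hj' := hq j hj
      rw [hsum] at this hj'
      rw [Function.update_of_ne hij] at hj'
      rcases eq_or_ne k i with rfl | hne
      · rw [Function.update_self] at this
        have := this.sub_right (hj'.smul_right c)
        simpa using this
      · rwa [Function.update_of_ne hne] at this)
    intro k hk
    have h2 := h1 k hk
    rcases eq_or_ne k j with rfl | hne
    · rw [Function.update_self] at h2
      have h3 := h1 i hi
      rw [Function.update_of_ne hij.symm, ← hμ, ← hn] at h3
      exact (dvd_add_left (h3.mul_left _)).1 h2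
    · rwa [Function.update_of_ne hne] at h2
  · intro y hy k hk
    rcases eq_or_ne k i with rfl | hne
    · rw [Function.update_self]; exact (hy k hk).add_right ((hy j hj).smul_right c)
    · rw [Function.update_of_ne hne]; exact hy k hk

theorem exists_partner (H : SA S h) (G : Good S h μ n s v) {i : ι} (hi : i ∈ s)
    (hmax : ∀ j ∈ s, n j ≤ n i) (hn : 1 ≤ n i) :
    ∃ j ∈ s, n j = n i ∧ μ j = starRingEnd ℂ (μ i) ∧
      h (aeval S (DD (μ i) (n i - 1)) (v i)) (v j) ≠ 0 := by
  have ex : ∃ j ∈ s, h (aeval S (DD (μ i) (n i - 1)) (v i)) (v j) ≠ 0 := by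
    by_contra! hc
    have h1 := G.nd (Pi.single i (DD (μ i) (n i - 1))) (by
      intro j hj
      have : ∑ k ∈ s, aeval S ((Pi.single i (DD (μ i) (n i - 1)) : ι → ℂ[X]) k) (v k) =
          aeval S (DD (μ i) (n i - 1)) (v i) := by
        rw [Finset.sum_eq_single i]
        · simp
        · intro k _ hk; simp [hk]
        · intro h; exact absurd hi h
      rw [this]
      apply OrthP.of_pow (μ := μ i)
      intro l
      rcases Nat.eq_zero_or_pos l with rfl | hl
      · simpa [DD] using hc j hj
      · rw [aeval_mul_app, ← DD_add, kill_ge (G.kill i hi) (by omega)]; simp) i hi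
    rw [Pi.single_eq_same, DD, DD, pow_dvd_pow_iff (Polynomial.X_sub_C_ne_zero _)
      (Polynomial.not_isUnit_X_sub_C _)] at h1
    omega
  obtain ⟨j, hj, hne⟩ := ex
  have hμ : μ j = starRingEnd ℂ (μ i) := by
    by_contra hc
    exact hne (OrthP.of_ne H (G.kill i hi) (G.kill j hj) (Ne.symm hc) _)
  refine ⟨j, hj, ?_, hμ, hne⟩
  rw [H.adj, DD_map, ← hμ] at hne
  by_contra hc
  have := hmax j hj
  rw [kill_ge (G.kill j hj) (by omega)] at hne
  simp at hne

theorem caseA (H : SA S h) (G : Good S h μ n s v) {i : ι} (hi : i ∈ s)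
    (hμ : starRingEnd ℂ (μ i) = μ i) (hn : 1 ≤ n i)
    (hne : h (aeval S (DD (μ i) (n i - 1)) (v i)) (v i) ≠ 0) :
    ∃ v2 t π ε, Good S h μ n s v2 ∧ TransP S h s v v2 ∧ t ⊆ s ∧ t.Nonempty ∧
      GramP S h μ n t v2 π ε := by
  obtain ⟨f, f0, ε, hε, hf⟩ := normA H hμ hn (G.kill i hi) hne
  obtain ⟨g1, g2⟩ := upd_unit H G hi f0
  refine ⟨_, {i}, id, fun _ => ε, g1, g2, by simpa using hi, by simp, ?_⟩
  constructor <;> simp only [Finset.mem_singleton, forall_eq, id]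
  · exact hε
  · exact hμ.symm
  · intro k l
    rw [Function.update_self]
    rw [show DD (μ i) l = (DD (μ i) l).map (starRingEnd ℂ) by rw [DD_map, hμ], ← H.adj, aeval_mul_app,
      ← DD_add, hf, add_comm l k]
    simp

theorem caseB (H : SA S h) (G : Good S h μ n s v) {i j : ι} (hi : i ∈ s) (hj : j ∈ s)
    (hμ : μ j = starRingEnd ℂ (μ i)) (hμ' : μ j ≠ μ i) (hn : 1 ≤ n i) (hn' : n j = n i)
    (hne : h (aeval S (DD (μ i) (n i - 1)) (v i)) (v j) ≠ 0) :
    ∃ v2 t π ε, Good S h μ n s v2 ∧ TransP S h s v v2 ∧ t ⊆ s ∧ t.Nonempty ∧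
      GramP S h μ n t v2 π ε := by
  obtain ⟨f, f0, hf⟩ := normB H hμ.symm hn (G.kill i hi) hne
  obtain ⟨g1, g2⟩ := upd_unit H G hj f0
  have hij : i ≠ j := by rintro rfl; exact hμ' rfl
  have hμ2 : μ i = starRingEnd ℂ (μ j) := by rw [hμ]; simp
  set v2 := Function.update v j (aeval S f (v j)) with hv2
  have vi : v2 i = v i := Function.update_of_ne hij _ _
  have vj : v2 j = aeval S f (v j) := Function.update_self _ _ _
  have gij : ∀ k l, h (aeval S (DD (μ i) k) (v2 i)) (aeval S (DD (μ j) l) (v2 j)) =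
      if k + l + 1 = n i then 1 else 0 := by
    intro k l
    rw [vi, vj, hμ, ← DD_map, ← H.adj, aeval_mul_app, ← DD_add, hf, add_comm l k]
  refine ⟨v2, {i, j}, Equiv.swap i j, fun _ => 1, g1, g2, ?_, by simp, ?_⟩
  · intro k; simp only [Finset.mem_insert, Finset.mem_singleton]; rintro (rfl | rfl) <;> assumption
  constructor <;> simp only [Finset.mem_singleton, Finset.mem_insert, forall_eq_or_imp, forall_eq,
    Equiv.swap_apply_left, Equiv.swap_apply_right]
  · simp
  · simp
  · exact ⟨hn', hn'.symm⟩
  · simp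
  · simp
  · exact ⟨hμ, hμ2⟩
  · refine ⟨⟨fun k l => ?_, fun k l => ?_⟩, ⟨fun k l => ?_, fun k l => ?_⟩⟩
    · rw [if_neg (fun h => hij h.1)]
      exact (OrthP.of_ne H (g1.kill i hi) (g1.kill i hi) (by rw [← hμ]; exact hμ')).right H _ _
    · rw [gij]; simp
    · rw [← H.herm, gij, hn', add_comm l k]; simp only [true_and]; split_ifs <;> simp
    · rw [if_neg (fun h => hij h.1.symm)]
      exact (OrthP.of_ne H (g1.kill j hj) (g1.kill j hj) (by rw [← hμ2]; exact hμ'.symm)).right H _ _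

theorem exists_block (H : SA S h) (G : Good S h μ n s v) (hs : s.Nonempty) (hn : ∀ i, 1 ≤ n i) :
    ∃ v2 t π ε, Good S h μ n s v2 ∧ TransP S h s v v2 ∧ t ⊆ s ∧ t.Nonempty ∧
      GramP S h μ n t v2 π ε := by
  obtain ⟨i, hi, hmax⟩ := Finset.exists_max_image s n hs
  obtain ⟨j, hj, hnj, hμ, hne⟩ := exists_partner H G hi hmax (hn i)
  by_cases hμ' : μ j = μ i
  swap
  · exact caseB H G hi hj hμ hμ' (hn i) hnj hne
  have hr : starRingEnd ℂ (μ i) = μ i := by rw [← hμ, hμ']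
  by_cases hα : h (aeval S (DD (μ i) (n i - 1)) (v i)) (v i) = 0
  swap
  · exact caseA H G hi hr (hn i) hα
  by_cases hγ : h (aeval S (DD (μ j) (n j - 1)) (v j)) (v j) = 0
  swap
  · exact caseA H G hj (by rw [hμ', hr]) (hn j) hγ
  have hij : j ≠ i := by rintro rfl; exact hne hα
  set β := h (aeval S (DD (μ i) (n i - 1)) (v i)) (v j) with hβ
  obtain ⟨g1, g2⟩ := upd_add H G hi hj hij hμ' hnj (starRingEnd ℂ β)
  obtain ⟨v2, t, π, ε, k1, k2, k3, k4, k5⟩ := caseA H g1 hi hr (hn i) (by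
    rw [Function.update_self]
    have hβ2 : h (aeval S (DD (μ i) (n i - 1)) (v j)) (v i) = starRingEnd ℂ β := by
      rw [hβ, H.herm, H.adj, DD_map, hr]
    rw [hμ', hnj] at hγ
    simp only [map_add, map_smul, map_smulₛₗ, LinearMap.add_apply, LinearMap.smul_apply, hα, hγ,
      hβ2, ← hβ, smul_eq_mul, Complex.conj_conj]
    intro hc
    have : starRingEnd ℂ β * β = 0 := by linear_combination hc / 2
    simp [hne] at this)
  exact ⟨v2, t, π, ε, k1, fun y hy => k2 y (g2 y hy), k3, k4, k5⟩

/-- projection piece -/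
def QQ (S : Module.End ℂ V) (h : V →ₗ⋆[ℂ] V →ₗ[ℂ] ℂ) (μ ν : ℂ) (N : ℕ) (u w : V) (e : ℂ) (y : V) : V :=
  ∑ m ∈ Finset.range N, (e * h (aeval S (DD ν (N - 1 - m)) u) y) • aeval S (DD μ m) w

theorem QQ_S (H : SA S h) {μ ν : ℂ} (hμν : starRingEnd ℂ μ = ν) {N : ℕ} {u w : V}
    (hu : aeval S (DD ν N) u = 0) (hw : aeval S (DD μ N) w = 0) (e : ℂ) (y : V) :
    QQ S h μ ν N u w e (S y) = S (QQ S h μ ν N u w e y) := by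
  have hadd : ∀ y z, QQ S h μ ν N u w e (y + z) = QQ S h μ ν N u w e y + QQ S h μ ν N u w e z := by
    intro y z; simp [QQ, mul_add, add_smul, Finset.sum_add_distrib]
  have hsmul : ∀ (c : ℂ) y, QQ S h μ ν N u w e (c • y) = c • QQ S h μ ν N u w e y := by
    intro c y; simp only [QQ, Finset.smul_sum, map_smul, smul_smul, smul_eq_mul]
    refine Finset.sum_congr rfl fun m _ => ?_
    congr 1; ring
  have hx : ∀ y, aeval S (DD μ 1) y = S y - μ • y := by intro y; simp [DD]
  have hS : ∀ y, S y = aeval S (DD μ 1) y + μ • y := by intro y; rw [hx]; simp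
  rw [hS y, hS (QQ S h μ ν N u w e y), hadd, hsmul]
  congr 1
  cases N with
  | zero => simp [QQ]
  | succ N =>
    unfold QQ
    rw [map_sum, Finset.sum_range_succ', Finset.sum_range_succ]
    have adj1 : ∀ z, h z (aeval S (DD μ 1) y) = h (aeval S (DD ν 1) z) y := by
      intro z; rw [H.adj, DD_map, ← hμν]; simp
    simp only [map_smul, aeval_mul_app, ← DD_add, adj1]
    rw [show 1 + N = N + 1 by omega, hw, show 1 + (N + 1 - 1 - 0) = N + 1 by omega, hu]
    simp only [map_zero, LinearMap.zero_apply, mul_zero, zero_smul, smul_zero, add_zero]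
    refine Finset.sum_congr rfl fun m hm => ?_
    rw [Finset.mem_range] at hm
    rw [show 1 + (N + 1 - 1 - (m + 1)) = N + 1 - 1 - m by omega, show 1 + m = m + 1 by omega]

/-- projection -/
def PP (S : Module.End ℂ V) (h : V →ₗ⋆[ℂ] V →ₗ[ℂ] ℂ) (μ : ι → ℂ) (n : ι → ℕ) (t : Finset ι)
    (v : ι → V) (π : ι → ι) (ε : ι → ℂ) : V →ₗ[ℂ] V where
  toFun y := ∑ a ∈ t, QQ S h (μ a) (μ (π a)) (n a) (v (π a)) (v a) (ε a) y
  map_add' y z := by simp [QQ, mul_add, add_smul, Finset.sum_add_distrib]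
  map_smul' c y := by
    simp only [QQ, Finset.smul_sum, map_smul, smul_smul, smul_eq_mul, RingHom.id_apply]
    refine Finset.sum_congr rfl fun a _ => Finset.sum_congr rfl fun m _ => ?_
    congr 1; ring

variable {t : Finset ι} {π : ι → ι} {ε : ι → ℂ}


theorem PP_apply (y : V) : PP S h μ n t v π ε y =
    ∑ a ∈ t, QQ S h (μ a) (μ (π a)) (n a) (v (π a)) (v a) (ε a) y := rfl

theorem PP_poly (H : SA S h) (G : Good S h μ n s v) (hts : t ⊆ s) (P : GramP S h μ n t v π ε) 
    (p : ℂ[X]) (y : V) :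
    PP S h μ n t v π ε (aeval S p y) = aeval S p (PP S h μ n t v π ε y) := by
  have h1 : ∀ y, PP S h μ n t v π ε (S y) = S (PP S h μ n t v π ε y) := by
    intro y
    rw [PP_apply, PP_apply, map_sum]
    refine Finset.sum_congr rfl fun a ha => ?_
    apply QQ_S H (P.mu_eq a ha).symm _ (G.kill a (hts ha))
    rw [← P.n_eq a ha]
    exact G.kill _ (hts (P.mem a ha))
  have h2 : Commute (PP S h μ n t v π ε : Module.End ℂ V) S := LinearMap.ext h1
  have h3 : Commute (PP S h μ n t v π ε : Module.End ℂ V) (aeval S p) := by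
    induction p using Polynomial.induction_on' with
    | add p q hp hq => rw [map_add]; exact hp.add_right hq
    | monomial k a => 
      rw [aeval_monomial]
      exact (Algebra.commute_algebraMap_right a _).mul_right (h2.pow_right k)
  exact LinearMap.congr_fun h3 y

def PC (S : Module.End ℂ V) (h : V →ₗ⋆[ℂ] V →ₗ[ℂ] ℂ) (μ : ι → ℂ) (n : ι → ℕ) 
    (v : ι → V) (π : ι → ι) (ε : ι → ℂ) (a : ι) (y : V) : ℂ[X] :=
  ∑ m ∈ Finset.range (n a), C (ε a * h (aeval S (DD (μ (π a)) (n a - 1 - m)) (v (π a))) y) * DD (μ a) m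

theorem PP_eq (y : V) : PP S h μ n t v π ε y = ∑ a ∈ t, aeval S (PC S h μ n v π ε a y) (v a) := by
  simp only [PP, LinearMap.coe_mk, AddHom.coe_mk, QQ, PC]
  refine Finset.sum_congr rfl fun a _ => ?_
  rw [map_sum, LinearMap.sum_apply]
  refine Finset.sum_congr rfl fun m _ => ?_
  rw [← aeval_mul_app, aeval_C, Module.algebraMap_end_apply]

theorem PP_orth (G : Good S h μ n s v) (hts : t ⊆ s) (P : GramP S h μ n t v π ε) 
    (y : V) {b : ι} (hb : b ∈ t) : OrthP S h (v b) (y - PP S h μ n t v π ε y) := by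
  apply OrthP.of_pow (μ := μ b)
  intro l
  rcases le_or_gt (n b) l with hl | hl
  · rw [kill_ge (G.kill b (hts hb)) hl]; simp
  rw [map_sub, sub_eq_zero]
  simp only [PP, LinearMap.coe_mk, AddHom.coe_mk, QQ, map_sum, map_smul, smul_eq_mul]
  rw [Finset.sum_eq_single (π b)]
  · rw [Finset.sum_eq_single (n b - 1 - l)]
    · rw [P.gram b hb _ (P.mem b hb), if_pos ⟨rfl, by omega⟩, P.inv b hb, P.n_eq b hb,
        P.eps_eq b hb, show n b - 1 - (n b - 1 - l) = l by omega]
      rcases P.eps b hb with h | h <;> rw [h] <;> ring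
    · intro m hm hne
      rw [P.gram b hb _ (P.mem b hb), if_neg (by rintro ⟨_, h⟩; omega), mul_zero]
    · intro hm; exact absurd (Finset.mem_range.2 (by rw [P.n_eq b hb]; omega)) hm
  · intro a ha hne
    refine Finset.sum_eq_zero fun m _ => ?_
    rw [P.gram b hb _ ha, if_neg (fun h => hne h.1), mul_zero]
  · intro hm; exact absurd (P.mem b hb) hm

theorem core (H : SA S h) (hn : ∀ i, 1 ≤ n i) : ∀ (s : Finset ι) (v : ι → V), 
    Good S h μ n s v → ∃ w π ε, (∀ i ∈ s, aeval S (DD (μ i) (n i)) (w i) = 0) ∧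
      GramP S h μ n s w π ε ∧ TransP S h s v w := by
  intro s
  induction s using Finset.strongInduction with
  | H s ih =>
  intro v G
  rcases s.eq_empty_or_nonempty with rfl | hs
  · refine ⟨v, id, fun _ => 1, by simp, ?_, fun y hy => hy⟩
    constructor <;> simp
  obtain ⟨v2, t, π, ε, G2, T2, hts, ht, P⟩ := exists_block H G hs hn
  set v' : ι → V := fun k => v2 k - PP S h μ n t v2 π ε (v2 k) with hv'
  have ho : ∀ b ∈ t, ∀ k, OrthP S h (v2 b) (v' k) := fun b hb k => PP_orth G2 hts P _ hb
  have G' : Good S h μ n (s \ t) v' := by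
    constructor
    · intro k hk
      rw [hv']; simp only
      rw [map_sub, ← PP_poly H G2 hts P, G2.kill k (Finset.mem_sdiff.1 hk).1]; simp
    · intro q hq
      set q' : ι → ℂ[X] := fun i => if i ∈ t then 
        -∑ k ∈ s \ t, q k * PC S h μ n v2 π ε i (v2 k) else q i with hq'
      have hsum : ∑ i ∈ s \ t, aeval S (q i) (v' i) = ∑ i ∈ s, aeval S (q' i) (v2 i) := by
        rw [← Finset.sum_sdiff hts, hv']
        simp only [map_sub, Finset.sum_sub_distrib, PP_eq, map_sum]
        rw [Finset.sum_comm, sub_eq_add_neg, ← Finset.sum_neg_distrib]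
        congr 1
        · refine Finset.sum_congr rfl fun i hi => ?_
          rw [hq']; simp only [if_neg (Finset.mem_sdiff.1 hi).2]
        · refine Finset.sum_congr rfl fun i hi => ?_
          rw [hq']; simp only [if_pos hi, map_neg, LinearMap.neg_apply, map_sum, LinearMap.sum_apply,
            aeval_mul_app]
      have hot : ∀ j ∈ t, OrthP S h (∑ i ∈ s, aeval S (q' i) (v2 i)) (v2 j) := by
        intro j hj
        rw [← hsum]
        exact OrthP.sum_left fun k _ => ((ho j hj k).symm H).left _
      have h1 := G2.nd q' (by
        intro j hj
        by_cases hjt : j ∈ t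
        · exact hot j hjt
        have h2 := hq j (Finset.mem_sdiff.2 ⟨hj, hjt⟩)
        rw [hsum] at h2
        have h3 : v2 j = v' j + PP S h μ n t v2 π ε (v2 j) := by rw [hv']; simp
        rw [h3, PP_eq]
        exact h2.add_right (OrthP.sum_right fun a ha => (hot a ha).right H _))
      intro i hi
      have h2 := h1 i (Finset.mem_sdiff.1 hi).1
      rw [hq'] at h2
      simpa only [if_neg (Finset.mem_sdiff.1 hi).2] using h2
  obtain ⟨w', π', ε', K', P', T'⟩ := ih (s \ t) (Finset.sdiff_ssubset hts ht) v' G'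
  have how : ∀ b ∈ t, ∀ k ∈ s \ t, OrthP S h (v2 b) (w' k) := fun b hb k hk =>
    T' _ (fun j _ => ho b hb j) k hk
  have hcases : ∀ i ∈ s, i ∈ t ∨ (i ∉ t ∧ i ∈ s \ t) := by
    intro i hi
    by_cases h : i ∈ t
    · exact Or.inl h
    · exact Or.inr ⟨h, Finset.mem_sdiff.2 ⟨hi, h⟩⟩
  have hnt : ∀ {i}, i ∈ s \ t → π' i ∉ t := fun hi => (Finset.mem_sdiff.1 (P'.mem _ hi)).2
  refine ⟨fun i => if i ∈ t then v2 i else w' i, fun i => if i ∈ t then π i else π' i,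
    fun i => if i ∈ t then ε i else ε' i, ?_, ?_, ?_⟩
  · intro i hi
    rcases hcases i hi with h1 | ⟨h1, h2⟩
    · simp only [if_pos h1]; exact G2.kill i hi
    · simp only [if_neg h1]; exact K' i h2
  · constructor
    · intro i hi
      rcases hcases i hi with h1 | ⟨h1, h2⟩
      · simp only [if_pos h1]; exact hts (P.mem i h1)
      · simp only [if_neg h1]; exact (Finset.mem_sdiff.1 (P'.mem i h2)).1
    · intro i hi
      rcases hcases i hi with h1 | ⟨h1, h2⟩
      · simp only [if_pos h1, if_pos (P.mem i h1)]; exact P.inv i h1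
      · simp only [if_neg h1, if_neg (hnt h2)]; exact P'.inv i h2
    · intro i hi
      rcases hcases i hi with h1 | ⟨h1, h2⟩
      · simp only [if_pos h1]; exact P.n_eq i h1
      · simp only [if_neg h1]; exact P'.n_eq i h2
    · intro i hi
      rcases hcases i hi with h1 | ⟨h1, h2⟩
      · simp only [if_pos h1, if_pos (P.mem i h1)]; exact P.eps_eq i h1
      · simp only [if_neg h1, if_neg (hnt h2)]; exact P'.eps_eq i h2
    · intro i hi
      rcases hcases i hi with h1 | ⟨h1, h2⟩
      · simp only [if_pos h1]; exact P.eps i h1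
      · simp only [if_neg h1]; exact P'.eps i h2
    · intro i hi
      rcases hcases i hi with h1 | ⟨h1, h2⟩
      · simp only [if_pos h1]; exact P.mu_eq i h1
      · simp only [if_neg h1]; exact P'.mu_eq i h2
    · intro i hi j hj k l
      rcases hcases i hi with h1 | ⟨h1, h2⟩ <;> rcases hcases j hj with h3 | ⟨h3, h4⟩
      · simp only [if_pos h1, if_pos h3]; exact P.gram i h1 j h3 k l
      · simp only [if_pos h1, if_neg h3]
        rw [if_neg (by rintro ⟨rfl, _⟩; exact h3 (P.mem i h1))]
        exact (how i h1 j h4).right H _ _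
      · simp only [if_neg h1, if_pos h3]
        rw [if_neg (by rintro ⟨rfl, _⟩; exact hnt h2 h3)]
        exact ((how j h3 i h2).symm H).right H _ _
      · simp only [if_neg h1, if_neg h3]; exact P'.gram i h2 j h4 k l
  · intro y hy i hi
    have hy2 := T2 y hy
    rcases hcases i hi with h1 | ⟨h1, h2⟩
    · simp only [if_pos h1]; exact hy2 i hi
    · simp only [if_neg h1]
      refine T' y (fun j hj => ?_) i h2
      rw [hv']; simp only [PP_eq]
      exact (hy2 j (Finset.mem_sdiff.1 hj).1).sub_right
        (OrthP.sum_right fun a ha => (hy2 a (hts ha)).right H _)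

end Fam
end Abstract

section CplxMat
open Polynomial

variable {p : ℕ} {n : Fin p → ℕ}

/-- complex Jordan matrix -/
def Lc (n : Fin p → ℕ) (lam : Fin p → ℂ) : Matrix (Σ i, Fin (n i)) (Σ i, Fin (n i)) ℂ :=
  Matrix.of fun x y => if x.1 = y.1 then
    (if (y.2 : ℕ) = x.2 then lam x.1 else if (y.2 : ℕ) = x.2 + 1 then 1 else 0) else 0

theorem sig_ext {x y : Σ i, Fin (n i)} : x = y ↔ x.1 = y.1 ∧ (x.2 : ℕ) = y.2 := by
  constructor
  · rintro rfl; exact ⟨rfl, rfl⟩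
  · rcases x with ⟨i, k⟩; rcases y with ⟨j, l⟩
    rintro ⟨h1, h2⟩
    dsimp only at h1 h2
    subst h1
    rw [Fin.ext h2]

def prv (y : Σ i, Fin (n i)) : Σ i, Fin (n i) := ⟨y.1, ⟨(y.2 : ℕ) - 1, by have := y.2.2; omega⟩⟩

theorem Lc_apply (lam : Fin p → ℂ) (x y : Σ i, Fin (n i)) :
    Lc n lam x y = (if x = y then lam y.1 else 0) +
      (if x = prv y then (if 1 ≤ (y.2 : ℕ) then 1 else 0) else 0) := by
  rcases x with ⟨i, k⟩; rcases y with ⟨j, l⟩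
  simp only [Lc, Matrix.of_apply, sig_ext, prv]
  by_cases hij : i = j
  · subst hij
    simp only [true_and, if_true]
    split_ifs <;> first | omega | simp
  · simp [hij]

theorem mul_Lc {κ : Type*} (lam : Fin p → ℂ) (Z : Matrix κ (Σ i, Fin (n i)) ℂ) (x : κ)
    (y : Σ i, Fin (n i)) :
    (Z * Lc n lam) x y = Z x y * lam y.1 + (if 1 ≤ (y.2 : ℕ) then Z x (prv y) else 0) := by
  rw [Matrix.mul_apply]
  simp only [Lc_apply, mul_add, Finset.sum_add_distrib, mul_ite, mul_zero, Finset.sum_ite_eq',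
    Finset.mem_univ, if_true, mul_one]

theorem sylv {lam : Fin p → ℂ} (hlam : ∀ i j, lam i + lam j ≠ 0)
    (W : Matrix (Σ i, Fin (n i)) (Σ i, Fin (n i)) ℂ)
    (h : W * Lc n lam + (Lc n lam)ᵀ * W = 0) : W = 0 := by
  have key : ∀ m : ℕ, ∀ x y : Σ i, Fin (n i), (x.2 : ℕ) + y.2 ≤ m → W x y = 0 := by
    intro m
    induction m using Nat.strong_induction_on with
    | _ m ih =>
    intro x y hxy
    have e1 : (W * Lc n lam + (Wᵀ * Lc n lam)ᵀ) x y = 0 := by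
      rw [Matrix.transpose_mul, Matrix.transpose_transpose, h]; rfl
    rw [Matrix.add_apply, Matrix.transpose_apply, mul_Lc, mul_Lc, Matrix.transpose_apply,
      Matrix.transpose_apply] at e1
    have e2 : (if 1 ≤ (y.2 : ℕ) then W x (prv y) else 0) = 0 := by
      split_ifs with hy
      · have : ((prv y).2 : ℕ) = y.2 - 1 := rfl
        exact ih (m - 1) (by omega) _ _ (by omega)
      · rfl
    have e3 : (if 1 ≤ (x.2 : ℕ) then W (prv x) y else 0) = 0 := by
      split_ifs with hy
      · have : ((prv x).2 : ℕ) = x.2 - 1 := rfl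
        exact ih (m - 1) (by omega) _ _ (by omega)
      · rfl
    rw [e2, e3, add_zero, add_zero, mul_comm, mul_comm (W x y), ← add_mul] at e1
    exact (mul_eq_zero.1 e1).resolve_left (hlam _ _)
  ext x y
  exact key _ x y le_rfl

/-- sesquilinear form of a matrix -/
def hform {τ : Type*} [Fintype τ] (K : Matrix τ τ ℂ) : (τ → ℂ) →ₗ⋆[ℂ] (τ → ℂ) →ₗ[ℂ] ℂ :=
  LinearMap.mk₂'ₛₗ (starRingEnd ℂ) (RingHom.id ℂ) (fun y z => star y ⬝ᵥ (K *ᵥ z))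
    (by intro a b c; simp [add_dotProduct])
    (by intro c a b; simp [smul_dotProduct])
    (by intro a b c; simp [Matrix.mulVec_add, dotProduct_add])
    (by intro c a b; simp [Matrix.mulVec_smul, dotProduct_smul])

theorem hform_apply {τ : Type*} [Fintype τ] (K : Matrix τ τ ℂ) (y z : τ → ℂ) :
    hform K y z = star y ⬝ᵥ (K *ᵥ z) := rfl

theorem hform_SA {τ : Type*} [Fintype τ] [DecidableEq τ] (K L : Matrix τ τ ℂ) (hK : Kᴴ = K)
    (hL : Lᴴ * K = K * L) : SA (Matrix.toLin' L) (hform K) := by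
  constructor
  · intro y z
    rw [hform_apply, hform_apply, starRingEnd_apply, Matrix.star_dotProduct, star_star,
      Matrix.star_mulVec, hK, Matrix.dotProduct_mulVec]
  · intro y z
    rw [hform_apply, hform_apply, Matrix.toLin'_apply, Matrix.toLin'_apply, Matrix.star_mulVec,
      Matrix.mulVec_mulVec, ← hL, Matrix.dotProduct_mulVec, Matrix.dotProduct_mulVec, 
      Matrix.vecMul_vecMul]

section
variable (hn : ∀ i, 1 ≤ n i) (lam : Fin p → ℂ)

theorem aeval_DD_one {V : Type*} [AddCommGroup V] [Module ℂ V] (S : Module.End ℂ V) (μ : ℂ)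
    (y : V) : aeval S (DD μ 1) y = S y - μ • y := by
  rw [DD, pow_one, map_sub, aeval_X, aeval_C]; rfl

def SS (n : Fin p → ℕ) (lam : Fin p → ℂ) : Module.End ℂ ((Σ i, Fin (n i)) → ℂ) :=
  Matrix.toLin' (Complex.I • Lc n lam)

theorem SS_apply (y : (Σ i, Fin (n i)) → ℂ) : SS n lam y = (Complex.I • Lc n lam) *ᵥ y :=
  Matrix.toLin'_apply _ _

def gen (hn : ∀ i, 1 ≤ n i) (i : Fin p) (k : ℕ) : Σ i, Fin (n i) :=
  ⟨i, ⟨n i - 1 - k, by have := hn i; omega⟩⟩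

theorem SS_single (y : Σ i, Fin (n i)) :
    SS n lam (Pi.single y 1) = (Complex.I * lam y.1) • Pi.single y 1 +
      (if 1 ≤ (y.2 : ℕ) then Complex.I else 0) • Pi.single (prv y) 1 := by
  ext x
  rw [SS_apply, Matrix.mulVec_single_one]
  simp only [Matrix.col_apply, Matrix.smul_apply, Lc_apply, Pi.add_apply, Pi.smul_apply, 
    Pi.single_apply, smul_eq_mul]
  split_ifs <;> simp [mul_add]

theorem aeval_DD_gen (i : Fin p) (k : ℕ) :
    aeval (SS n lam) (DD (Complex.I * lam i) k) (Pi.single (gen hn i 0) 1) =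
      (if k < n i then Complex.I ^ k else 0) • Pi.single (gen hn i k) 1 := by
  induction k with
  | zero => simp [DD, show 0 < n i from hn i]
  | succ k ih =>
    rw [add_comm, DD_add, ← aeval_mul_app, ih, map_smul]
    have hs : SS n lam (Pi.single (gen hn i k) 1) = (Complex.I * lam i) • Pi.single (gen hn i k) 1 +
        (if 1 ≤ n i - 1 - k then Complex.I else 0) • Pi.single (gen hn i (1 + k)) 1 := by
      have e : prv (gen hn i k) = gen hn i (1 + k) := by
        rw [sig_ext]; refine ⟨rfl, ?_⟩; simp only [prv, gen]; omega
      rw [← e]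
      exact SS_single lam (gen hn i k)
    rw [aeval_DD_one, hs, add_sub_cancel_left, smul_smul]
    congr 1
    by_cases h1 : 1 + k < n i
    · rw [if_pos (by omega), if_pos (by omega), if_pos h1]; ring
    · rw [if_neg h1, if_neg (by omega : ¬ 1 ≤ n i - 1 - k), mul_zero]

theorem aeval_gen_apply (i : Fin p) (q : ℂ[X]) (x : Σ i, Fin (n i)) :
    aeval (SS n lam) q (Pi.single (gen hn i 0) 1 : (Σ i, Fin (n i)) → ℂ) x =
      if x.1 = i then (taylor (Complex.I * lam i) q).coeff (n i - 1 - x.2) * 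
        Complex.I ^ (n i - 1 - x.2) else 0 := by
  conv_lhs => rw [← Polynomial.sum_taylor_eq q (Complex.I * lam i), Polynomial.sum]
  simp only [map_sum, LinearMap.sum_apply, Finset.sum_apply]
  have e : ∀ l, (aeval (SS n lam) (C ((taylor (Complex.I * lam i) q).coeff l) * 
      (X - C (Complex.I * lam i)) ^ l) (Pi.single (gen hn i 0) 1 : (Σ i, Fin (n i)) → ℂ)) x = 
      if x.1 = i ∧ l = n i - 1 - x.2 then
       (taylor (Complex.I * lam i) q).coeff l * Complex.I ^ l else 0 := by
    intro l
    rw [← aeval_mul_app, aeval_C, Module.algebraMap_end_apply, ← DD, aeval_DD_gen hn]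
    simp only [Pi.smul_apply, Pi.single_apply, smul_eq_mul, sig_ext, gen]
    have hx := x.2.2
    by_cases hi : x.1 = i
    · subst hi
      by_cases hl : l < n x.1
      · by_cases hh : l = n x.1 - 1 - x.2
        · have h3 : (x.2 : ℕ) = n x.1 - 1 - l := by omega
          simp only [true_and, hl, if_true, if_pos h3, if_pos hh, mul_one]
        · have h3 : ¬ (x.2 : ℕ) = n x.1 - 1 - l := by omega
          simp [hh, h3]
      · have h3 : ¬ l = n x.1 - 1 - x.2 := by omega
        simp [hl, h3]
    · simp [hi]
  rw [Finset.sum_congr rfl fun l _ => e l]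
  by_cases hi : x.1 = i
  · simp only [hi, true_and, if_true]
    rw [Finset.sum_ite_eq']
    split_ifs with h
    · rfl
    · rw [Polynomial.notMem_support_iff.1 h, zero_mul]
  · simp [hi]

theorem good_gen (K : Matrix (Σ i, Fin (n i)) (Σ i, Fin (n i)) ℂ) (hK : Kᴴ = K)
    (hKi : ∀ y, K *ᵥ y = 0 → y = 0)
    (H : SA (SS n lam) (hform K)) : 
    Good (SS n lam) (hform K) (fun i => Complex.I * lam i) n Finset.univ 
      (fun i => Pi.single (gen hn i 0) 1) := by
  constructor
  · intro i _
    rw [aeval_DD_gen]; simp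
  · intro q hq i _
    set y := ∑ i, aeval (SS n lam) (q i) (Pi.single (gen hn i 0) 1) with hy
    have h1 : ∀ x : Σ i, Fin (n i), hform K y (Pi.single x 1) = 0 := by
      intro x
      have hx := x.2.2
      have h2 := ((hq x.1 (Finset.mem_univ _)).right H (DD (Complex.I * lam x.1) (n x.1 - 1 - x.2))) 1
      rw [aeval_DD_gen, if_pos (by omega), show gen hn x.1 (n x.1 - 1 - x.2) = x by
        rw [sig_ext]; refine ⟨rfl, ?_⟩; simp only [gen]; omega] at h2
      simpa using h2
    have h2 : y = 0 := by
      apply hKi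
      ext x
      have := H.herm y (Pi.single x 1)
      rw [h1, map_zero, hform_apply, Pi.star_single, star_one, single_one_dotProduct] at this
      exact this.symm
    have h3 : ∀ l, l < n i → (taylor (Complex.I * lam i) (q i)).coeff l = 0 := by
      intro l hl
      have h4 := congrFun h2 (gen hn i l)
      rw [hy, Finset.sum_apply] at h4
      simp only [aeval_gen_apply] at h4
      rw [Finset.sum_ite_eq, if_pos (Finset.mem_univ _)] at h4
      simp only [gen, Pi.zero_apply] at h4
      rw [show n i - 1 - (n i - 1 - l) = l by omega] at h4
      simpa using h4
    rw [← Polynomial.sum_taylor_eq (q i) (Complex.I * lam i), Polynomial.sum]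
    refine Finset.dvd_sum fun l _ => ?_
    by_cases hl : l < n i
    · rw [h3 l hl]; simp
    · exact (pow_dvd_pow _ (by omega)).mul_left _

end

theorem complex_form (hn : ∀ i, 1 ≤ n i) (lam : Fin p → ℂ)
    (Hc : Matrix (Σ i, Fin (n i)) (Σ i, Fin (n i)) ℂ) (hH : Hcᴴ = -Hc)
    (hHi : ∀ y, Hc *ᵥ y = 0 → y = 0)
    (hL : Hc * Lc n lam + (Lc n lam)ᴴ * Hc = 0) :
    ∃ Z : Matrix (Σ i, Fin (n i)) (Σ i, Fin (n i)) ℂ, Z * Lc n lam = Lc n lam * Z ∧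
      ∀ x, ∃ x' c, c ^ 4 = 1 ∧ ∀ y, (Zᴴ * Hc * Z) x y = if y = x' then c else 0 := by
  have hL' : (Lc n lam)ᴴ * Hc = - (Hc * Lc n lam) := (neg_eq_of_add_eq_zero_right hL).symm
  have hK : (Complex.I • Hc)ᴴ = Complex.I • Hc := by
    rw [Matrix.conjTranspose_smul, hH]; simp
  have H : SA (SS n lam) (hform (Complex.I • Hc)) := by
    unfold SS
    apply hform_SA _ _ hK
    rw [Matrix.conjTranspose_smul, Matrix.smul_mul, Matrix.mul_smul, hL', Matrix.smul_mul, 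
      Matrix.mul_smul]
    simp
  obtain ⟨w, π, ε, kw, P, -⟩ := core H hn _ _ (good_gen hn lam _ hK (by
    intro y hy
    apply hHi
    rw [Matrix.smul_mulVec] at hy
    simpa using hy) H)
  set colv : (Σ i, Fin (n i)) → (Σ i, Fin (n i)) → ℂ := fun x => 
    (-Complex.I) ^ (n x.1 - 1 - x.2) • 
      aeval (SS n lam) (DD (Complex.I * lam x.1) (n x.1 - 1 - x.2)) (w x.1) with hcol
  have hSc : ∀ y, (Complex.I • Lc n lam) *ᵥ colv y = (Complex.I * lam y.1) • colv y + 
      (if 1 ≤ (y.2 : ℕ) then Complex.I else 0) • colv (prv y) := by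
    intro y
    have hy := y.2.2
    rw [← SS_apply, hcol]
    simp only [map_smul]
    have : ∀ (μ : ℂ) z, SS n lam z = aeval (SS n lam) (DD μ 1) z + μ • z := by
      intro μ z; rw [aeval_DD_one]; simp
    rw [this (Complex.I * lam y.1), aeval_mul_app, ← DD_add, smul_add, add_comm]
    congr 1
    · rw [smul_comm]
    · by_cases h1 : 1 ≤ (y.2 : ℕ)
      · rw [if_pos h1, smul_smul]
        have e : n (prv y).1 - 1 - ((prv y).2 : ℕ) = 1 + (n y.1 - 1 - y.2) := by
          simp only [prv]; omega
        rw [e, show (prv y).1 = y.1 from rfl]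
        congr 1
        rw [pow_add, ← mul_assoc]; simp
      · rw [if_neg h1, kill_ge (kw y.1 (Finset.mem_univ _)) (by omega)]; simp
  refine ⟨Matrix.of fun x y => colv y x, ?_, ?_⟩
  · ext x y
    rw [mul_Lc]
    have h1 := congrFun (hSc y) x
    rw [Matrix.smul_mulVec] at h1
    simp only [Pi.smul_apply, Pi.add_apply, smul_eq_mul] at h1
    have h2 : (Lc n lam *ᵥ colv y) x = (Lc n lam * Matrix.of fun x y => colv y x) x y := rfl
    rw [h2] at h1
    apply mul_left_cancel₀ Complex.I_ne_zero
    rw [h1]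
    simp only [Matrix.of_apply]
    split_ifs <;> ring
  · intro x
    have hx := x.2.2
    have hni := P.n_eq x.1 (Finset.mem_univ _)
    refine ⟨⟨π x.1, ⟨n x.1 - 1 - x.2, by rw [hni]; omega⟩⟩, 
      -Complex.I * (Complex.I ^ (n x.1 - 1 - x.2) * ((-Complex.I) ^ (x.2 : ℕ) * ε x.1)), ?_, ?_⟩
    · have hi : Complex.I ^ 4 = 1 := Complex.I_pow_four
      have hi2 : (-Complex.I) ^ 4 = 1 := by rw [Even.neg_pow (by decide), hi]
      have hε : ε x.1 ^ 4 = 1 := by 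
        rcases P.eps x.1 (Finset.mem_univ _) with h | h <;> rw [h] <;> norm_num
      rw [mul_pow, mul_pow, mul_pow, hi2, hε, ← pow_mul, ← pow_mul, mul_comm _ 4, mul_comm _ 4,
        pow_mul, pow_mul, hi, hi2]
      simp
    · intro y
      have hy := y.2.2
      have h1 : ((Matrix.of fun x y => colv y x)ᴴ * Hc * (Matrix.of fun x y => colv y x)) x y =
          -Complex.I * hform (Complex.I • Hc) (colv x) (colv y) := by
        rw [hform_apply, Matrix.smul_mulVec, dotProduct_smul, smul_eq_mul, ← mul_assoc]
        simp only [neg_mul, Complex.I_mul_I, neg_neg, one_mul]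
        rw [Matrix.mul_assoc]; rfl
      rw [h1, hcol]
      simp only [map_smul, map_smulₛₗ, LinearMap.smul_apply, smul_eq_mul]
      rw [P.gram _ (Finset.mem_univ _) _ (Finset.mem_univ _)]
      by_cases hh : y = ⟨π x.1, ⟨n x.1 - 1 - x.2, by rw [hni]; omega⟩⟩
      · rw [if_pos hh]
        obtain ⟨g1, g2⟩ := sig_ext.1 hh
        simp only at g1 g2
        have hny : n y.1 = n x.1 := by rw [g1, hni]
        rw [if_pos ⟨g1, by omega⟩, show n y.1 - 1 - (y.2 : ℕ) = x.2 by omega]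
        simp
        ring
      · rw [if_neg hh, if_neg]
        · simp
        · rintro ⟨g1, g2⟩
          apply hh
          rw [sig_ext]
          have hny : n y.1 = n x.1 := by rw [g1, hni]
          exact ⟨g1, by simp only; omega⟩

end CplxMat

section RealMat

variable {p : ℕ} {n : Fin p → ℕ}

/-- The realification of a complex matrix. -/
def RR (Z : Matrix (Σ i, Fin (n i)) (Σ i, Fin (n i)) ℂ) :
    Matrix (Σ i, Fin (n i) × Fin 2) (Σ i, Fin (n i) × Fin 2) ℝ :=
  Matrix.of fun s t =>
    !![(Z ⟨s.1, s.2.1⟩ ⟨t.1, t.2.1⟩).re, -(Z ⟨s.1, s.2.1⟩ ⟨t.1, t.2.1⟩).im;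
       (Z ⟨s.1, s.2.1⟩ ⟨t.1, t.2.1⟩).im, (Z ⟨s.1, s.2.1⟩ ⟨t.1, t.2.1⟩).re] s.2.2 t.2.2

abbrev ix (x : Σ i, Fin (n i)) (u : Fin 2) : Σ i, Fin (n i) × Fin 2 := ⟨x.1, (x.2, u)⟩

theorem RR_ix (Z : Matrix (Σ i, Fin (n i)) (Σ i, Fin (n i)) ℂ) (x y : Σ i, Fin (n i))
    (u v : Fin 2) : RR Z (ix x u) (ix y v) =
      !![(Z x y).re, -(Z x y).im; (Z x y).im, (Z x y).re] u v := rfl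

theorem ext_ix {M M' : Matrix (Σ i, Fin (n i) × Fin 2) (Σ i, Fin (n i) × Fin 2) ℝ}
    (h : ∀ x y u v, M (ix x u) (ix y v) = M' (ix x u) (ix y v)) : M = M' := by
  ext ⟨i, k, u⟩ ⟨j, l, v⟩
  exact h ⟨i, k⟩ ⟨j, l⟩ u v

theorem sum_ix (f : (Σ i, Fin (n i) × Fin 2) → ℝ) :
    ∑ s, f s = ∑ x : Σ i, Fin (n i), (f (ix x 0) + f (ix x 1)) := by
  rw [Fintype.sum_sigma, Fintype.sum_sigma]
  refine Finset.sum_congr rfl fun i _ => ?_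
  rw [Fintype.sum_prod_type]
  simp only [Fin.sum_univ_two]

theorem RR_mul (Z W : Matrix (Σ i, Fin (n i)) (Σ i, Fin (n i)) ℂ) :
    RR (Z * W) = RR Z * RR W := by
  apply ext_ix
  intro x y u v
  rw [Matrix.mul_apply, sum_ix]
  simp only [RR_ix, Matrix.mul_apply, Complex.re_sum, Complex.im_sum, Complex.mul_re,
    Complex.mul_im, ← Finset.sum_neg_distrib]
  fin_cases u <;> fin_cases v <;> simp [Finset.sum_add_distrib, Finset.sum_sub_distrib, Finset.sum_neg_distrib] <;> ring

theorem RR_conj (Z : Matrix (Σ i, Fin (n i)) (Σ i, Fin (n i)) ℂ) : RR Zᴴ = (RR Z)ᵀ := by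
  apply ext_ix
  intro x y u v
  rw [Matrix.transpose_apply]
  simp only [RR_ix, Matrix.conjTranspose_apply]
  fin_cases u <;> fin_cases v <;> simp

theorem RR_add (Z W : Matrix (Σ i, Fin (n i)) (Σ i, Fin (n i)) ℂ) :
    RR (Z + W) = RR Z + RR W := by
  apply ext_ix
  intro x y u v
  rw [Matrix.add_apply]
  simp only [RR_ix, Matrix.add_apply]
  fin_cases u <;> fin_cases v <;> simp
  ring

theorem RR_neg (Z : Matrix (Σ i, Fin (n i)) (Σ i, Fin (n i)) ℂ) : RR (-Z) = -RR Z := by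
  apply ext_ix
  intro x y u v
  rw [Matrix.neg_apply]
  simp only [RR_ix, Matrix.neg_apply]
  fin_cases u <;> fin_cases v <;> simp

theorem RR_zero : RR (0 : Matrix (Σ i, Fin (n i)) (Σ i, Fin (n i)) ℂ) = 0 := by
  apply ext_ix
  intro x y u v
  simp only [RR_ix, Matrix.zero_apply]
  fin_cases u <;> fin_cases v <;> simp

theorem RR_inj {Z W : Matrix (Σ i, Fin (n i)) (Σ i, Fin (n i)) ℂ} (h : RR Z = RR W) : Z = W := by
  ext x y
  apply Complex.ext
  · simpa [RR_ix] using congrFun (congrFun h (ix x 0)) (ix y 0)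
  · simpa [RR_ix] using congrFun (congrFun h (ix x 1)) (ix y 0)

theorem RR_Lc (a b : Fin p → ℝ) :
    Matrix.blockDiagonal' (fun i => realJordanBlock (n i) (a i) (b i)) =
      RR (Lc n fun i => ⟨a i, -b i⟩) := by
  apply ext_ix
  rintro ⟨i, k⟩ ⟨j, l⟩ u v
  rw [RR_ix]
  by_cases hij : i = j
  · subst hij
    rw [Matrix.blockDiagonal'_apply_eq]
    simp only [realJordanBlock, Lc, Matrix.of_apply, Fin.ext_iff, if_true]
    split_ifs <;> fin_cases u <;> fin_cases v <;> simp
  · rw [Matrix.blockDiagonal'_apply_ne _ _ _ hij]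
    simp only [Lc, Matrix.of_apply, if_neg hij]
    fin_cases u <;> fin_cases v <;> simp

theorem exists_Hc (lam : Fin p → ℂ) (hlam : ∀ i j, lam i + lam j ≠ 0)
    (B : Matrix (Σ i, Fin (n i) × Fin 2) (Σ i, Fin (n i) × Fin 2) ℝ)
    (heq : B * RR (Lc n lam) + (RR (Lc n lam))ᵀ * B = 0) : ∃ Hc, B = RR Hc := by
  set W : Matrix (Σ i, Fin (n i)) (Σ i, Fin (n i)) ℂ := Matrix.of fun x y =>
    ⟨B (ix x 0) (ix y 0) - B (ix x 1) (ix y 1), -(B (ix x 0) (ix y 1) + B (ix x 1) (ix y 0))⟩ with hW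
  have hW0 : W = 0 := by
    apply sylv hlam
    ext x y
    have E : ∀ u v, (∑ z, (B (ix x u) (ix z 0) * RR (Lc n lam) (ix z 0) (ix y v) +
        B (ix x u) (ix z 1) * RR (Lc n lam) (ix z 1) (ix y v))) +
        (∑ z, (RR (Lc n lam) (ix z 0) (ix x u) * B (ix z 0) (ix y v) +
        RR (Lc n lam) (ix z 1) (ix x u) * B (ix z 1) (ix y v))) = 0 := by
      intro u v
      have := congrFun (congrFun heq (ix x u)) (ix y v)
      rw [Matrix.add_apply, Matrix.mul_apply, Matrix.mul_apply, sum_ix, sum_ix] at this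
      exact this
    have E00 := E 0 0
    have E01 := E 0 1
    have E10 := E 1 0
    have E11 := E 1 1
    simp only [RR_ix, Matrix.of_apply, Matrix.cons_val', Matrix.cons_val_zero, Matrix.cons_val_one, 
      Matrix.cons_val_fin_one] at E00 E01 E10 E11
    rw [← Finset.sum_add_distrib] at E00 E01 E10 E11
    rw [Matrix.add_apply, Matrix.mul_apply, Matrix.mul_apply, ← Finset.sum_add_distrib,
      Matrix.zero_apply]
    apply Complex.ext
    · have e := congrArg₂ (· - ·) E00 E11
      simp only [← Finset.sum_sub_distrib, sub_zero] at e
      rw [Complex.re_sum, Complex.zero_re, ← e]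
      refine Finset.sum_congr rfl fun z _ => ?_
      simp only [hW, Matrix.of_apply, Matrix.transpose_apply, Complex.add_re, Complex.mul_re]
      ring
    · have e := congrArg₂ (fun a b => - (a + b)) E01 E10
      simp only [← Finset.sum_add_distrib, ← Finset.sum_neg_distrib, neg_zero, add_zero] at e
      rw [Complex.im_sum, Complex.zero_im, ← e]
      refine Finset.sum_congr rfl fun z _ => ?_
      simp only [hW, Matrix.of_apply, Matrix.transpose_apply, Complex.add_im, Complex.mul_im]
      ring
  refine ⟨Matrix.of fun x y => ⟨B (ix x 0) (ix y 0), B (ix x 1) (ix y 0)⟩, ?_⟩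
  apply ext_ix
  intro x y u v
  have h1 := congrFun (congrFun hW0 x) y
  have hr := congrArg Complex.re h1
  have hi := congrArg Complex.im h1
  simp only [hW, Matrix.of_apply, Matrix.zero_apply, Complex.zero_re, Complex.zero_im] at hr hi
  rw [RR_ix]
  fin_cases u <;> fin_cases v <;> simp <;> linarith

theorem signed_perm {σ : Type*} [Fintype σ] [DecidableEq σ] (r : ℕ) (hc : Fintype.card σ = 2 * r)
    (M : Matrix σ σ ℝ) (hM : Mᵀ = -M)
    (h : ∀ s, ∃ t e, (e = 1 ∨ e = -1) ∧ ∀ t', M s t' = if t' = t then e else 0) :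
    IsUnit M ∧ ∃ e : σ ≃ Fin (2 * r), Matrix.reindex e e M = canonJ (2 * r) (2 * r) := by
  choose f ε hε hf using h
  have hsk : ∀ s t, M s t = - M t s := by
    intro s t
    have := congrFun (congrFun hM t) s
    simpa using this
  have hne : ∀ s, ε s ≠ 0 := by
    intro s; rcases hε s with h | h <;> rw [h] <;> norm_num
  have h1 : ∀ s, f (f s) = s ∧ ε (f s) = - ε s := by
    intro s
    have e := hsk s (f s)
    rw [hf, hf, if_pos rfl] at e
    by_cases hs : s = f (f s)
    · rw [if_pos hs] at e
      exact ⟨hs.symm, by linarith⟩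
    · rw [if_neg hs] at e
      exact absurd (by linarith) (hne s)
  have hee : ∀ s, ε s * ε s = 1 := by
    intro s; rcases hε s with h | h <;> rw [h] <;> norm_num
  constructor
  · have hMM : M * (-M) = 1 := by
      ext s t
      rw [← hM, Matrix.mul_apply]
      simp only [Matrix.transpose_apply, hf, ite_mul, zero_mul, Finset.sum_ite_eq', Finset.mem_univ,
        if_true, Matrix.one_apply]
      by_cases hst : s = t
      · subst hst; simp [hee]
      · rw [if_neg hst, if_neg, mul_zero]
        intro h2; apply hst
        rw [← (h1 s).1, h2, (h1 t).1]
    exact IsUnit.of_mul_eq_one _ hMM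
  · let P := {s : σ // ε s = 1}
    let g : P ⊕ P → σ := Sum.elim (fun s => s.1) (fun s => f s.1)
    have hg : Function.Bijective g := by
      constructor
      · rintro (⟨s, hs⟩ | ⟨s, hs⟩) (⟨t, ht⟩ | ⟨t, ht⟩) hst <;> simp only [g, Sum.elim_inl, Sum.elim_inr] at hst
        · subst hst; rfl
        · have := (h1 t).2
          rw [← hst, hs, ht] at this; norm_num at this
        · have := (h1 s).2
          rw [hst, hs, ht] at this; norm_num at this
        · have : s = t := by rw [← (h1 s).1, hst, (h1 t).1]
          subst this; rfl
      · intro s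
        rcases hε s with h | h
        · exact ⟨Sum.inl ⟨s, h⟩, rfl⟩
        · exact ⟨Sum.inr ⟨f s, by rw [(h1 s).2, h, neg_neg]⟩, (h1 s).1⟩
    let G : P ⊕ P ≃ σ := Equiv.ofBijective g hg
    have hcP : Fintype.card P = r := by
      have := Fintype.card_congr G
      rw [Fintype.card_sum, hc] at this
      omega
    let q : P ≃ Fin r := Fintype.equivFinOfCardEq hcP
    let E : Fin r ⊕ Fin r ≃ Fin (2 * r) := finSumFinEquiv.trans (finCongr (by omega))
    refine ⟨G.symm.trans ((Equiv.sumCongr q q).trans E), ?_⟩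
    set e := G.symm.trans ((Equiv.sumCongr q q).trans E) with he
    have key : ∀ s t : P ⊕ P, M (g s) (g t) = canonJ (2 * r) (2 * r) (e (g s)) (e (g t)) := by
      have heg : ∀ s, e (g s) = E (Equiv.sumCongr q q s) := by
        intro s
        have : G.symm (g s) = s := G.symm_apply_apply s
        simp only [he, Equiv.trans_apply, this]
      intro s t
      rw [heg, heg, hf]
      have hr : 2 * r / 2 = r := by omega
      have hq : ∀ s t : P, (q t : ℕ) = q s ↔ t = s := by
        intro s t; rw [← Fin.ext_iff]; exact q.apply_eq_iff_eq
      rcases s with s | s <;> rcases t with t | t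
      · have : ¬ (t.1 = f s.1) := by
          intro h; have := (h1 s.1).2
          rw [← h, s.2, t.2] at this; norm_num at this
        have b1 := (q s).2
        have b2 := (q t).2
        refine (if_neg this).trans ?_
        simp only [canonJ, Matrix.of_apply, E, Equiv.sumCongr_apply, 
          Sum.map_inl, Equiv.trans_apply, finSumFinEquiv_apply_left, finCongr_apply, Fin.val_cast,
          Fin.val_castAdd, hr]
        rw [if_neg (by omega), if_neg (by omega)]
      · have b1 := (q s).2
        have b2 := (q t).2
        have hh : f t.1 = f s.1 ↔ t = s := by
          constructor
          · intro h; apply Subtype.ext; rw [← (h1 t.1).1, h, (h1 s.1).1]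
          · rintro rfl; rfl
        simp only [g, Sum.elim_inl, Sum.elim_inr, canonJ, Matrix.of_apply, E, Equiv.sumCongr_apply, 
          Sum.map_inl, Sum.map_inr, Equiv.trans_apply, finSumFinEquiv_apply_left, 
          finSumFinEquiv_apply_right, finCongr_apply, Fin.val_cast,
          Fin.val_castAdd, Fin.val_natAdd, hr, hh, ← hq, s.2]
        by_cases h : (q t : ℕ) = q s
        · rw [if_pos h, if_pos (by omega)]
        · rw [if_neg h, if_neg (by omega), if_neg (by omega)]
      · have b1 := (q s).2
        have b2 := (q t).2
        have hh : t.1 = f (f s.1) ↔ t = s := by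
          rw [(h1 s.1).1]; exact Subtype.ext_iff.symm
        simp only [g, Sum.elim_inl, Sum.elim_inr, canonJ, Matrix.of_apply, E, Equiv.sumCongr_apply, 
          Sum.map_inl, Sum.map_inr, Equiv.trans_apply, finSumFinEquiv_apply_left, 
          finSumFinEquiv_apply_right, finCongr_apply, Fin.val_cast,
          Fin.val_castAdd, Fin.val_natAdd, hr, hh, ← hq, (h1 s.1).2, s.2]
        by_cases h : (q t : ℕ) = q s
        · rw [if_pos h, if_neg (by omega), if_pos (by omega)]
        · rw [if_neg h, if_neg (by omega), if_neg (by omega)]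
      · have b1 := (q s).2
        have b2 := (q t).2
        have : ¬ (f t.1 = f (f s.1)) := by
          rw [(h1 s.1).1]
          intro h; have := (h1 t.1).2
          rw [h, s.2, t.2] at this; norm_num at this
        refine (if_neg this).trans ?_
        simp only [canonJ, Matrix.of_apply, E, Equiv.sumCongr_apply, 
          Sum.map_inr, Equiv.trans_apply, finSumFinEquiv_apply_right, finCongr_apply, Fin.val_cast,
          Fin.val_natAdd, hr]
        rw [if_neg (by omega), if_neg (by omega)]
    ext x y
    obtain ⟨s, hs⟩ := hg.2 (e.symm x)
    obtain ⟨t, ht⟩ := hg.2 (e.symm y)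
    have := key s t
    rw [hs, ht, Equiv.apply_symm_apply, Equiv.apply_symm_apply] at this
    rw [Matrix.reindex_apply, Matrix.submatrix_apply, this]

theorem rows_RR (Y : Matrix (Σ i, Fin (n i)) (Σ i, Fin (n i)) ℂ)
    (h : ∀ x, ∃ x' c, c ^ 4 = 1 ∧ ∀ y, Y x y = if y = x' then c else 0)
    (s : Σ i, Fin (n i) × Fin 2) :
    ∃ t e, (e = 1 ∨ e = -1) ∧ ∀ t', RR Y s t' = if t' = t then e else 0 := by
  obtain ⟨i, k, u⟩ := s
  obtain ⟨x', c, hc, hY⟩ := h ⟨i, k⟩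
  have hix : ∀ y v v', (ix y v = ix x' v') ↔ (y = x' ∧ v = v') := by
    rintro ⟨j, l⟩ v v'
    rcases x' with ⟨j', l'⟩
    constructor
    · intro h
      simp only [ix, Sigma.mk.injEq] at h
      obtain ⟨rfl, h⟩ := h
      simp only [heq_eq_eq, Prod.mk.injEq] at h
      exact ⟨by rw [h.1], h.2⟩
    · rintro ⟨h, rfl⟩
      cases h; rfl
  have hcc : c = 1 ∨ c = -1 ∨ c = Complex.I ∨ c = -Complex.I := by
    have : (c - 1) * ((c + 1) * ((c - Complex.I) * (c + Complex.I))) = 0 := by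
      have h2 : Complex.I ^ 2 = -1 := Complex.I_sq
      linear_combination hc - (c ^ 2 - 1) * h2
    rcases mul_eq_zero.1 this with h | h
    · exact Or.inl (sub_eq_zero.1 h)
    rcases mul_eq_zero.1 h with h | h
    · exact Or.inr (Or.inl (eq_neg_of_add_eq_zero_left h))
    rcases mul_eq_zero.1 h with h | h
    · exact Or.inr (Or.inr (Or.inl (sub_eq_zero.1 h)))
    · exact Or.inr (Or.inr (Or.inr (eq_neg_of_add_eq_zero_left h)))
  have main : ∃ v e, (e = (1 : ℝ) ∨ e = -1) ∧ ∀ v', !![c.re, -c.im; c.im, c.re] u v' =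
      if v' = v then e else 0 := by
    rcases hcc with rfl | rfl | rfl | rfl
    · refine ⟨u, 1, Or.inl rfl, ?_⟩
      intro v'; fin_cases u <;> fin_cases v' <;> simp
    · refine ⟨u, -1, Or.inr rfl, ?_⟩
      intro v'; fin_cases u <;> fin_cases v' <;> simp
    · fin_cases u
      · refine ⟨1, -1, Or.inr rfl, ?_⟩
        intro v'; fin_cases v' <;> simp
      · refine ⟨0, 1, Or.inl rfl, ?_⟩
        intro v'; fin_cases v' <;> simp
    · fin_cases u
      · refine ⟨1, 1, Or.inl rfl, ?_⟩
        intro v'; fin_cases v' <;> simp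
      · refine ⟨0, -1, Or.inr rfl, ?_⟩
        intro v'; fin_cases v' <;> simp
  obtain ⟨v, e, he, hv⟩ := main
  refine ⟨ix x' v, e, he, ?_⟩
  rintro ⟨j, l, v'⟩
  have h1 := RR_ix Y ⟨i, k⟩ ⟨j, l⟩ u v'
  refine h1.trans ?_
  rw [hY]
  have h2 := hix ⟨j, l⟩ v' v
  by_cases hy : (⟨j, l⟩ : Σ i, Fin (n i)) = x'
  · rw [if_pos hy, hv]
    exact if_congr (by rw [h2]; simp [hy]) rfl rfl
  · rw [if_neg hy]
    refine Eq.trans ?_ (if_neg (by rw [h2]; simp [hy])).symm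
    fin_cases u <;> fin_cases v' <;> simp

end RealMat

/-- For a complex-eigenvalue real Jordan matrix `𝒥`, every invertible skew-symmetric solution
of `B𝒥 + 𝒥ᵀB = 0` is congruent, via an invertible element of the commutant of `𝒥`, to a
permutation of the standard symplectic matrix. -/
theorem canonical_form_complex
    (p : ℕ) (hp : 1 ≤ p) (n : Fin p → ℕ) (hn : ∀ i, 1 ≤ n i)
    (a b : Fin p → ℝ) (hb : ∀ i, 0 < b i)
    (B : Matrix (Σ i, Fin (n i) × Fin 2) (Σ i, Fin (n i) × Fin 2) ℝ)
    (hskew : Bᵀ = -B) (hinv : IsUnit B)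
    (heq : B * Matrix.blockDiagonal' (fun i => realJordanBlock (n i) (a i) (b i))
        + (Matrix.blockDiagonal' (fun i => realJordanBlock (n i) (a i) (b i)))ᵀ * B = 0) :
    ∃ A : Matrix (Σ i, Fin (n i) × Fin 2) (Σ i, Fin (n i) × Fin 2) ℝ, IsUnit A ∧
      A * Matrix.blockDiagonal' (fun i => realJordanBlock (n i) (a i) (b i))
        = Matrix.blockDiagonal' (fun i => realJordanBlock (n i) (a i) (b i)) * A ∧
      ∃ e : (Σ i, Fin (n i) × Fin 2) ≃ Fin (2 * ∑ i, n i),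
        Matrix.reindex e e (Aᵀ * B * A) = canonJ (2 * ∑ i, n i) (2 * ∑ i, n i) := by
  have hlam : ∀ i j : Fin p, (⟨a i, -b i⟩ + ⟨a j, -b j⟩ : ℂ) ≠ 0 := by
    intro i j h
    have := congrArg Complex.im h
    simp at this
    linarith [hb i, hb j]
  rw [RR_Lc] at heq ⊢
  set lam : Fin p → ℂ := fun i => ⟨a i, -b i⟩ with hl
  obtain ⟨Hc, rfl⟩ := exists_Hc lam hlam B heq
  have hH : Hcᴴ = -Hc := by
    apply RR_inj; rw [RR_conj, RR_neg, hskew]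
  have hL : Hc * Lc n lam + (Lc n lam)ᴴ * Hc = 0 := by
    apply RR_inj; rw [RR_add, RR_mul, RR_mul, RR_conj, RR_zero, heq]
  have hHi : ∀ y, Hc *ᵥ y = 0 → y = 0 := by
    intro y hy
    have h1 : Hc * (Matrix.of fun x (_ : Σ i, Fin (n i)) => y x) = 0 := by
      ext x z
      exact congrFun hy x
    have h2 : RR Hc * RR (Matrix.of fun x (_ : Σ i, Fin (n i)) => y x) = RR Hc * 0 := by
      rw [← RR_mul, h1, RR_zero, Matrix.mul_zero]
    have h3 := hinv.mul_left_cancel h2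
    rw [← RR_zero] at h3
    have h4 := RR_inj h3
    ext x
    exact congrFun (congrFun h4 x) x
  obtain ⟨Z, hZ, hrow⟩ := complex_form hn lam Hc hH hHi hL
  have hcong : (RR Z)ᵀ * RR Hc * RR Z = RR (Zᴴ * Hc * Z) := by
    rw [RR_mul, RR_mul, RR_conj]
  have hcard : Fintype.card (Σ i, Fin (n i) × Fin 2) = 2 * ∑ i, n i := by
    simp [Fintype.card_sigma, ← Finset.sum_mul, mul_comm]
  obtain ⟨hu, e, he⟩ := signed_perm (∑ i, n i) hcard (RR (Zᴴ * Hc * Z)) (by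
    rw [← hcong, Matrix.transpose_mul, Matrix.transpose_mul, hskew, Matrix.transpose_transpose,
      Matrix.neg_mul, Matrix.mul_neg, Matrix.mul_assoc]) (rows_RR _ hrow)
  refine ⟨RR Z, ?_, ?_, e, ?_⟩
  · rw [← hcong, Matrix.isUnit_iff_isUnit_det, Matrix.det_mul] at hu
    rw [Matrix.isUnit_iff_isUnit_det]
    exact isUnit_of_mul_isUnit_right hu
  · rw [← RR_mul, hZ, RR_mul]
  · rw [hcong, he]
end
end

section
/- Let N ≥ 1 and let 𝒥 be an N×N real matrix. Let B̄ be a skew-symmetric real matrix indexed by Unit ⊕ Fin N and let B be its lower-right N×N block, B i j := B̄ (inr i) (inr j). Then the 2-form ω(x,y) = x ⬝ᵥ B̄.mulVec y is closed for the almost abelian bracket determined by 𝒥 if and only if B * 𝒥 + 𝒥ᵀ * B = 0. -/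
open Matrix

noncomputable section

/-- The matrix `𝒥̄` on `Unit ⊕ Fin N` with lower-right block `𝒥` and zeros elsewhere. -/
def jbar {N : ℕ} (J : Matrix (Fin N) (Fin N) ℝ) :
    Matrix (Unit ⊕ Fin N) (Unit ⊕ Fin N) ℝ :=
  Matrix.fromBlocks 0 0 0 J

/-- The almost abelian Lie bracket determined by `𝒥`. -/
def aaBracket {N : ℕ} (J : Matrix (Fin N) (Fin N) ℝ)
    (x y : (Unit ⊕ Fin N) → ℝ) : (Unit ⊕ Fin N) → ℝ :=
  x (Sum.inl ()) • (jbar J).mulVec y - y (Sum.inl ()) • (jbar J).mulVec x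

/-- The 2-form associated to a matrix `B̄`. -/
def twoForm {N : ℕ} (B : Matrix (Unit ⊕ Fin N) (Unit ⊕ Fin N) ℝ)
    (x y : (Unit ⊕ Fin N) → ℝ) : ℝ :=
  x ⬝ᵥ B.mulVec y

/-- Closedness of the 2-form associated to `B̄` for the almost abelian bracket of `𝒥`. -/
def IsClosed2Form {N : ℕ} (J : Matrix (Fin N) (Fin N) ℝ)
    (B : Matrix (Unit ⊕ Fin N) (Unit ⊕ Fin N) ℝ) : Prop :=
  ∀ x y z : (Unit ⊕ Fin N) → ℝ,
    twoForm B x (aaBracket J y z) + twoForm B z (aaBracket J x y)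
      + twoForm B y (aaBracket J z x) = 0


theorem twoForm_jbar {N : ℕ} (J : Matrix (Fin N) (Fin N) ℝ)
    (B : Matrix (Unit ⊕ Fin N) (Unit ⊕ Fin N) ℝ) (x z : (Unit ⊕ Fin N) → ℝ) :
    x ⬝ᵥ B.mulVec ((jbar J).mulVec z) =
      x (Sum.inl ()) * (B.toBlocks₁₂ *ᵥ (J *ᵥ (z ∘ Sum.inr))) () +
      (x ∘ Sum.inr) ⬝ᵥ (B.toBlocks₂₂ * J) *ᵥ (z ∘ Sum.inr) := by
  have h1 : (jbar J).mulVec z = Sum.elim (0 : Unit → ℝ) (J *ᵥ (z ∘ Sum.inr)) := by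
    unfold jbar
    rw [Matrix.fromBlocks_mulVec]
    simp
  rw [h1, ← Matrix.mulVec_mulVec]
  simp [dotProduct, Matrix.mulVec, Matrix.toBlocks₁₂, Matrix.toBlocks₂₂]

theorem block_skew {N : ℕ} (J B : Matrix (Fin N) (Fin N) ℝ) (hB : Bᵀ = -B)
    (u v : Fin N → ℝ) :
    u ⬝ᵥ (B * J + Jᵀ * B) *ᵥ v = u ⬝ᵥ (B * J) *ᵥ v - v ⬝ᵥ (B * J) *ᵥ u := by
  have h : v ⬝ᵥ (B * J) *ᵥ u = u ⬝ᵥ (B * J)ᵀ *ᵥ v := by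
    rw [Matrix.mulVec_transpose, dotProduct_comm u, Matrix.dotProduct_mulVec]
  rw [h, Matrix.transpose_mul, hB, Matrix.add_mulVec, dotProduct_add]
  simp [Matrix.neg_mulVec]

theorem closed_sum {N : ℕ} (J : Matrix (Fin N) (Fin N) ℝ)
    (B : Matrix (Unit ⊕ Fin N) (Unit ⊕ Fin N) ℝ) (hskew : Bᵀ = -B)
    (x y z : (Unit ⊕ Fin N) → ℝ) :
    twoForm B x (aaBracket J y z) + twoForm B z (aaBracket J x y)
      + twoForm B y (aaBracket J z x) =
    y (Sum.inl ()) * ((x ∘ Sum.inr) ⬝ᵥ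
        (B.toBlocks₂₂ * J + Jᵀ * B.toBlocks₂₂) *ᵥ (z ∘ Sum.inr))
    - z (Sum.inl ()) * ((x ∘ Sum.inr) ⬝ᵥ
        (B.toBlocks₂₂ * J + Jᵀ * B.toBlocks₂₂) *ᵥ (y ∘ Sum.inr))
    - x (Sum.inl ()) * ((y ∘ Sum.inr) ⬝ᵥ
        (B.toBlocks₂₂ * J + Jᵀ * B.toBlocks₂₂) *ᵥ (z ∘ Sum.inr)) := by
  have hB : B.toBlocks₂₂ᵀ = -B.toBlocks₂₂ := by
    ext i j
    exact congrFun (congrFun hskew (Sum.inr i)) (Sum.inr j)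
  simp only [block_skew J _ hB, twoForm, aaBracket, Matrix.mulVec_sub, Matrix.mulVec_smul,
    dotProduct_sub, dotProduct_smul, twoForm_jbar, smul_eq_mul]
  ring

/-- The 2-form of `B̄` is closed iff the lower-right block `B` of `B̄` satisfies
`B * 𝒥 + 𝒥ᵀ * B = 0`. -/
theorem closed_iff_block_condition
    (N : ℕ) (hN : 1 ≤ N) (J : Matrix (Fin N) (Fin N) ℝ)
    (Bbar : Matrix (Unit ⊕ Fin N) (Unit ⊕ Fin N) ℝ) (hskew : Bbarᵀ = -Bbar) :
    IsClosed2Form J Bbar ↔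
      Bbar.toBlocks₂₂ * J + Jᵀ * Bbar.toBlocks₂₂ = 0 := by
  constructor
  · intro h
    ext i j
    have := h (Sum.elim 0 (Pi.single i 1)) (Sum.elim 1 0) (Sum.elim 0 (Pi.single j 1))
    rw [closed_sum J Bbar hskew] at this
    simp only [Sum.elim_comp_inr, Sum.elim_inl, Pi.zero_apply, Pi.one_apply, zero_mul, one_mul, sub_zero] at this
    simpa [-Matrix.add_apply] using this
  · intro h x y z
    rw [closed_sum J Bbar hskew, h]
    simp
end
end

section
/- Let N ≥ 1 and let 𝒥 be an N×N real matrix. There exists a skew-symmetric invertible real matrix B̄ indexed by Unit ⊕ Fin N whose associated 2-form is closed for the almost abelian bracket determined by 𝒥, if and only if there exists a skew-symmetric N×N real matrix B with B * 𝒥 + 𝒥ᵀ * B = 0 and rank B = N − 1. -/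
open Matrix

noncomputable section

theorem aux_closed {N : ℕ} (J B : Matrix (Fin N) (Fin N) ℝ) (c : Fin N → ℝ)
    (A : Matrix Unit Unit ℝ) (hB : Bᵀ = -B) :
    IsClosed2Form J (Matrix.fromBlocks A (-(Matrix.replicateRow Unit c))
      (Matrix.replicateCol Unit c) B) ↔ B * J + Jᵀ * B = 0 := by
  have key : ∀ u v : Fin N → ℝ,
      u ⬝ᵥ (B * J + Jᵀ * B) *ᵥ v = u ⬝ᵥ B *ᵥ (J *ᵥ v) - v ⬝ᵥ B *ᵥ (J *ᵥ u) := by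
    intro u v
    have h1 : v ⬝ᵥ B *ᵥ (J *ᵥ u) = - (u ⬝ᵥ Jᵀ *ᵥ (B *ᵥ v)) := by
      rw [Matrix.dotProduct_mulVec, ← Matrix.mulVec_transpose, hB, Matrix.dotProduct_mulVec,
        ← Matrix.mulVec_transpose, Matrix.neg_mulVec, Matrix.mulVec_neg, neg_dotProduct,
        dotProduct_comm]
    rw [h1, Matrix.add_mulVec, dotProduct_add, ← Matrix.mulVec_mulVec, ← Matrix.mulVec_mulVec]
    ring
  have br : ∀ x y : (Unit ⊕ Fin N) → ℝ, aaBracket J x y = Sum.elim (fun _ => 0)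
      (x (Sum.inl ()) • J *ᵥ (y ∘ Sum.inr) - y (Sum.inl ()) • J *ᵥ (x ∘ Sum.inr)) := by
    intro x y
    ext i
    rcases i with i | i <;> simp [aaBracket, jbar, Matrix.fromBlocks_mulVec]
  have tf : ∀ (x : (Unit ⊕ Fin N) → ℝ) (w : Fin N → ℝ),
      twoForm (Matrix.fromBlocks A (-(Matrix.replicateRow Unit c))
      (Matrix.replicateCol Unit c) B) x (Sum.elim (fun _ => 0) w)
      = - x (Sum.inl ()) * (c ⬝ᵥ w) + (x ∘ Sum.inr) ⬝ᵥ B *ᵥ w := by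
    intro x w
    have hz : ((fun _ => 0 : Unit → ℝ)) = 0 := rfl
    simp [twoForm, Matrix.fromBlocks_mulVec, dotProduct, hz, Matrix.mulVec, Matrix.neg_apply,
      Finset.sum_neg_distrib]
  constructor
  · intro h
    have h2 : ∀ u v : Fin N → ℝ, u ⬝ᵥ (B * J + Jᵀ * B) *ᵥ v = 0 := by
      intro u v
      have := h (Sum.elim (fun _ => 1) 0) (Sum.elim (fun _ => 0) v) (Sum.elim (fun _ => 0) u)
      rw [br, br, br, tf, tf, tf] at this
      simp [Matrix.mulVec_neg] at this
      rw [key, Matrix.mulVec_mulVec, Matrix.mulVec_mulVec]; linarith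
    ext i j
    have := h2 (Pi.single i 1) (Pi.single j 1)
    simpa using this
  · intro h x y z
    have k1 := key (x ∘ Sum.inr) (y ∘ Sum.inr)
    have k2 := key (y ∘ Sum.inr) (z ∘ Sum.inr)
    have k3 := key (z ∘ Sum.inr) (x ∘ Sum.inr)
    rw [h] at k1 k2 k3
    simp only [Matrix.zero_mulVec, dotProduct_zero] at k1 k2 k3
    rw [br, br, br, tf, tf, tf]
    simp only [Matrix.mulVec_sub, Matrix.mulVec_smul, dotProduct_sub, dotProduct_smul, smul_eq_mul]
    linear_combination z (Sum.inl ()) * k1 + x (Sum.inl ()) * k2 + y (Sum.inl ()) * k3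

theorem aux_mulVec {N : ℕ} (B : Matrix (Fin N) (Fin N) ℝ) (c : Fin N → ℝ)
    (a : ℝ) (w : Fin N → ℝ) :
    (Matrix.fromBlocks 0 (-(Matrix.replicateRow Unit c))
      (Matrix.replicateCol Unit c) B) *ᵥ (Sum.elim (fun _ => a) w)
      = Sum.elim (fun _ => -(c ⬝ᵥ w)) (a • c + B *ᵥ w) := by
  ext i
  rcases i with i | i <;>
    simp [Matrix.fromBlocks_mulVec, Matrix.mulVec, dotProduct, Finset.sum_neg_distrib, mul_comm]

theorem aux_isUnit {N : ℕ} (B : Matrix (Fin N) (Fin N) ℝ) (c : Fin N → ℝ) :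
    IsUnit (Matrix.fromBlocks 0 (-(Matrix.replicateRow Unit c))
      (Matrix.replicateCol Unit c) B) ↔
      ∀ (a : ℝ) (w : Fin N → ℝ), c ⬝ᵥ w = 0 → a • c + B *ᵥ w = 0 → a = 0 ∧ w = 0 := by
  rw [← Matrix.mulVec_injective_iff_isUnit, ← Matrix.coe_mulVecLin, injective_iff_map_eq_zero]
  simp only [Matrix.mulVecLin_apply]
  constructor
  · intro h a w h1 h2
    have := h (Sum.elim (fun _ => a) w) (by
      rw [aux_mulVec, h1, h2]; ext i; rcases i with i | i <;> simp)
    exact ⟨by simpa using congrFun this (Sum.inl ()),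
      by ext i; simpa using congrFun this (Sum.inr i)⟩
  · intro h x hx
    have e : x = Sum.elim (fun _ => x (Sum.inl ())) (x ∘ Sum.inr) := by
      ext i; rcases i with i | i <;> simp
    rw [e, aux_mulVec] at hx
    obtain ⟨h1, h2⟩ := h (x (Sum.inl ())) (x ∘ Sum.inr)
      (by simpa using congrFun hx (Sum.inl ()))
      (by ext i; simpa using congrFun hx (Sum.inr i))
    rw [e, h1, h2]; ext i; rcases i with i | i <;> simp

theorem aux_skew {N : ℕ} (B : Matrix (Fin N) (Fin N) ℝ) (hB : Bᵀ = -B) (u v : Fin N → ℝ) :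
    u ⬝ᵥ B *ᵥ v = - (v ⬝ᵥ B *ᵥ u) := by
  rw [Matrix.dotProduct_mulVec, ← Matrix.mulVec_transpose, hB, Matrix.neg_mulVec,
    neg_dotProduct, dotProduct_comm]

theorem aux_rank {N : ℕ} (hN : 1 ≤ N) (B : Matrix (Fin N) (Fin N) ℝ) :
    B.rank = N - 1 ↔ Module.finrank ℝ (LinearMap.ker B.mulVecLin) = 1 := by
  have := LinearMap.finrank_range_add_finrank_ker B.mulVecLin
  rw [Module.finrank_fin_fun] at this
  unfold Matrix.rank
  omega

/-- Existence of a symplectic (closed nondegenerate) form on the almost abelian Lie algebra of `𝒥`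
iff there is a skew-symmetric `N×N` solution of `B𝒥 + 𝒥ᵀB = 0` of rank `N - 1`. -/
theorem exists_symplectic_iff
    (N : ℕ) (hN : 1 ≤ N) (J : Matrix (Fin N) (Fin N) ℝ) :
    (∃ Bbar : Matrix (Unit ⊕ Fin N) (Unit ⊕ Fin N) ℝ,
        Bbarᵀ = -Bbar ∧ IsUnit Bbar ∧ IsClosed2Form J Bbar) ↔
      (∃ B : Matrix (Fin N) (Fin N) ℝ,
        Bᵀ = -B ∧ B * J + Jᵀ * B = 0 ∧ B.rank = N - 1) := by
  constructor
  · rintro ⟨Bbar, hs, hu, hc⟩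
    obtain ⟨B, hBd⟩ : ∃ B, B = Bbar.toBlocks₂₂ := ⟨_, rfl⟩
    obtain ⟨c, hcd⟩ : ∃ c : Fin N → ℝ, c = fun i => Bbar (Sum.inr i) (Sum.inl ()) := ⟨_, rfl⟩
    have hs' : ∀ i j, Bbar j i = - Bbar i j := fun i j => congrFun (congrFun hs i) j
    have e : Bbar = Matrix.fromBlocks 0 (-(Matrix.replicateRow Unit c))
      (Matrix.replicateCol Unit c) B := by
      ext i j
      rcases i with i | i <;> rcases j with j | j
      · have := hs' (Sum.inl ()) (Sum.inl ())
        simp; linarith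
      · simp [hcd]; exact hs' _ _
      · simp [hcd]
      · simp [hBd, Matrix.toBlocks₂₂]
    have hB : Bᵀ = -B := by
      ext i j
      simpa [hBd, Matrix.toBlocks₂₂] using hs' (Sum.inr i) (Sum.inr j)
    rw [e] at hu hc
    rw [aux_closed J B c 0 hB] at hc
    rw [aux_isUnit] at hu
    refine ⟨B, hB, hc, ?_⟩
    rw [aux_rank hN]
    -- a nonzero kernel vector
    obtain ⟨v, hv0, hv⟩ : ∃ v, v ≠ 0 ∧ B *ᵥ v = 0 := by
      by_contra! hcon
      have hinj : Function.Injective B.mulVecLin := by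
        rw [injective_iff_map_eq_zero]
        intro w hw
        by_contra h
        exact hcon w h hw
      obtain ⟨w, hw⟩ := (LinearMap.injective_iff_surjective.mp hinj) (-c)
      rw [Matrix.mulVecLin_apply] at hw
      have h0 : c ⬝ᵥ w = 0 := by
        have := aux_skew B hB w w
        rw [hw] at this
        simp [dotProduct_comm w c] at this
        linarith
      have := (hu 1 w h0 (by rw [hw]; simp)).1
      norm_num at this
    have hcv : c ⬝ᵥ v ≠ 0 := fun h => hv0 (hu 0 v h (by simp [hv])).2
    refine finrank_eq_one (⟨v, by simpa using hv⟩ : LinearMap.ker B.mulVecLin) ?_ ?_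
    · intro h; exact hv0 (congrArg Subtype.val h)
    · rintro ⟨w, hw⟩
      rw [LinearMap.mem_ker, Matrix.mulVecLin_apply] at hw
      refine ⟨(c ⬝ᵥ w) / (c ⬝ᵥ v), ?_⟩
      apply Subtype.ext
      have := (hu 0 (w - ((c ⬝ᵥ w) / (c ⬝ᵥ v)) • v)
        (by simp [dotProduct_sub, dotProduct_smul, hcv])
        (by simp [Matrix.mulVec_sub, Matrix.mulVec_smul, hw, hv])).2
      exact (sub_eq_zero.mp this).symm
  · rintro ⟨B, hB, hJ, hr⟩
    rw [aux_rank hN, finrank_eq_one_iff'] at hr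
    obtain ⟨⟨v, hv⟩, hv0, hspan⟩ := hr
    have hv0' : v ≠ 0 := fun h => hv0 (Subtype.ext h)
    rw [LinearMap.mem_ker, Matrix.mulVecLin_apply] at hv
    have hvv : v ⬝ᵥ v ≠ 0 := fun h => hv0' (dotProduct_self_eq_zero.mp h)
    refine ⟨Matrix.fromBlocks 0 (-(Matrix.replicateRow Unit v))
      (Matrix.replicateCol Unit v) B, ?_, ?_, (aux_closed J B v 0 hB).mpr hJ⟩
    · rw [Matrix.fromBlocks_transpose, Matrix.fromBlocks_neg, hB]
      simp
    · rw [aux_isUnit]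
      intro a w h1 h2
      have h3 : a = 0 := by
        have h4 := congrArg (fun t => v ⬝ᵥ t) h2
        simp only [dotProduct_add, dotProduct_smul, aux_skew B hB v w, hv, dotProduct_zero,
          smul_eq_mul, neg_zero, add_zero] at h4
        exact (mul_eq_zero.mp h4).resolve_right hvv
      refine ⟨h3, ?_⟩
      rw [h3, zero_smul, zero_add] at h2
      obtain ⟨t, ht⟩ := hspan ⟨w, by simpa using h2⟩
      have ht' : t • v = w := congrArg Subtype.val ht
      rw [← ht', dotProduct_smul, smul_eq_mul] at h1
      rw [← ht', (mul_eq_zero.mp h1).resolve_right hvv, zero_smul]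
end
end
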